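/- Let p be a prime with p > 5, p ∉ {7, 11, 19, 31}, and suppose p % 8 ∈ {1, 7} or p % 10 ∈ {1, 9} (i.e., p ≡ ±1 mod 8 or p ≡ ±1 mod 10). Then PSL(2,p) does not satisfy the replacement property. -/

import Mathlib

section Defs

variable {G : Type*} [Group G]

/-- `g` is a generating sequence of `G`: the set of its entries generates `G`. -/
def IsGenSeq {n : ℕ} (g : Fin n → G) : Prop :=
  Subgroup.closure (Set.range g) = ⊤

/-- `g` is irredundant: for each `i`, the entries other than `g i` do not generate `G`. -/
def IsIrred {n : ℕ} (g : Fin n → G) : Prop :=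
  ∀ i : Fin n, Subgroup.closure (g '' {j | j ≠ i}) ≠ ⊤

/-- `m(G)`: the largest length of an irredundant generating sequence of `G`. -/
noncomputable def maxIrredLen (G : Type*) [Group G] : ℕ :=
  sSup {n | ∃ g : Fin n → G, IsGenSeq g ∧ IsIrred g}

/-- `G` satisfies the replacement property. -/
def ReplacementProperty (G : Type*) [Group G] : Prop :=
  ∀ g : Fin (maxIrredLen G) → G, IsGenSeq g → IsIrred g →
    ∀ x : G, x ≠ 1 → ∃ i, IsGenSeq (Function.update g i x)

/-- `x` is a witness to failure of the replacement property for `G`. -/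
def IsWitnessToFailure {G : Type*} [Group G] (x : G) : Prop :=
  x ≠ 1 ∧ ∃ g : Fin (maxIrredLen G) → G, IsGenSeq g ∧ IsIrred g ∧
    ∀ i, ¬ IsGenSeq (Function.update g i x)

/-- A family of subgroups is in general position. -/
def InGeneralPosition {n : ℕ} (H : Fin n → Subgroup G) : Prop :=
  ∀ j, ¬ ((⨅ i ∈ ({j}ᶜ : Set (Fin n)), H i) ≤ H j)

/-- The sequence of subgroups `M` corresponds to the sequence of elements `g`. -/
def Corresponds {n : ℕ} (M : Fin n → Subgroup G) (g : Fin n → G) : Prop :=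
  (∀ i j, j ≠ i → g i ∈ M j) ∧ ∀ i, g i ∉ M i

end Defs

/-- `PSL(2,p)`. -/
abbrev PSL (p : ℕ) : Type := Matrix.ProjectiveSpecialLinearGroup (Fin 2) (ZMod p)

namespace PSLRep
open Matrix

abbrev Mat (K : Type*) [Field K] := Matrix (Fin 2) (Fin 2) K
abbrev SL2 (K : Type*) [Field K] := Matrix.SpecialLinearGroup (Fin 2) K

section Lines
variable {K : Type*} [Field K]

/-- The scaled traceless part of a matrix; it spans the rotation axis of `h`. -/
def axis (h : Mat K) : Mat K := (2 : K) • h - h.trace • 1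

def br (v w : Mat K) : Mat K := v * w - w * v

/-- Conjugation by `g` preserves the line spanned by `v`. -/
def Fixes (g : SL2 K) (v : Mat K) : Prop := ∃ c : K, (g : Mat K) * v = c • (v * g)

/-- All elements of `H` preserve a common line of traceless matrices. -/
def LType (H : Subgroup (SL2 K)) : Prop :=
  ∃ v : Mat K, v ≠ 0 ∧ v.trace = 0 ∧ ∀ h ∈ H, Fixes h v

lemma mat_ext_iff {A B : Mat K} :
    A = B ↔ A 0 0 = B 0 0 ∧ A 0 1 = B 0 1 ∧ A 1 0 = B 1 0 ∧ A 1 1 = B 1 1 := by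
  constructor
  · rintro rfl; simp
  · rintro ⟨h1, h2, h3, h4⟩
    ext i j; fin_cases i <;> fin_cases j <;> assumption

lemma trace_axis (h : Mat K) : (axis h).trace = 0 := by
  simp [axis, trace_fin_two]; ring

lemma trace_br (v w : Mat K) : (br v w).trace = 0 := by
  simp [br, trace_mul_comm v w]

lemma traceless_iff {v : Mat K} : v.trace = 0 ↔ v 1 1 = -v 0 0 := by
  rw [trace_fin_two, add_comm, eq_neg_iff_add_eq_zero]

lemma det_entries (g : SL2 K) : g.1 0 0 * g.1 1 1 - g.1 0 1 * g.1 1 0 = 1 := by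
  have := g.2; rwa [det_fin_two] at this

lemma exists_smul_of_comm (h2 : (2 : K) ≠ 0) {A v : Mat K} (hA : A.trace = 0) (hv : v.trace = 0)
    (hA0 : A ≠ 0) (h : A * v = v * A) : ∃ c : K, v = c • A := by
  rw [traceless_iff] at hA hv
  simp only [mat_ext_iff, mul_apply, Fin.sum_univ_two, hA, hv] at h
  obtain ⟨e1, e2, e3, -⟩ := h
  have f2 : A 0 0 * v 0 1 = A 0 1 * v 0 0 := by
    apply mul_left_cancel₀ h2; linear_combination e2
  have f3 : A 0 0 * v 1 0 = A 1 0 * v 0 0 := by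
    apply mul_left_cancel₀ h2; linear_combination -e3
  have f1 : A 0 1 * v 1 0 = A 1 0 * v 0 1 := by linear_combination e1
  by_cases ha : A 0 0 = 0
  · by_cases hb : A 0 1 = 0
    · have hc : A 1 0 ≠ 0 := fun hc => hA0 (mat_ext_iff.2 (by simp [ha, hb, hc, hA]))
      refine ⟨v 1 0 / A 1 0, mat_ext_iff.2 ?_⟩
      have g1 : v 0 0 = 0 := by
        apply mul_left_cancel₀ hc; rw [← f3, ha]; ring
      have g2 : v 0 1 = 0 := by
        apply mul_left_cancel₀ hc; rw [← f1, hb]; ring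
      simp [ha, hb, hA, hv, g1, g2, hc]
    · refine ⟨v 0 1 / A 0 1, mat_ext_iff.2 ?_⟩
      have g1 : v 0 0 = 0 := by
        apply mul_left_cancel₀ hb; rw [← f2, ha]; ring
      simp only [Matrix.smul_apply, smul_eq_mul, ha, hA, hv, g1]
      refine ⟨by ring, by field_simp, ?_, by ring⟩
      field_simp; linear_combination f1
  · refine ⟨v 0 0 / A 0 0, mat_ext_iff.2 ?_⟩
    simp only [Matrix.smul_apply, smul_eq_mul, hA, hv]
    refine ⟨by field_simp, ?_, ?_, by field_simp⟩
    · field_simp; linear_combination f2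
    · field_simp; linear_combination f3

lemma SL2.mul_inv_mat (g : SL2 K) : (g : Mat K) * ((g⁻¹ : SL2 K) : Mat K) = 1 := by
  rw [← Matrix.SpecialLinearGroup.coe_mul, mul_inv_cancel]; rfl

lemma SL2.inv_mul_mat (g : SL2 K) : ((g⁻¹ : SL2 K) : Mat K) * (g : Mat K) = 1 := by
  rw [← Matrix.SpecialLinearGroup.coe_mul, inv_mul_cancel]; rfl

lemma SL2.mat_left_cancel (g : SL2 K) {A B : Mat K} (h : (g : Mat K) * A = g * B) : A = B := by
  rw [← one_mul A, ← one_mul B, ← g.inv_mul_mat, mul_assoc, mul_assoc, h]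

lemma SL2.mat_right_cancel (g : SL2 K) {A B : Mat K} (h : A * (g : Mat K) = B * g) : A = B := by
  rw [← mul_one A, ← mul_one B, ← g.mul_inv_mat, ← mul_assoc, ← mul_assoc, h]

lemma fixes_mul {g h : SL2 K} {v : Mat K} (hg : Fixes g v) (hh : Fixes h v) : Fixes (g * h) v := by
  obtain ⟨c, hc⟩ := hg
  obtain ⟨d, hd⟩ := hh
  refine ⟨c * d, ?_⟩
  rw [Matrix.SpecialLinearGroup.coe_mul, mul_assoc, hd, mul_smul_comm, ← mul_assoc, hc, smul_mul_assoc,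
    smul_smul, mul_assoc, mul_comm d c]

lemma fixes_one (v : Mat K) : Fixes 1 v := ⟨1, by simp⟩

lemma fixes_neg_one (v : Mat K) : Fixes (-1) v := ⟨1, by simp⟩

lemma fixes_inv {g : SL2 K} {v : Mat K} (hg : Fixes g v) : Fixes g⁻¹ v := by
  obtain ⟨c, hc⟩ := hg
  by_cases h0 : c = 0
  · have : v = 0 := g.mat_left_cancel (by simp [hc, h0])
    exact ⟨1, by simp [this]⟩
  refine ⟨c⁻¹, g.mat_right_cancel (g.mat_left_cancel ?_)⟩
  have e : (g : Mat K) * ((g⁻¹ : SL2 K) * v * g) = v * g := by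
    rw [← mul_assoc, ← mul_assoc, g.mul_inv_mat, one_mul]
  rw [e, smul_mul_assoc, mul_smul_comm, mul_assoc v, g.inv_mul_mat, mul_one, hc, smul_smul,
    inv_mul_cancel₀ h0, one_smul]

/-- The stabilizer of the line spanned by `v`. -/
def lineStab (v : Mat K) : Subgroup (SL2 K) where
  carrier := {g | Fixes g v}
  mul_mem' := fixes_mul
  one_mem' := fixes_one v
  inv_mem' := fixes_inv

lemma fixes_br {g : SL2 K} {v w : Mat K} (hv : Fixes g v) (hw : Fixes g w) :
    Fixes g (br v w) := by
  obtain ⟨c, hc⟩ := hv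
  obtain ⟨d, hd⟩ := hw
  refine ⟨c * d, ?_⟩
  simp only [br, mul_sub, sub_mul, smul_sub]
  congr 1
  · rw [← mul_assoc, hc, smul_mul_assoc, mul_assoc, hd, mul_smul_comm, smul_smul, mul_assoc]
  · rw [← mul_assoc, hd, smul_mul_assoc, mul_assoc, hc, mul_smul_comm, smul_smul, mul_assoc,
      mul_comm d c]

lemma fixes_smul {g : SL2 K} {v : Mat K} (h : Fixes g v) (a : K) : Fixes g (a • v) := by
  obtain ⟨c, hc⟩ := h
  exact ⟨c, by rw [mul_smul_comm, hc, smul_mul_assoc, smul_comm]⟩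

lemma fixes_of_smul {g : SL2 K} {v : Mat K} {a : K} (ha : a ≠ 0) (h : Fixes g (a • v)) :
    Fixes g v := by
  simpa [smul_smul, inv_mul_cancel₀ ha] using fixes_smul h a⁻¹

lemma trace_mul_of_fixes {g : SL2 K} {v w : Mat K} {c d : K} (hv : (g : Mat K) * v = c • (v * g))
    (hw : (g : Mat K) * w = d • (w * g)) : (v * w).trace = c * d * (v * w).trace := by
  have : (g : Mat K) * (v * w) = (c * d) • (v * w * g) := by
    rw [← mul_assoc, hv, smul_mul_assoc, mul_assoc, hw, mul_smul_comm, smul_smul, mul_assoc]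
  have h2 : v * w = (c * d) • ((g⁻¹ : SL2 K) * (v * w * g)) := by
    apply g.mat_left_cancel
    rw [this, mul_smul_comm, ← mul_assoc (g : Mat K), g.mul_inv_mat, one_mul]
  calc (v * w).trace = ((c * d) • ((g⁻¹ : SL2 K) * (v * w * g))).trace := by rw [← h2]
    _ = c * d * (v * w).trace := by
      rw [trace_smul, smul_eq_mul, trace_mul_comm, mul_assoc (v * w), g.mul_inv_mat, mul_one]

lemma comm_axis {g v : Mat K} : g * v = v * g → axis g * v = v * axis g := by
  intro h; simp [axis, sub_mul, mul_sub, h]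

lemma br_eq_zero {v w : Mat K} : br v w = 0 ↔ v * w = w * v := sub_eq_zero

lemma br_ne_zero (h2 : (2 : K) ≠ 0) {v w : Mat K} (hv : v.trace = 0) (hw : w.trace = 0)
    (hw0 : w ≠ 0) {g : SL2 K} (hgw : Fixes g w) (hgv : ¬ Fixes g v) : br w v ≠ 0 := by
  intro h
  obtain ⟨c, rfl⟩ := exists_smul_of_comm h2 hw hv hw0 (br_eq_zero.1 h)
  exact hgv (fixes_smul hgw c)

lemma exists_smul_of_comm' (h2 : (2 : K) ≠ 0) {A v : Mat K} (hA : A.trace = 0) (hv : v.trace = 0)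
    (hA0 : A ≠ 0) (hv0 : v ≠ 0) (h : A * v = v * A) : ∃ c : K, c ≠ 0 ∧ v = c • A := by
  obtain ⟨c, rfl⟩ := exists_smul_of_comm h2 hA hv hA0 h
  exact ⟨c, by rintro rfl; simp at hv0, rfl⟩

/-- Three distinct lines, each fixed by all but one of the generators, force a common
fixed line. -/
lemma exists_common_line (h2 : (2 : K) ≠ 0) {g₁ g₂ g₃ g₄ : SL2 K} {v₁ v₂ v₃ : Mat K}
    (ha : axis (g₄ : Mat K) ≠ 0)
    (t₁ : v₁.trace = 0) (t₂ : v₂.trace = 0) (t₃ : v₃.trace = 0)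
    (n₁ : v₁ ≠ 0) (n₂ : v₂ ≠ 0) (n₃ : v₃ ≠ 0)
    (f₁₂ : Fixes g₁ v₂) (f₁₃ : Fixes g₁ v₃) (f₂₁ : Fixes g₂ v₁) (f₂₃ : Fixes g₂ v₃)
    (f₃₁ : Fixes g₃ v₁) (f₃₂ : Fixes g₃ v₂) (f₄₁ : Fixes g₄ v₁) (f₄₂ : Fixes g₄ v₂)
    (f₄₃ : Fixes g₄ v₃) (m₁ : ¬ Fixes g₁ v₁) (m₂ : ¬ Fixes g₂ v₂) (m₃ : ¬ Fixes g₃ v₃) :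
    ∃ v : Mat K, v ≠ 0 ∧ v.trace = 0 ∧ Fixes g₁ v ∧ Fixes g₂ v ∧ Fixes g₃ v ∧
      ∀ g, Fixes g v₁ → Fixes g v₂ → Fixes g v₃ → Fixes g v := by
  have b12 : br v₁ v₂ ≠ 0 := br_ne_zero h2 t₂ t₁ n₁ f₂₁ m₂
  have b13 : br v₁ v₃ ≠ 0 := br_ne_zero h2 t₃ t₁ n₁ f₃₁ m₃
  have b23 : br v₂ v₃ ≠ 0 := br_ne_zero h2 t₃ t₂ n₂ f₃₂ m₃
  by_cases hD : (v₁ * br v₂ v₃).trace = 0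
  · have e2 : br v₁ v₂ * br v₁ v₃ = br v₁ v₃ * br v₁ v₂ := by
      rw [traceless_iff] at t₁ t₂ t₃
      simp only [br, trace_fin_two, mul_apply, Fin.sum_univ_two, Matrix.sub_apply, t₁, t₂, t₃] at hD
      simp only [br, mat_ext_iff, mul_apply, Fin.sum_univ_two, Matrix.sub_apply, t₁, t₂, t₃]
      refine ⟨?_, ?_, ?_, ?_⟩
      · linear_combination (-2) * v₁ 0 0 * hD
      · linear_combination (-2) * v₁ 0 1 * hD
      · linear_combination (-2) * v₁ 1 0 * hD
      · linear_combination (2) * v₁ 0 0 * hD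
    have e1 : br v₁ v₂ * br v₂ v₃ = br v₂ v₃ * br v₁ v₂ := by
      rw [traceless_iff] at t₁ t₂ t₃
      simp only [br, trace_fin_two, mul_apply, Fin.sum_univ_two, Matrix.sub_apply, t₁, t₂, t₃] at hD
      simp only [br, mat_ext_iff, mul_apply, Fin.sum_univ_two, Matrix.sub_apply, t₁, t₂, t₃]
      refine ⟨?_, ?_, ?_, ?_⟩
      · linear_combination (-2) * v₂ 0 0 * hD
      · linear_combination (-2) * v₂ 0 1 * hD
      · linear_combination (-2) * v₂ 1 0 * hD
      · linear_combination (2) * v₂ 0 0 * hD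
    obtain ⟨c, hc, hc'⟩ := exists_smul_of_comm' h2 (trace_br _ _) (trace_br _ _) b12 b13 e2
    obtain ⟨d, hd, hd'⟩ := exists_smul_of_comm' h2 (trace_br _ _) (trace_br _ _) b12 b23 e1
    refine ⟨br v₁ v₂, b12, trace_br _ _, ?_, ?_, fixes_br f₃₁ f₃₂, fun g h1 h2 _ => fixes_br h1 h2⟩
    · exact fixes_of_smul hd (hd' ▸ fixes_br f₁₂ f₁₃)
    · exact fixes_of_smul hc (hc' ▸ fixes_br f₂₁ f₂₃)
  exfalso
  have cramer : (v₁ * br v₂ v₃).trace • axis (g₄ : Mat K)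
      = (axis (g₄ : Mat K) * br v₂ v₃).trace • v₁ + (axis (g₄ : Mat K) * br v₃ v₁).trace • v₂
        + (axis (g₄ : Mat K) * br v₁ v₂).trace • v₃ := by
    have t₄ := trace_axis (g₄ : Mat K)
    generalize axis (g₄ : Mat K) = w at t₄
    rw [traceless_iff] at t₁ t₂ t₃ t₄
    simp only [br, mat_ext_iff, mul_apply, Fin.sum_univ_two, Matrix.sub_apply, t₁, t₂, t₃, t₄, Matrix.add_apply,
      Matrix.smul_apply, smul_eq_mul, trace_fin_two]
    refine ⟨?_, ?_, ?_, ?_⟩ <;> ring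
  have ax : (g₄ : Mat K) * axis g₄ = (1 : K) • (axis (g₄ : Mat K) * (g₄ : Mat K)) := by
    simp [axis, mul_sub, sub_mul]
  have key : ∀ {x y z : Mat K} {g : SL2 K}, x.trace = 0 → x ≠ 0 → br y z ≠ 0 →
      Fixes g₄ x → Fixes g₄ y → Fixes g₄ z → (x * br y z).trace ≠ 0 →
      Fixes g y → Fixes g z → ¬ Fixes g x → (axis (g₄ : Mat K) * br y z).trace = 0 := by
    intro x y z g tx nx hyz fx fy fz hD gy gz gx
    by_contra hne
    obtain ⟨a, ha'⟩ := fx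
    obtain ⟨b, hb⟩ := fixes_br fy fz
    have e1 := trace_mul_of_fixes ax hb
    have e2 := trace_mul_of_fixes ha' hb
    rw [one_mul] at e1
    have hb1 : b = 1 := by
      apply mul_right_cancel₀ hne; rw [one_mul]; exact e1.symm
    have ha1 : a = 1 := by
      apply mul_right_cancel₀ hD; rw [one_mul, ← mul_one a, ← hb1]; exact e2.symm
    rw [ha1, one_smul] at ha'
    rw [hb1, one_smul] at hb
    obtain ⟨c, hc, rfl⟩ := exists_smul_of_comm' h2 (trace_axis _) tx ha nx (comm_axis ha')
    obtain ⟨d, hd, hd'⟩ :=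
      exists_smul_of_comm' h2 (trace_axis _) (trace_br y z) ha hyz (comm_axis hb)
    exact gx (fixes_smul (fixes_of_smul hd (hd' ▸ fixes_br gy gz)) c)
  have D2 : (v₂ * br v₃ v₁).trace = (v₁ * br v₂ v₃).trace := by
    simp only [br, trace_fin_two, mul_apply, Fin.sum_univ_two, Matrix.sub_apply]; ring
  have D3 : (v₃ * br v₁ v₂).trace = (v₁ * br v₂ v₃).trace := by
    simp only [br, trace_fin_two, mul_apply, Fin.sum_univ_two, Matrix.sub_apply]; ring
  have b31 : br v₃ v₁ ≠ 0 := by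
    rw [Ne, br_eq_zero] at b13 ⊢; exact fun h => b13 h.symm
  rw [key t₁ n₁ b23 f₄₁ f₄₂ f₄₃ hD f₁₂ f₁₃ m₁,
    key t₂ n₂ b31 f₄₂ f₄₃ f₄₁ (D2 ▸ hD) f₂₃ f₂₁ m₂,
    key t₃ n₃ b12 f₄₃ f₄₁ f₄₂ (D3 ▸ hD) f₃₁ f₃₂ m₃] at cramer
  simp [hD, ha] at cramer

end Lines

section Transvections
variable {K : Type*} [Field K]

def upper (x : K) : SL2 K := ⟨!![1, x; 0, 1], by simp [det_fin_two]⟩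
def lower (x : K) : SL2 K := ⟨!![1, 0; x, 1], by simp [det_fin_two]⟩

lemma sl2_ext_iff {g h : SL2 K} : g = h ↔ g.1 0 0 = h.1 0 0 ∧ g.1 0 1 = h.1 0 1 ∧
    g.1 1 0 = h.1 1 0 ∧ g.1 1 1 = h.1 1 1 :=
  Subtype.ext_iff.trans mat_ext_iff

lemma mul_entry (g h : SL2 K) (i j : Fin 2) :
    (g * h).1 i j = g.1 i 0 * h.1 0 j + g.1 i 1 * h.1 1 j := by
  change (g.1 * h.1) i j = _
  simp [Matrix.mul_apply]

lemma mat_mul_entry (g h : Mat K) (i j : Fin 2) :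
    (g * h) i j = g i 0 * h 0 j + g i 1 * h 1 j := by
  simp [Matrix.mul_apply]

lemma one_entries : (1 : SL2 K).1 0 0 = 1 ∧ (1 : SL2 K).1 0 1 = 0 ∧ (1 : SL2 K).1 1 0 = 0 ∧
    (1 : SL2 K).1 1 1 = 1 := ⟨rfl, rfl, rfl, rfl⟩

lemma upper_entries (x : K) : (upper x).1 0 0 = 1 ∧ (upper x).1 0 1 = x ∧ (upper x).1 1 0 = 0 ∧
    (upper x).1 1 1 = 1 := ⟨rfl, rfl, rfl, rfl⟩

lemma lower_entries (x : K) : (lower x).1 0 0 = 1 ∧ (lower x).1 0 1 = 0 ∧ (lower x).1 1 0 = x ∧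
    (lower x).1 1 1 = 1 := ⟨rfl, rfl, rfl, rfl⟩

lemma mem_of_transvections {H : Subgroup (SL2 K)} (hU : ∀ x, upper x ∈ H)
    (hL : ∀ x, lower x ∈ H) (g : SL2 K) : g ∈ H := by
  have main : ∀ g : SL2 K, g.1 1 0 ≠ 0 → g ∈ H := by
    intro g hc
    have hd := det_entries g
    have : g = upper ((g.1 0 0 - 1) / g.1 1 0) * lower (g.1 1 0)
        * upper ((g.1 1 1 - 1) / g.1 1 0) := by
      rw [sl2_ext_iff]
      simp only [mul_entry, upper_entries, lower_entries]
      field_simp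
      refine ⟨by ring, ?_, by ring, by ring⟩
      linear_combination -hd
    rw [this]
    exact H.mul_mem (H.mul_mem (hU _) (hL _)) (hU _)
  by_cases hc : g.1 1 0 = 0
  · have h1 : lower 1 * g ∈ H := by
      apply main
      have hd := det_entries g
      simp only [mul_entry, lower_entries, hc]
      rw [hc] at hd
      intro h
      have h' : g.1 0 0 = 0 := by linear_combination h
      simp [h'] at hd
    simpa using H.mul_mem (H.inv_mem (hL 1)) h1
  · exact main g hc

lemma not_lType_top (h2 : (2 : K) ≠ 0) : ¬ LType (⊤ : Subgroup (SL2 K)) := by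
  rintro ⟨v, hv, ht, hf⟩
  obtain ⟨c, hc⟩ := hf (upper 1) trivial
  obtain ⟨d, hd⟩ := hf (lower 1) trivial
  rw [traceless_iff] at ht
  simp only [mat_ext_iff, mat_mul_entry, Matrix.smul_apply, smul_eq_mul, upper_entries,
    lower_entries, ht] at hc hd
  obtain ⟨c1, c2, c3, c4⟩ := hc
  obtain ⟨d1, d2, d3, d4⟩ := hd
  have hz : v 1 0 = 0 := by
    by_contra hz
    have : c = 1 := by apply mul_right_cancel₀ hz; linear_combination -c3
    subst this; exact hz (by linear_combination c1)
  have hy : v 0 1 = 0 := by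
    by_contra hz
    have : d = 1 := by apply mul_right_cancel₀ hz; linear_combination -d2
    subst this; exact hz (by linear_combination -d1)
  have hx : v 0 0 = 0 := by
    by_contra hx
    have : c = 1 := by apply mul_right_cancel₀ hx; linear_combination -c1 + hz
    subst this
    apply hx; apply mul_left_cancel₀ h2; linear_combination -c2
  exact hv (mat_ext_iff.2 (by simp [hx, hy, hz, ht]))

lemma exists_conj_upper {A : Mat K} (ht : A.trace = 0) (hd : A.det = 0) :
    ∃ (P : SL2 K) (b : K), A * P = P * !![0, b; 0, 0] := by
  rw [traceless_iff] at ht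
  rw [det_fin_two, ht] at hd
  by_cases hc : A 1 0 = 0
  · have ha : A 0 0 = 0 := by
      rw [hc] at hd; simpa using hd
    exact ⟨1, A 0 1, by simp [mat_ext_iff, hc, ha, ht]⟩
  · refine ⟨⟨!![A 0 0, -(A 1 0)⁻¹; A 1 0, 0], by simp [det_fin_two, hc]⟩, -(A 1 0)⁻¹, ?_⟩
    simp [mat_ext_iff, mat_mul_entry, ht]
    exact ⟨by linear_combination -hd, by ring⟩

end Transvections

section Prime
variable {p : ℕ} [Fact p.Prime]

lemma trace_eq_two_of_pow {u : SL2 (ZMod p)} (hu : u ^ p = 1) : (u : Mat (ZMod p)).trace = 2 := by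
  have h1 : ((u : Mat (ZMod p)) - 1) ^ p = 0 := by
    rw [sub_pow_char_of_commute p (Commute.one_right _), ← Matrix.SpecialLinearGroup.coe_pow, hu]
    simp
  have h2 : ((u : Mat (ZMod p)) - 1).det = 0 := by
    have := congrArg det h1
    rw [det_pow] at this
    simpa [(Fact.out : p.Prime).ne_zero] using this
  have h3 := det_entries u
  rw [det_fin_two] at h2
  simp at h2
  rw [trace_fin_two]
  linear_combination h3 - h2

lemma pow_unipotent {u : SL2 (ZMod p)} {A : Mat (ZMod p)} (hA : (u : Mat (ZMod p)) = 1 + A)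
    (h0 : A * A = 0) (n : ℕ) : ((u ^ n : SL2 (ZMod p)) : Mat (ZMod p)) = 1 + (n : ZMod p) • A := by
  induction n with
  | zero => simp
  | succ n ih =>
    rw [pow_succ, Matrix.SpecialLinearGroup.coe_mul, ih, hA]
    simp [mul_add, add_mul, h0, add_smul]; abel

lemma pow_upper (b : ZMod p) (n : ℕ) : upper b ^ n = upper (n * b) := by
  induction n with
  | zero => simp [sl2_ext_iff, upper_entries, one_entries]
  | succ n ih =>
    rw [pow_succ, ih, sl2_ext_iff]
    simp only [mul_entry, upper_entries]
    push_cast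
    refine ⟨by ring, by ring, by ring, by ring⟩

lemma pow_lower (b : ZMod p) (n : ℕ) : lower b ^ n = lower (n * b) := by
  induction n with
  | zero => simp [sl2_ext_iff, lower_entries, one_entries]
  | succ n ih =>
    rw [pow_succ, ih, sl2_ext_iff]
    simp only [mul_entry, lower_entries]
    push_cast
    refine ⟨by ring, by ring, by ring, by ring⟩

lemma upper_mem {H : Subgroup (SL2 (ZMod p))} {b : ZMod p} (hb : b ≠ 0) (h : upper b ∈ H)
    (x : ZMod p) : upper x ∈ H := by
  have := H.pow_mem h (x / b).val
  rwa [pow_upper, ZMod.natCast_zmod_val, div_mul_cancel₀ _ hb] at this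

lemma lower_mem {H : Subgroup (SL2 (ZMod p))} {b : ZMod p} (hb : b ≠ 0) (h : lower b ∈ H)
    (x : ZMod p) : lower x ∈ H := by
  have := H.pow_mem h (x / b).val
  rwa [pow_lower, ZMod.natCast_zmod_val, div_mul_cancel₀ _ hb] at this

lemma eq_top_of_upper {H : Subgroup (SL2 (ZMod p))} {b : ZMod p} (hb : b ≠ 0) (h : upper b ∈ H)
    {k : SL2 (ZMod p)} (hk : k ∈ H) (hc : k.1 1 0 ≠ 0) : H = ⊤ := by
  have hU := upper_mem hb h
  have hd := det_entries k
  have key : k * upper (-b) * k⁻¹ ∈ H := H.mul_mem (H.mul_mem hk (hU _)) (H.inv_mem hk)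
  have key2 := H.mul_mem (H.mul_mem (hU (-(k.1 0 0 / k.1 1 0))) key)
    (H.inv_mem (hU (-(k.1 0 0 / k.1 1 0))))
  have e : upper (-(k.1 0 0 / k.1 1 0)) * (k * upper (-b) * k⁻¹) *
      (upper (-(k.1 0 0 / k.1 1 0)))⁻¹ = lower (b * (k.1 1 0) ^ 2) := by
    rw [mul_inv_eq_iff_eq_mul, ← mul_assoc, mul_inv_eq_iff_eq_mul, sl2_ext_iff]
    simp only [mul_entry, upper_entries, lower_entries]
    field_simp
    refine ⟨?_, ?_, ?_, ?_⟩
    all_goals first | ring1 | linear_combination (b * k.1 1 0) * hd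
  rw [e] at key2
  rw [eq_top_iff]
  intro g _
  exact mem_of_transvections hU (lower_mem (by positivity) key2) g

/-- A subgroup of order divisible by `p` is everything or fixes a line. -/
lemma lType_or_eq_top_of_dvd_card {H : Subgroup (SL2 (ZMod p))} (hp : p ∣ Nat.card H) :
    LType H ∨ H = ⊤ := by
  obtain ⟨u, hu⟩ := exists_prime_orderOf_dvd_card' p hp
  have hup : (u : SL2 (ZMod p)) ^ p = 1 := by
    have := pow_orderOf_eq_one u
    rw [hu] at this
    exact_mod_cast congrArg Subtype.val this
  have hu1 : (u : SL2 (ZMod p)) ≠ 1 := by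
    intro h
    have : u = 1 := Subtype.ext h
    rw [this, orderOf_one] at hu
    exact (Fact.out : p.Prime).one_lt.ne hu
  set A : Mat (ZMod p) := ((u : SL2 (ZMod p)) : Mat (ZMod p)) - 1 with hA
  have htr : A.trace = 0 := by
    rw [hA, trace_sub, trace_eq_two_of_pow hup]; simp
  have hdet : A.det = 0 := by
    have h1 := det_entries (u : SL2 (ZMod p))
    have h2 := trace_eq_two_of_pow hup
    rw [trace_fin_two] at h2
    rw [hA, det_fin_two]; simp; linear_combination h1 - h2
  have hA0 : A ≠ 0 := fun h => hu1 (Subtype.ext (sub_eq_zero.1 h))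
  obtain ⟨P, b, hP⟩ := exists_conj_upper htr hdet
  have hb : b ≠ 0 := by
    rintro rfl
    apply hA0
    apply P.mat_right_cancel
    rw [hP]
    simp [mat_ext_iff, mat_mul_entry]
  have huP : u * P = P * upper b := by
    apply Subtype.ext
    have : ((u : SL2 (ZMod p)) : Mat (ZMod p)) = 1 + A := by simp [hA]
    rw [Matrix.SpecialLinearGroup.coe_mul, Matrix.SpecialLinearGroup.coe_mul, this, add_mul, hP,
      one_mul]
    simp only [mat_ext_iff, mat_mul_entry, upper_entries, Matrix.add_apply]
    simp [add_comm]
  set H' := H.comap (MulAut.conj P).toMonoidHom with hH'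
  have hmem : ∀ k, k ∈ H' ↔ P * k * P⁻¹ ∈ H := fun k => by simp [hH', Subgroup.mem_comap]
  have hub : upper b ∈ H' := by
    rw [hmem, ← huP]; simp
  by_cases hall : ∀ k ∈ H', k.1 1 0 = 0
  · left
    refine ⟨A, hA0, htr, fun h hh => ?_⟩
    have h10 := hall (P⁻¹ * h * P) (by rw [hmem]; simpa [mul_assoc] using hh)
    set k := P⁻¹ * h * P with hk
    have hk' : h * P = P * k := by rw [hk]; group
    have hk'' : (h : Mat (ZMod p)) * P = P * (k : Mat (ZMod p)) := by
      rw [← Matrix.SpecialLinearGroup.coe_mul, hk', Matrix.SpecialLinearGroup.coe_mul]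
    have hd := det_entries k
    rw [h10] at hd
    refine ⟨k.1 0 0 ^ 2, P.mat_right_cancel ?_⟩
    rw [mul_assoc, hP, ← mul_assoc, hk'', smul_mul_assoc, mul_assoc A, hk'', ← mul_assoc A, hP,
      mul_assoc, mul_assoc, ← mul_smul_comm]
    congr 1
    simp only [mat_ext_iff, mat_mul_entry, Matrix.smul_apply, smul_eq_mul, h10]
    simp
    linear_combination (-k.1 0 0) * b * hd
  · right
    push Not at hall
    obtain ⟨k, hk, hk0⟩ := hall
    have := eq_top_of_upper hb hub hk hk0
    rw [eq_top_iff]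
    intro g _
    have hg : P⁻¹ * g * P ∈ H' := this ▸ Subgroup.mem_top _
    rw [hmem] at hg
    simpa [mul_assoc] using hg

end Prime

section Counting

lemma orbit_arith_sorted {a b c l m n M : ℕ} (ha : a * l = M) (hb : b * m = M) (hc : c * n = M)
    (hl : 2 ≤ l) (hlm : l ≤ m) (hmn : m ≤ n) (hs : M + 2 = a + b + c) :
    c ≤ 2 ∨ (M = 12 ∧ l = 2 ∧ m = 3 ∧ n = 3) ∨ (M = 24 ∧ l = 2 ∧ m = 3 ∧ n = 4) ∨
      (M = 60 ∧ l = 2 ∧ m = 3 ∧ n = 5) := by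
  by_cases hc2 : c ≤ 2
  · exact Or.inl hc2
  right
  obtain rfl | hl3 : l = 2 ∨ 3 ≤ l := by omega
  swap
  · have := Nat.mul_le_mul_left a hl3
    have := Nat.mul_le_mul_left b (hl3.trans hlm)
    have := Nat.mul_le_mul_left c ((hl3.trans hlm).trans hmn)
    omega
  obtain rfl | rfl | hm4 : m = 2 ∨ m = 3 ∨ 4 ≤ m := by omega
  · omega
  · obtain rfl | rfl | rfl | hn6 : n = 3 ∨ n = 4 ∨ n = 5 ∨ 6 ≤ n := by omega
    · omega
    · omega
    · omega
    · have := Nat.mul_le_mul_left c hn6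
      omega
  · have := Nat.mul_le_mul_left b hm4
    have := Nat.mul_le_mul_left c (hm4.trans hmn)
    omega

lemma orbit_arith_three {a b c l m n M : ℕ} (ha : a * l = M) (hb : b * m = M) (hc : c * n = M)
    (hl : 2 ≤ l) (hm : 2 ≤ m) (hn : 2 ≤ n) (hs : M + 2 = a + b + c) :
    (a ≤ 2 ∨ b ≤ 2 ∨ c ≤ 2) ∨
    (M = 12 ∧ (l = 2 ∨ l = 3) ∧ (m = 2 ∨ m = 3) ∧ (n = 2 ∨ n = 3)) ∨
    (M = 24 ∧ (l = 2 ∨ l = 3 ∨ l = 4) ∧ (m = 2 ∨ m = 3 ∨ m = 4) ∧ (n = 2 ∨ n = 3 ∨ n = 4)) ∨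
    (M = 60 ∧ (l = 2 ∨ l = 3 ∨ l = 5) ∧ (m = 2 ∨ m = 3 ∨ m = 5) ∧ (n = 2 ∨ n = 3 ∨ n = 5)) := by
  rcases le_total l m with h1 | h1 <;> rcases le_total m n with h2 | h2 <;>
    rcases le_total l n with h3 | h3
  · rcases orbit_arith_sorted ha hb hc hl h1 h2 hs with h | ⟨h, h', h'', h'''⟩ | ⟨h, h', h'', h'''⟩ | ⟨h, h', h'', h'''⟩
    · simp only [h, true_or, or_true]
    all_goals subst h h' h'' h'''; simp
  · rcases orbit_arith_sorted ha hb hc hl h1 h2 hs with h | ⟨h, h', h'', h'''⟩ | ⟨h, h', h'', h'''⟩ | ⟨h, h', h'', h'''⟩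
    · simp only [h, true_or, or_true]
    all_goals subst h h' h'' h'''; simp
  · rcases orbit_arith_sorted ha hc hb hl h3 h2 (by omega) with h | ⟨h, h', h'', h'''⟩ | ⟨h, h', h'', h'''⟩ | ⟨h, h', h'', h'''⟩
    · simp only [h, true_or, or_true]
    all_goals subst h h' h'' h'''; simp
  · rcases orbit_arith_sorted hc ha hb hn h3 h1 (by omega) with h | ⟨h, h', h'', h'''⟩ | ⟨h, h', h'', h'''⟩ | ⟨h, h', h'', h'''⟩
    · simp only [h, true_or, or_true]
    all_goals subst h h' h'' h'''; simp
  · rcases orbit_arith_sorted hb ha hc hm h1 h3 (by omega) with h | ⟨h, h', h'', h'''⟩ | ⟨h, h', h'', h'''⟩ | ⟨h, h', h'', h'''⟩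
    · simp only [h, true_or, or_true]
    all_goals subst h h' h'' h'''; simp
  · rcases orbit_arith_sorted hb hc ha hm h2 h3 (by omega) with h | ⟨h, h', h'', h'''⟩ | ⟨h, h', h'', h'''⟩ | ⟨h, h', h'', h'''⟩
    · simp only [h, true_or]
    all_goals subst h h' h'' h'''; simp
  · rcases orbit_arith_sorted hc hb ha hn h2 h1 (by omega) with h | ⟨h, h', h'', h'''⟩ | ⟨h, h', h'', h'''⟩ | ⟨h, h', h'', h'''⟩
    · simp only [h, true_or]
    all_goals subst h h' h'' h'''; simp
  · rcases orbit_arith_sorted hc hb ha hn h2 h1 (by omega) with h | ⟨h, h', h'', h'''⟩ | ⟨h, h', h'', h'''⟩ | ⟨h, h', h'', h'''⟩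
    · simp only [h, true_or]
    all_goals subst h h' h'' h'''; simp

lemma orbit_arith {Ω : Type*} [Fintype Ω] {s n : Ω → ℕ} {M : ℕ} (hM : 0 < M)
    (hsn : ∀ ω, s ω * n ω = M) (hn : ∀ ω, 2 ≤ n ω)
    (hsum : Fintype.card Ω * M + 2 = ∑ ω, s ω + 2 * M) :
    M = 1 ∨ (∃ ω, s ω ≤ 2) ∨ (M = 12 ∧ ∀ ω, n ω = 2 ∨ n ω = 3) ∨
      (M = 24 ∧ ∀ ω, n ω = 2 ∨ n ω = 3 ∨ n ω = 4) ∨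
      (M = 60 ∧ ∀ ω, n ω = 2 ∨ n ω = 3 ∨ n ω = 5) := by
  classical
  have hle : ∀ ω, 2 * s ω ≤ M := fun ω => by
    have := Nat.mul_le_mul_left (s ω) (hn ω); have := hsn ω; omega
  have hpos : ∀ ω, 0 < s ω := fun ω => by
    rcases Nat.eq_zero_or_pos (s ω) with h | h
    · have := hsn ω; rw [h] at this; omega
    · exact h
  have hbound : 2 * ∑ ω, s ω ≤ Fintype.card Ω * M := by
    rw [Finset.mul_sum, ← smul_eq_mul, ← Finset.card_univ]
    exact Finset.sum_le_card_nsmul _ _ _ fun ω _ => hle ω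
  have hr : Fintype.card Ω < 4 := by
    by_contra hr
    have := Nat.mul_le_mul_right M (not_lt.1 hr)
    omega
  obtain h | h | h | h : Fintype.card Ω = 0 ∨ Fintype.card Ω = 1 ∨ Fintype.card Ω = 2 ∨
      Fintype.card Ω = 3 := by omega
  · have : IsEmpty Ω := Fintype.card_eq_zero_iff.1 h
    simp at hsum; omega
  · obtain ⟨x, hx⟩ := Finset.card_eq_one.1 (Finset.card_univ.trans h)
    rw [hx, Finset.sum_singleton, h] at hsum
    have := hle x; have := hpos x; omega
  · obtain ⟨x, y, hxy, hx⟩ := Finset.card_eq_two.1 (Finset.card_univ.trans h)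
    rw [hx, Finset.sum_pair hxy, h] at hsum
    exact Or.inr (Or.inl ⟨x, by have := hpos y; omega⟩)
  · obtain ⟨x, y, z, hxy, hxz, hyz, hx⟩ := Finset.card_eq_three.1 (Finset.card_univ.trans h)
    have hall : ∀ {P : Ω → Prop}, P x → P y → P z → ∀ ω, P ω := by
      intro P h1 h2 h3 ω
      have : ω ∈ (Finset.univ : Finset Ω) := Finset.mem_univ ω
      rw [hx] at this
      simp only [Finset.mem_insert, Finset.mem_singleton] at this
      rcases this with rfl | rfl | rfl <;> assumption
    rw [hx, Finset.sum_insert (by simp [hxy, hxz]), Finset.sum_pair hyz, h] at hsum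
    rcases orbit_arith_three (hsn x) (hsn y) (hsn z) (hn x) (hn y) (hn z) (by omega) with
      h | h | h | h
    · rcases h with h | h | h
      exacts [Or.inr (Or.inl ⟨_, h⟩), Or.inr (Or.inl ⟨_, h⟩), Or.inr (Or.inl ⟨_, h⟩)]
    · exact Or.inr (Or.inr (Or.inl ⟨h.1, hall h.2.1 h.2.2.1 h.2.2.2⟩))
    · exact Or.inr (Or.inr (Or.inr (Or.inl ⟨h.1, hall h.2.1 h.2.2.1 h.2.2.2⟩)))
    · exact Or.inr (Or.inr (Or.inr (Or.inr ⟨h.1, hall h.2.1 h.2.2.1 h.2.2.2⟩)))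

end Counting

section Powers
variable {K : Type*} [Field K]

lemma trace_one_two : (1 : Mat K).trace = 2 := by simp

lemma cayley_hamilton_sl2 (g : SL2 K) :
    (g : Mat K) * g = (g : Mat K).trace • (g : Mat K) - 1 := by
  have hd := det_entries g
  simp only [mat_ext_iff, mat_mul_entry, Matrix.sub_apply, Matrix.smul_apply, smul_eq_mul,
    trace_fin_two]
  simp
  refine ⟨?_, ?_, ?_, ?_⟩
  · linear_combination -hd
  · ring
  · ring
  · linear_combination -hd

lemma eq_one_or_neg_one_of_scalar {g : SL2 K} {c : K} (h : (g : Mat K) = c • 1) :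
    g = 1 ∨ g = -1 := by
  have hd : c * c = 1 := by
    have := g.2
    rw [h, det_fin_two] at this
    simpa using this
  rcases mul_self_eq_one_iff.1 hd with rfl | rfl
  · left; apply Subtype.ext; rw [h]; simp
  · right; apply Subtype.ext; rw [h]; simp

lemma coeff_zero_of_smul_eq {g : SL2 K} (h1 : g ≠ 1) (h2 : g ≠ -1) {a b : K}
    (h : a • (g : Mat K) = b • 1) : a = 0 := by
  by_contra ha
  have : (g : Mat K) = (a⁻¹ * b) • 1 := by
    rw [mul_smul, ← h, smul_smul, inv_mul_cancel₀ ha, one_smul]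
  rcases eq_one_or_neg_one_of_scalar this with h | h
  exacts [h1 h, h2 h]

lemma axis_eq_zero {g : SL2 K} (h2 : (2 : K) ≠ 0) (h : axis (g : Mat K) = 0) :
    g = 1 ∨ g = -1 := by
  apply eq_one_or_neg_one_of_scalar (c := 2⁻¹ * (g : Mat K).trace)
  rw [mul_smul, ← sub_eq_zero.1 h, smul_smul, inv_mul_cancel₀ h2, one_smul]

lemma axis_sq (g : SL2 K) :
    axis (g : Mat K) * axis (g : Mat K) = ((g : Mat K).trace ^ 2 - 4) • 1 := by
  have := cayley_hamilton_sl2 g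
  simp only [axis, mul_sub, sub_mul, smul_mul_assoc, mul_smul_comm, one_mul, mul_one, this]
  module

lemma mul_axis (g : Mat K) : g * axis g = axis g * g := by
  simp [axis, mul_sub, sub_mul]

lemma eq_one_or_neg_one_of_sq {g : SL2 K} (h2 : (2 : K) ≠ 0) (h : g ^ 2 = 1) : g = 1 ∨ g = -1 := by
  have h1 := cayley_hamilton_sl2 g
  rw [← Matrix.SpecialLinearGroup.coe_mul, ← sq, h, Matrix.SpecialLinearGroup.coe_one] at h1
  by_contra hc
  push Not at hc
  have h3 : (g : Mat K).trace • (g : Mat K) = (2 : K) • 1 := by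
    rw [sub_eq_iff_eq_add.1 h1.symm, two_smul]
  have := coeff_zero_of_smul_eq hc.1 hc.2 h3
  rw [this, zero_smul] at h3
  have := congrFun (congrFun h3 0) 0
  simp at this
  exact h2 this.symm

lemma coe_pow_two (g : SL2 K) : ((g ^ 2 : SL2 K) : Mat K) =
    (g : Mat K).trace • (g : Mat K) - (1 : K) • 1 := by
  rw [sq, Matrix.SpecialLinearGroup.coe_mul, cayley_hamilton_sl2, one_smul]

lemma coe_pow_succ {g : SL2 K} {n : ℕ} {a b : K}
    (h : ((g ^ n : SL2 K) : Mat K) = a • (g : Mat K) - b • 1) :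
    ((g ^ (n + 1) : SL2 K) : Mat K) = (a * (g : Mat K).trace - b) • (g : Mat K) - a • 1 := by
  rw [pow_succ, Matrix.SpecialLinearGroup.coe_mul, h, sub_mul, smul_mul_assoc, cayley_hamilton_sl2,
    smul_mul_assoc, one_mul]
  module

lemma coeff_zero_of_pow {g : SL2 K} (h2 : (2 : K) ≠ 0) (h1 : g ≠ 1) (hn : g ≠ -1) {n : ℕ} {a b : K}
    (hg : ((g ^ n : SL2 K) : Mat K) = a • (g : Mat K) - b • 1) (h : g ^ (2 * n) = 1) : a = 0 := by
  rw [mul_comm, pow_mul] at h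
  rcases eq_one_or_neg_one_of_sq h2 h with h | h
  · rw [h, eq_comm, sub_eq_iff_eq_add] at hg
    refine coeff_zero_of_smul_eq h1 hn (b := 1 + b) (hg.trans ?_)
    simp [add_smul]
  · rw [h, eq_comm, sub_eq_iff_eq_add] at hg
    refine coeff_zero_of_smul_eq h1 hn (b := -1 + b) (hg.trans ?_)
    simp [add_smul]

lemma trace_of_pow_four {g : SL2 K} (h2 : (2 : K) ≠ 0) (h1 : g ≠ 1) (hn : g ≠ -1)
    (h : g ^ (2 * 2) = 1) : (g : Mat K).trace = 0 :=
  coeff_zero_of_pow h2 h1 hn (coe_pow_two g) h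

lemma trace_of_pow_six {g : SL2 K} (h2 : (2 : K) ≠ 0) (h1 : g ≠ 1) (hn : g ≠ -1)
    (h : g ^ (2 * 3) = 1) : (g : Mat K).trace ^ 2 = 1 := by
  linear_combination coeff_zero_of_pow h2 h1 hn (coe_pow_succ (coe_pow_two g)) h

lemma trace_of_pow_eight {g : SL2 K} (h2 : (2 : K) ≠ 0) (h1 : g ≠ 1) (hn : g ≠ -1)
    (h : g ^ (2 * 4) = 1) : (g : Mat K).trace = 0 ∨ (g : Mat K).trace ^ 2 = 2 := by
  have := coeff_zero_of_pow h2 h1 hn (coe_pow_succ (coe_pow_succ (coe_pow_two g))) h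
  have : (g : Mat K).trace * ((g : Mat K).trace ^ 2 - 2) = 0 := by linear_combination this
  rcases mul_eq_zero.1 this with h | h
  · exact Or.inl h
  · exact Or.inr (sub_eq_zero.1 h)

lemma trace_of_pow_ten {g : SL2 K} (h2 : (2 : K) ≠ 0) (h1 : g ≠ 1) (hn : g ≠ -1)
    (h : g ^ (2 * 5) = 1) :
    (g : Mat K).trace ^ 2 = (g : Mat K).trace + 1 ∨ (g : Mat K).trace ^ 2 = 1 - (g : Mat K).trace := by
  have := coeff_zero_of_pow h2 h1 hn
    (coe_pow_succ (coe_pow_succ (coe_pow_succ (coe_pow_two g)))) h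
  have : ((g : Mat K).trace ^ 2 - ((g : Mat K).trace + 1)) *
      ((g : Mat K).trace ^ 2 - (1 - (g : Mat K).trace)) = 0 := by linear_combination this
  rcases mul_eq_zero.1 this with h | h
  · exact Or.inl (sub_eq_zero.1 h)
  · exact Or.inr (sub_eq_zero.1 h)

end Powers

section Poles
variable {L : Type*} [Field L]

/-- The normalized rotation axes of the noncentral elements of `H`. -/
def poleSet (H : Subgroup (SL2 L)) : Set (Mat L) :=
  {B | B.trace = 0 ∧ B * B = 1 ∧ ∃ h ∈ H, h ≠ 1 ∧ h ≠ -1 ∧ (h : Mat L) * B = B * h}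

lemma conj_comm_iff {g : SL2 L} {B : Mat L} :
    (g : Mat L) * B * ((g⁻¹ : SL2 L) : Mat L) = B ↔ (g : Mat L) * B = B * g := by
  constructor
  · intro e
    nth_rewrite 2 [← e]
    rw [mul_assoc _ _ (g : Mat L), g.inv_mul_mat, mul_one]
  · intro e
    rw [e, mul_assoc, g.mul_inv_mat, mul_one]

lemma trace_conj (g : SL2 L) (B : Mat L) :
    ((g : Mat L) * B * ((g⁻¹ : SL2 L) : Mat L)).trace = B.trace := by
  rw [trace_mul_comm, ← mul_assoc, g.inv_mul_mat, one_mul]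

lemma conj_mem_poleSet {H : Subgroup (SL2 L)} {k : SL2 L} (hk : k ∈ H) {B : Mat L}
    (hB : B ∈ poleSet H) : (k : Mat L) * B * ((k⁻¹ : SL2 L) : Mat L) ∈ poleSet H := by
  obtain ⟨ht, hs, h, hh, h1, h2, hc⟩ := hB
  refine ⟨by rw [trace_conj, ht], ?_, k * h * k⁻¹, H.mul_mem (H.mul_mem hk hh) (H.inv_mem hk),
    ?_, ?_, ?_⟩
  · have : (k : Mat L) * B * ((k⁻¹ : SL2 L) : Mat L) * ((k : Mat L) * B * ((k⁻¹ : SL2 L) : Mat L))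
        = (k : Mat L) * B * (((k⁻¹ : SL2 L) : Mat L) * (k : Mat L)) * B * ((k⁻¹ : SL2 L) : Mat L) := by
      simp only [mul_assoc]
    rw [this, k.inv_mul_mat, mul_one, mul_assoc (k : Mat L), hs, mul_one, k.mul_inv_mat]
  · intro e; apply h1; simpa using e
  · intro e; apply h2
    rw [mul_inv_eq_iff_eq_mul] at e
    apply mul_left_cancel (a := k); rw [e]; simp
  · simp only [Matrix.SpecialLinearGroup.coe_mul]
    have e1 : (k : Mat L) * h * ((k⁻¹ : SL2 L) : Mat L) * ((k : Mat L) * B * ((k⁻¹ : SL2 L) : Mat L))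
        = (k : Mat L) * h * (((k⁻¹ : SL2 L) : Mat L) * (k : Mat L)) * B * ((k⁻¹ : SL2 L) : Mat L) := by
      simp only [mul_assoc]
    have e2 : (k : Mat L) * B * ((k⁻¹ : SL2 L) : Mat L) * ((k : Mat L) * h * ((k⁻¹ : SL2 L) : Mat L))
        = (k : Mat L) * B * (((k⁻¹ : SL2 L) : Mat L) * (k : Mat L)) * h * ((k⁻¹ : SL2 L) : Mat L) := by
      simp only [mul_assoc]
    rw [e1, e2, k.inv_mul_mat, mul_one, mul_one, mul_assoc (k : Mat L), hc]
    simp only [mul_assoc]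

instance poleAction (H : Subgroup (SL2 L)) : MulAction H (poleSet H) where
  smul k B := ⟨_, conj_mem_poleSet k.2 B.2⟩
  one_smul B := Subtype.ext (by
    change ((1 : SL2 L) : Mat L) * B * (((1 : SL2 L)⁻¹ : SL2 L) : Mat L) = B
    rw [inv_one, Matrix.SpecialLinearGroup.coe_one, one_mul, mul_one])
  mul_smul g k B := Subtype.ext (by
    change ((g.1 * k.1 : SL2 L) : Mat L) * B * (((g.1 * k.1)⁻¹ : SL2 L) : Mat L)
      = (g.1 : Mat L) * ((k.1 : Mat L) * B * ((k.1⁻¹ : SL2 L) : Mat L)) * ((g.1⁻¹ : SL2 L) : Mat L)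
    rw [_root_.mul_inv_rev, Matrix.SpecialLinearGroup.coe_mul, Matrix.SpecialLinearGroup.coe_mul]
    simp only [mul_assoc])

lemma pole_smul_eq_iff {H : Subgroup (SL2 L)} {k : H} {B : poleSet H} :
    k • B = B ↔ ((k : SL2 L) : Mat L) * B = B * (k : SL2 L) := by
  rw [Subtype.ext_iff]
  exact conj_comm_iff

end Poles

section Burnside
variable {L : Type*} [Field L]

/-- Elements of trace `±2` are central. -/
def Semisimple (H : Subgroup (SL2 L)) : Prop :=
  ∀ h ∈ H, (h : Mat L).trace ^ 2 = 4 → h = 1 ∨ h = -1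

lemma eq_or_eq_neg_of_comm (h2 : (2 : L) ≠ 0) {g : SL2 L} (hg : axis (g : Mat L) ≠ 0)
    {B C : Mat L} (hB : B.trace = 0) (hB1 : B * B = 1) (hC : C.trace = 0) (hC1 : C * C = 1)
    (cB : (g : Mat L) * B = B * g) (cC : (g : Mat L) * C = C * g) : C = B ∨ C = -B := by
  have hB0 : B ≠ 0 := by rintro rfl; simp at hB1
  obtain ⟨c, rfl⟩ := exists_smul_of_comm h2 (trace_axis _) hB hg (comm_axis cB)
  obtain ⟨d, rfl⟩ := exists_smul_of_comm h2 (trace_axis _) hC hg (comm_axis cC)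
  have hc : c ≠ 0 := by rintro rfl; simp at hB0
  rw [smul_mul_smul_comm, ← hB1, smul_mul_smul_comm] at hC1
  have : (d * d - c * c) • (axis (g : Mat L) * axis (g : Mat L)) = 0 := by
    rw [sub_smul, hC1, sub_self]
  rcases smul_eq_zero.1 this with h | h
  · rcases mul_self_eq_mul_self_iff.1 (sub_eq_zero.1 h) with h | h
    · left; rw [h]
    · right; rw [h, neg_smul]
  · rw [smul_mul_smul_comm, h] at hB1; simp at hB1

lemma exists_pole [IsAlgClosed L] {g : SL2 L}
    (ht : (g : Mat L).trace ^ 2 ≠ 4) : ∃ B : Mat L, B.trace = 0 ∧ B * B = 1 ∧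
      (g : Mat L) * B = B * g := by
  obtain ⟨s, hs⟩ := IsAlgClosed.exists_pow_nat_eq ((g : Mat L).trace ^ 2 - 4) (n := 2) (by norm_num)
  have hs0 : s ≠ 0 := by
    rintro rfl
    apply ht; linear_combination -hs
  refine ⟨s⁻¹ • axis (g : Mat L), by rw [trace_smul, trace_axis, smul_zero], ?_, ?_⟩
  · rw [smul_mul_smul_comm, axis_sq, smul_smul, ← hs]
    have : s⁻¹ * s⁻¹ * s ^ 2 = 1 := by field_simp
    rw [this, one_smul]
  · rw [mul_smul_comm, smul_mul_assoc, mul_axis]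

variable {H : Subgroup (SL2 L)}

lemma axis_ne_zero (h2 : (2 : L) ≠ 0) {h : SL2 L} (h1 : h ≠ 1) (hn : h ≠ -1) :
    axis (h : Mat L) ≠ 0 := fun e => by
  rcases axis_eq_zero h2 e with e | e
  exacts [h1 e, hn e]

lemma fixedBy_card [IsAlgClosed L] (h2 : (2 : L) ≠ 0) (hs : Semisimple H) {h : H}
    (h1 : (h : SL2 L) ≠ 1) (hn : (h : SL2 L) ≠ -1) :
    Nat.card (MulAction.fixedBy (poleSet H) h) = 2 := by
  have ht : ((h : SL2 L) : Mat L).trace ^ 2 ≠ 4 := fun e => by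
    rcases hs h h.2 e with e | e
    exacts [h1 e, hn e]
  obtain ⟨B, hB, hB1, hc⟩ := exists_pole ht
  have hB0 : B ≠ 0 := by rintro rfl; simp at hB1
  have m1 : B ∈ poleSet H := ⟨hB, hB1, h, h.2, h1, hn, hc⟩
  have hc' : ((h : SL2 L) : Mat L) * (-B) = (-B) * (h : SL2 L) := by
    rw [mul_neg, neg_mul, hc]
  have m2 : -B ∈ poleSet H := ⟨by rw [trace_neg, hB, neg_zero], by rw [neg_mul_neg, hB1],
    h, h.2, h1, hn, hc'⟩
  have : MulAction.fixedBy (poleSet H) h = {⟨B, m1⟩, ⟨-B, m2⟩} := by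
    ext C
    rw [MulAction.mem_fixedBy, pole_smul_eq_iff, Set.mem_insert_iff, Set.mem_singleton_iff,
      Subtype.ext_iff, Subtype.ext_iff]
    constructor
    · intro cC
      exact eq_or_eq_neg_of_comm h2 (axis_ne_zero h2 h1 hn) hB hB1 C.2.1 C.2.2.1 hc cC
    · rintro (e | e)
      · rw [e, hc]
      · rw [e]; exact hc'
  rw [this, Nat.card_coe_set_eq, Set.ncard_pair]
  intro e
  have e' : B = -B := congrArg Subtype.val e
  have : (2 : L) • B = 0 := by
    rw [two_smul]; nth_rewrite 2 [e']; simp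
  rcases smul_eq_zero.1 this with h | h
  exacts [h2 h, hB0 h]

lemma poleSet_finite [Finite H] (h2 : (2 : L) ≠ 0) : (poleSet H).Finite := by
  have : poleSet H ⊆ ⋃ h : H, {B | axis (h.1 : Mat L) ≠ 0 ∧ B.trace = 0 ∧ B * B = 1 ∧
      (h.1 : Mat L) * B = B * h.1} := by
    rintro B ⟨hB, hB1, h, hh, h1, hn, hc⟩
    exact Set.mem_iUnion.2 ⟨⟨h, hh⟩, axis_ne_zero h2 h1 hn, hB, hB1, hc⟩
  refine Set.Finite.subset (Set.finite_iUnion fun h => ?_) this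
  rcases Set.eq_empty_or_nonempty {B | axis (h.1 : Mat L) ≠ 0 ∧ B.trace = 0 ∧ B * B = 1 ∧
      (h.1 : Mat L) * B = B * h.1} with e | ⟨B, hA, hB, hB1, hc⟩
  · rw [e]; exact Set.finite_empty
  · refine Set.Finite.subset (Set.toFinite {B, -B}) ?_
    rintro C ⟨-, hC, hC1, hc'⟩
    exact eq_or_eq_neg_of_comm h2 hA hB hB1 hC hC1 hc hc'

lemma sl2_one_ne_neg_one (h2 : (2 : L) ≠ 0) : (1 : SL2 L) ≠ -1 := by
  intro e
  have e0 := congrFun (congrFun (congrArg Subtype.val e) 0) 0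
  have e1 : (1 : L) = -1 := e0
  apply h2; linear_combination e1

lemma fixedBy_card_central (h : H) (hc : (h : SL2 L) = 1 ∨ (h : SL2 L) = -1) :
    Nat.card (MulAction.fixedBy (poleSet H) h) = Nat.card (poleSet H) := by
  have : MulAction.fixedBy (poleSet H) h = Set.univ := by
    ext C
    rw [MulAction.mem_fixedBy, pole_smul_eq_iff]
    rcases hc with e | e <;> simp [e]
  rw [this, Nat.card_univ]

lemma sum_fixedBy [IsAlgClosed L] [Fintype H] (h2 : (2 : L) ≠ 0) (hs : Semisimple H)
    (hneg : (-1 : SL2 L) ∈ H) :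
    ∑ h : H, Nat.card (MulAction.fixedBy (poleSet H) h) + 4 =
      2 * Nat.card (poleSet H) + 2 * Nat.card H := by
  classical
  have hne : (1 : H) ≠ ⟨-1, hneg⟩ := fun e => sl2_one_ne_neg_one h2 (congrArg Subtype.val e)
  have hsub : ({1, ⟨-1, hneg⟩} : Finset H) ⊆ Finset.univ := Finset.subset_univ _
  rw [← Finset.sum_sdiff hsub, Finset.sum_pair hne, fixedBy_card_central _ (Or.inl rfl),
    fixedBy_card_central _ (Or.inr rfl), Finset.sum_congr rfl (g := fun _ => 2)]
  · rw [Finset.sum_const, Finset.card_sdiff_of_subset hsub, Finset.card_pair hne,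
      Finset.card_univ, Nat.card_eq_fintype_card (α := H)]
    have := Finset.card_le_card hsub
    rw [Finset.card_pair hne, Finset.card_univ] at this
    rw [smul_eq_mul]; omega
  · intro h hh
    simp only [Finset.mem_sdiff, Finset.mem_univ, true_and, Finset.mem_insert,
      Finset.mem_singleton, not_or] at hh
    exact fixedBy_card h2 hs (fun e => hh.1 (Subtype.ext e)) (fun e => hh.2 (Subtype.ext e))

lemma orbit_count [IsAlgClosed L] [Finite H] (h2 : (2 : L) ≠ 0) (hs : Semisimple H)
    (hneg : (-1 : SL2 L) ∈ H) :
    Nat.card (MulAction.orbitRel.Quotient H (poleSet H)) * Nat.card H + 4 =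
      2 * Nat.card (poleSet H) + 2 * Nat.card H := by
  classical
  have := Fintype.ofFinite H
  have := (poleSet_finite (H := H) h2).fintype
  rw [← sum_fixedBy h2 hs hneg]
  have e := MulAction.sum_card_fixedBy_eq_card_orbits_mul_card_group H (poleSet H)
  simp only [← Nat.card_eq_fintype_card] at e
  rw [e]

end Burnside

section Classification
variable {L : Type*} [Field L] {H : Subgroup (SL2 L)}

lemma even_card_subgroup (h2 : (2 : L) ≠ 0) {S : Subgroup (SL2 L)} (hneg : (-1 : SL2 L) ∈ S) :
    2 ∣ Nat.card S := by
  have : orderOf (⟨-1, hneg⟩ : S) = 2 := by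
    apply orderOf_eq_prime
    · apply Subtype.ext; simp
    · intro e; exact sl2_one_ne_neg_one h2 (congrArg Subtype.val e).symm
  exact (dvd_of_eq this.symm).trans (orderOf_dvd_natCard _)

lemma stabilizer_card [Finite H] (h2 : (2 : L) ≠ 0) (hneg : (-1 : SL2 L) ∈ H) (B : poleSet H) :
    ∃ n, 2 ≤ n ∧ Nat.card (MulAction.stabilizer H B) = 2 * n := by
  obtain ⟨h, hh, h1, hn, hc⟩ := B.2.2.2
  set S := MulAction.stabilizer H B
  have m1 : (⟨-1, hneg⟩ : H) ∈ S := by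
    rw [MulAction.mem_stabilizer_iff, pole_smul_eq_iff]; simp
  have m2 : (⟨h, hh⟩ : H) ∈ S := by
    rw [MulAction.mem_stabilizer_iff, pole_smul_eq_iff]; exact hc
  have hdvd : 2 ∣ Nat.card S := by
    have : orderOf (⟨⟨-1, hneg⟩, m1⟩ : S) = 2 := by
      apply orderOf_eq_prime
      · apply Subtype.ext; apply Subtype.ext; simp
      · intro e
        exact sl2_one_ne_neg_one h2 (congrArg (fun x : S => (x : H).1) e).symm
    exact (dvd_of_eq this.symm).trans (orderOf_dvd_natCard _)
  have h3 : 3 ≤ Nat.card S := by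
    classical
    have := Fintype.ofFinite S
    have hcard : ({1, ⟨⟨-1, hneg⟩, m1⟩, ⟨⟨h, hh⟩, m2⟩} : Finset S).card = 3 := by
      refine Finset.card_eq_three.2 ⟨_, _, _, ?_, ?_, ?_, rfl⟩ <;> intro e <;>
        have e := congrArg (fun x : S => (x : H).1) e
      · exact sl2_one_ne_neg_one h2 e
      · exact h1 e.symm
      · exact hn e.symm
    rw [← hcard, Nat.card_eq_fintype_card]
    exact Finset.card_le_univ _
  exact ⟨Nat.card S / 2, by omega, by omega⟩

lemma strong_of_small_orbit [Finite H] (h2 : (2 : L) ≠ 0) {B : poleSet H}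
    (hB : Nat.card (MulAction.orbit H B) ≤ 2) :
    ∃ h ∈ H, h ≠ 1 ∧ h ≠ -1 ∧ ∀ k ∈ H,
      (k : Mat L) * axis (h : Mat L) = axis (h : Mat L) * k ∨
      (k : Mat L) * axis (h : Mat L) = -(axis (h : Mat L) * k) := by
  obtain ⟨hB0, hB1, h, hh, h1, hn, hc⟩ := B.2
  refine ⟨h, hh, h1, hn, fun k hk => ?_⟩
  have hA := axis_ne_zero h2 h1 hn
  have key : (k : Mat L) * (B : Mat L) = B * k ∨ (k : Mat L) * (B : Mat L) = -(B * k) := by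
    by_cases hkB : (⟨k, hk⟩ : H) • B = B
    · exact Or.inl (pole_smul_eq_iff.1 hkB)
    right
    set C := (⟨k, hk⟩ : H) • B with hC
    have hfB : (⟨h, hh⟩ : H) • B = B := pole_smul_eq_iff.2 hc
    have hfC : (⟨h, hh⟩ : H) • C = C := by
      by_contra hne
      have := (poleSet_finite (H := H) h2).fintype
      have hne2 : (⟨h, hh⟩ : H) • C ≠ B := fun e => hkB
        ((MulAction.injective (⟨h, hh⟩ : H)) (e.trans hfB.symm))
      have hsub : ({B, C, (⟨h, hh⟩ : H) • C} : Set (poleSet H)) ⊆ MulAction.orbit H B := by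
        rintro x (rfl | rfl | rfl)
        · exact MulAction.mem_orbit_self _
        · exact MulAction.mem_orbit _ _
        · rw [hC, ← mul_smul]; exact MulAction.mem_orbit _ _
      have h3 := Set.ncard_le_ncard hsub (Set.toFinite _)
      rw [Set.ncard_eq_three.2 ⟨B, C, _, fun e => hkB e.symm, hne2.symm, fun e => hne e.symm, rfl⟩,
        ← Nat.card_coe_set_eq] at h3
      omega
    have hCv : (C : Mat L) = (k : Mat L) * B * ((k⁻¹ : SL2 L) : Mat L) := rfl
    have hkB' : (k : Mat L) * (B : Mat L) = C * k := by
      rw [hCv, mul_assoc _ _ (k : Mat L), k.inv_mul_mat, mul_one]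
    rcases eq_or_eq_neg_of_comm h2 hA hB0 hB1 C.2.1 C.2.2.1 hc (pole_smul_eq_iff.1 hfC) with e | e
    · exact absurd (Subtype.ext e) hkB
    · rw [hkB', e, neg_mul]
  have hBne : (B : Mat L) ≠ 0 := by intro e; rw [e] at hB1; simp at hB1
  obtain ⟨c, hcc, hc'⟩ := exists_smul_of_comm' h2 (trace_axis _) hB0 hA hBne (comm_axis hc)
  rw [hc'] at key
  simp only [mul_smul_comm, smul_mul_assoc, ← smul_neg] at key
  have hinj : Function.Injective (fun x : Mat L => c • x) := smul_right_injective _ hcc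
  exact key.imp (fun e => hinj e) (fun e => hinj e)

theorem strong_or_polyhedral [IsAlgClosed L] [Finite H] (h2 : (2 : L) ≠ 0) (hs : Semisimple H)
    (hneg : (-1 : SL2 L) ∈ H) :
    (∀ h ∈ H, h = 1 ∨ h = -1) ∨
    (∃ h ∈ H, h ≠ 1 ∧ h ≠ -1 ∧ ∀ k ∈ H,
      (k : Mat L) * axis (h : Mat L) = axis (h : Mat L) * k ∨
      (k : Mat L) * axis (h : Mat L) = -(axis (h : Mat L) * k)) ∨
    (Nat.card H = 24 ∧ ∀ h ∈ H, h ≠ 1 → h ≠ -1 → h ^ (2 * 2) = 1 ∨ h ^ (2 * 3) = 1) ∨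
    (Nat.card H = 48 ∧ ∀ h ∈ H, h ≠ 1 → h ≠ -1 →
      h ^ (2 * 2) = 1 ∨ h ^ (2 * 3) = 1 ∨ h ^ (2 * 4) = 1) ∨
    (Nat.card H = 120 ∧ ∀ h ∈ H, h ≠ 1 → h ≠ -1 →
      h ^ (2 * 2) = 1 ∨ h ^ (2 * 3) = 1 ∨ h ^ (2 * 5) = 1) := by
  classical
  have := Fintype.ofFinite H
  have := (poleSet_finite (H := H) h2).fintype
  let Ω := MulAction.orbitRel.Quotient H (poleSet H)
  have : Fintype Ω := Fintype.ofFinite Ω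
  choose n hn hcard using stabilizer_card (H := H) h2 hneg
  obtain ⟨M, hM⟩ := even_card_subgroup h2 hneg
  have hMpos : 0 < M := by have := Nat.card_pos (α := H); omega
  have hsn : ∀ B : poleSet H, Nat.card (MulAction.orbit H B) * n B = M := fun B => by
    have := MulAction.card_orbit_mul_card_stabilizer_eq_card_group H B
    simp only [← Nat.card_eq_fintype_card] at this
    rw [hcard, hM] at this
    apply Nat.eq_of_mul_eq_mul_left (two_pos)
    rw [← this]; ring
  have hsum : Nat.card (poleSet H) = ∑ ω : Ω, Nat.card (MulAction.orbit H ω.out) := by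
    rw [Nat.card_congr (MulAction.selfEquivSigmaOrbits H (poleSet H)), Nat.card_sigma]
  have hcount := orbit_count h2 hs hneg
  rw [hsum, hM, Nat.card_eq_fintype_card] at hcount
  have harith := orbit_arith (Ω := Ω) (s := fun ω => Nat.card (MulAction.orbit H ω.out))
    (n := fun ω => n ω.out) hMpos (fun ω => hsn _) (fun ω => hn _) (by
      have e : Fintype.card Ω * (2 * M) = 2 * (Fintype.card Ω * M) := by ring
      change Fintype.card Ω * (2 * M) + 4 = _ at hcount
      omega)
  have hpow : ∀ (P : ℕ → Prop), (∀ ω : Ω, P (n ω.out)) → ∀ h ∈ H, h ≠ 1 → h ≠ -1 →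
      ∃ m, P m ∧ h ^ (2 * m) = 1 := by
    intro P hP h hh h1 hn1
    have ht : (h : Mat L).trace ^ 2 ≠ 4 := fun e => by
      rcases hs h hh e with e | e
      exacts [h1 e, hn1 e]
    obtain ⟨B, hB, hB1, hc⟩ := exists_pole ht
    let B' : poleSet H := ⟨B, hB, hB1, h, hh, h1, hn1, hc⟩
    have hst : (⟨h, hh⟩ : H) ∈ MulAction.stabilizer H B' := by
      rw [MulAction.mem_stabilizer_iff, pole_smul_eq_iff]; exact hc
    let ω : Ω := Quotient.mk'' B'
    have horb : MulAction.orbit H ω.out = MulAction.orbit H B' := by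
      have : ω.out ∈ MulAction.orbit H B' := by
        rw [← MulAction.orbitRel_apply]; exact Quotient.mk_out (s := MulAction.orbitRel H (poleSet H)) B'
      exact MulAction.orbit_eq_iff.2 this
    have hnn : n ω.out = n B' := by
      have e1 := hsn ω.out
      have e2 := hsn B'
      rw [horb, ← e2] at e1
      refine Nat.eq_of_mul_eq_mul_left ?_ e1
      have : Nonempty (MulAction.orbit H B') := ⟨⟨B', MulAction.mem_orbit_self _⟩⟩
      exact Nat.card_pos
    refine ⟨n B', hnn ▸ hP ω, ?_⟩
    have := pow_card_eq_one' (x := (⟨_, hst⟩ : MulAction.stabilizer H B'))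
    rw [hcard] at this
    have := congrArg (fun x : MulAction.stabilizer H B' => ((x : H) : SL2 L)) this
    simpa using this
  rcases harith with h | ⟨ω, h⟩ | ⟨h, hP⟩ | ⟨h, hP⟩ | ⟨h, hP⟩
  · left
    have hc2 : Nat.card H = 2 := by omega
    intro h' hh'
    by_contra hc
    push Not at hc
    have hcard : ({1, ⟨-1, hneg⟩, ⟨h', hh'⟩} : Finset H).card = 3 := by
      refine Finset.card_eq_three.2 ⟨_, _, _, ?_, ?_, ?_, rfl⟩ <;> intro e <;>
        have e := congrArg Subtype.val e
      · exact sl2_one_ne_neg_one h2 e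
      · exact hc.1 e.symm
      · exact hc.2 e.symm
    have := Finset.card_le_univ ({1, ⟨-1, hneg⟩, ⟨h', hh'⟩} : Finset H)
    rw [hcard, ← Nat.card_eq_fintype_card, hc2] at this
    omega
  · exact Or.inr (Or.inl (strong_of_small_orbit h2 h))
  · refine Or.inr (Or.inr (Or.inl ⟨by omega, fun h' hh h1 hn1 => ?_⟩))
    obtain ⟨m, hm, e⟩ := hpow (fun n => n = 2 ∨ n = 3) hP h' hh h1 hn1
    rcases hm with rfl | rfl
    exacts [Or.inl e, Or.inr e]
  · refine Or.inr (Or.inr (Or.inr (Or.inl ⟨by omega, fun h' hh h1 hn1 => ?_⟩)))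
    obtain ⟨m, hm, e⟩ := hpow (fun n => n = 2 ∨ n = 3 ∨ n = 4) hP h' hh h1 hn1
    rcases hm with rfl | rfl | rfl
    exacts [Or.inl e, Or.inr (Or.inl e), Or.inr (Or.inr e)]
  · refine Or.inr (Or.inr (Or.inr (Or.inr ⟨by omega, fun h' hh h1 hn1 => ?_⟩)))
    obtain ⟨m, hm, e⟩ := hpow (fun n => n = 2 ∨ n = 3 ∨ n = 5) hP h' hh h1 hn1
    rcases hm with rfl | rfl | rfl
    exacts [Or.inl e, Or.inr (Or.inl e), Or.inr (Or.inr e)]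

end Classification

section Types
variable {K : Type*} [Field K]

/-- Every element of `H` commutes or anticommutes with a fixed nonzero traceless matrix. -/
def StrongL (H : Subgroup (SL2 K)) : Prop :=
  ∃ A : Mat K, A ≠ 0 ∧ A.trace = 0 ∧ ∀ h ∈ H, (h : Mat K) * A = A * h ∨ (h : Mat K) * A = -(A * h)

lemma StrongL.lType {H : Subgroup (SL2 K)} (h : StrongL H) : LType H := by
  obtain ⟨A, h0, ht, hA⟩ := h
  refine ⟨A, h0, ht, fun k hk => ?_⟩
  rcases hA k hk with h | h
  · exact ⟨1, by rw [one_smul, h]⟩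
  · exact ⟨-1, by rw [neg_smul, one_smul, h]⟩

def TrA (t : K) : Prop := t = 0 ∨ t ^ 2 = 1
def TrS (t : K) : Prop := t = 0 ∨ t ^ 2 = 1 ∨ t ^ 2 = 2
def TrI (t : K) : Prop := t = 0 ∨ t ^ 2 = 1 ∨ t ^ 2 = t + 1 ∨ t ^ 2 = 1 - t

/-- `H` has order `N` and the traces of its noncentral elements satisfy `P`. -/
def Poly (N : ℕ) (P : K → Prop) (H : Subgroup (SL2 K)) : Prop :=
  Nat.card H = N ∧ ∀ h ∈ H, h ≠ 1 → h ≠ -1 → P (h : Mat K).trace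

def Exc (H : Subgroup (SL2 K)) : Prop :=
  Poly 24 TrA H ∨ Poly 48 TrS H ∨ Poly 120 TrI H

end Types

section Transfer
variable {p : ℕ} [Fact p.Prime]

lemma semisimple_of_not_dvd {H : Subgroup (SL2 (ZMod p))}
    (hneg : -1 ∈ H) (hp : ¬ p ∣ Nat.card H) : Semisimple H := by
  have key : ∀ u ∈ H, (u : Mat (ZMod p)).trace = 2 → u = 1 := by
    intro u hu ht
    have hA : ((u : SL2 (ZMod p)) : Mat (ZMod p)) = 1 + ((u : Mat (ZMod p)) - 1) := by simp
    have h0 : ((u : Mat (ZMod p)) - 1) * ((u : Mat (ZMod p)) - 1) = 0 := by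
      simp only [mul_sub, sub_mul, one_mul, mul_one, cayley_hamilton_sl2, ht]
      module
    have h1 := pow_unipotent hA h0 p
    rw [CharP.cast_eq_zero, zero_smul, add_zero] at h1
    have h2 : u ^ p = 1 := Subtype.ext h1
    have h3 : (⟨u, hu⟩ : H) ^ p = 1 := Subtype.ext h2
    have h4 := orderOf_dvd_of_pow_eq_one h3
    have h5 := orderOf_dvd_natCard (⟨u, hu⟩ : H)
    have h6 : orderOf (⟨u, hu⟩ : H) = 1 := by
      rcases (Nat.dvd_prime Fact.out).1 h4 with h | h
      · exact h
      · rw [h] at h5; exact absurd h5 hp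
    exact congrArg Subtype.val (orderOf_eq_one_iff.1 h6)
  intro h hh ht
  have : ((h : Mat (ZMod p)).trace - 2) * ((h : Mat (ZMod p)).trace + 2) = 0 := by
    linear_combination ht
  rcases mul_eq_zero.1 this with h' | h'
  · exact Or.inl (key h hh (sub_eq_zero.1 h'))
  · right
    have : -h ∈ H := by simpa using H.mul_mem hneg hh
    have := key _ this (by
      rw [Matrix.SpecialLinearGroup.coe_neg, trace_neg]; linear_combination -h')
    rw [← this, neg_neg]

lemma strongL_or_exc (h2 : (2 : ZMod p) ≠ 0) {H : Subgroup (SL2 (ZMod p))}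
    (hneg : -1 ∈ H) (hp : ¬ p ∣ Nat.card H) : StrongL H ∨ Exc H := by
  have hss := semisimple_of_not_dvd hneg hp
  let L := AlgebraicClosure (ZMod p)
  let i : ZMod p →+* L := algebraMap _ _
  have hi : Function.Injective i := i.injective
  let φ : SL2 (ZMod p) →* SL2 L := Matrix.SpecialLinearGroup.map i
  have hφv : ∀ g, ((φ g : SL2 L) : Mat L) = (g : Mat (ZMod p)).map i := fun g => rfl
  have hmi : Function.Injective (fun A : Mat (ZMod p) => A.map i) := Matrix.map_injective hi
  have hφ : Function.Injective φ := fun g h e => Subtype.ext (hmi (congrArg Subtype.val e))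
  have htr : ∀ g, ((φ g : SL2 L) : Mat L).trace = i (g : Mat (ZMod p)).trace := fun g => by
    rw [hφv, trace_fin_two, trace_fin_two, map_add]; rfl
  have h2L : (2 : L) ≠ 0 := by
    have : i 2 ≠ 0 := (map_ne_zero i).2 h2
    rwa [map_ofNat] at this
  have hone : ∀ a b, i ((1 : Mat (ZMod p)) a b) = (1 : Mat L) a b := fun a b => by
    rw [Matrix.one_apply, Matrix.one_apply]
    split_ifs
    exacts [map_one i, map_zero i]
  have hneg' : φ (-1) = -1 := by
    apply Subtype.ext
    rw [hφv, Matrix.SpecialLinearGroup.coe_neg, Matrix.SpecialLinearGroup.coe_neg,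
      Matrix.SpecialLinearGroup.coe_one, Matrix.SpecialLinearGroup.coe_one]
    ext a b
    change i (-((1 : Mat (ZMod p)) a b)) = -((1 : Mat L) a b)
    rw [map_neg, hone]
  have hnegL : (-1 : SL2 L) ∈ H.map φ := ⟨-1, hneg, hneg'⟩
  have hssL : Semisimple (H.map φ) := by
    rintro _ ⟨h, hh, rfl⟩ ht
    rw [htr] at ht
    have : i ((h : Mat (ZMod p)).trace ^ 2) = i 4 := by rw [map_pow, ht, map_ofNat]
    rcases hss h hh (hi this) with e | e
    · left; rw [e, map_one]
    · right; rw [e, hneg']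
  have : Finite (H.map φ) := Finite.of_equiv H (H.equivMapOfInjective φ hφ).toEquiv
  have hcard : Nat.card (H.map φ) = Nat.card H :=
    (Nat.card_congr (H.equivMapOfInjective φ hφ).toEquiv).symm
  have hpow : ∀ {h : SL2 (ZMod p)} {n : ℕ}, φ h ^ n = 1 → h ^ n = 1 := fun {h n} e => by
    apply hφ; rw [map_pow, e, map_one]
  have hne : ∀ {h : SL2 (ZMod p)}, h ≠ 1 → φ h ≠ 1 := fun h e => h (hφ (e.trans (map_one φ).symm))
  have hnn : ∀ {h : SL2 (ZMod p)}, h ≠ -1 → φ h ≠ -1 := fun h e => h (hφ (e.trans hneg'.symm))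
  rcases strong_or_polyhedral h2L hssL hnegL with h | ⟨h, hh, h1, hn, hst⟩ | ⟨hc, h⟩ | ⟨hc, h⟩ |
    ⟨hc, h⟩
  · left
    refine ⟨!![1, 0; 0, -1], fun e => ?_, by simp [trace_fin_two], fun k hk => Or.inl ?_⟩
    · have := congrFun (congrFun e 0) 0
      simp at this
    · rcases h (φ k) ⟨k, hk, rfl⟩ with e | e
      · rw [hφ (e.trans (map_one φ).symm)]; simp
      · rw [hφ (e.trans hneg'.symm)]; simp
  · left
    obtain ⟨g, hg, rfl⟩ := hh
    have hax : axis ((φ g : SL2 L) : Mat L) = (axis (g : Mat (ZMod p))).map i := by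
      rw [axis, htr, hφv, axis]
      ext a b
      simp only [Matrix.map_apply, Matrix.sub_apply, Matrix.smul_apply, smul_eq_mul, map_sub,
        map_mul, map_ofNat]
      congr 2
      exact (hone a b).symm
    refine ⟨axis (g : Mat (ZMod p)), axis_ne_zero h2 (fun e => h1 (by rw [e, map_one]))
      (fun e => hn (by rw [e, hneg'])), trace_axis _, fun k hk => ?_⟩
    have e1 : ∀ A B : Mat (ZMod p), (A * B).map i = A.map i * B.map i := fun A B => Matrix.map_mul
    refine (hst (φ k) ⟨k, hk, rfl⟩).imp (fun e => hmi ?_) (fun e => hmi ?_)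
    · rw [hax, hφv] at e
      simp only [e1]; exact e
    · rw [hax, hφv] at e
      have : (-(axis (g : Mat (ZMod p)) * (k : Mat (ZMod p)))).map i =
        -((axis (g : Mat (ZMod p)) * (k : Mat (ZMod p))).map i) := by ext a b; exact map_neg i _
      simp only [this, e1]; exact e
  · refine Or.inr (Or.inl ⟨hcard ▸ hc, fun k hk k1 kn => ?_⟩)
    rcases h (φ k) ⟨k, hk, rfl⟩ (hne k1) (hnn kn) with e | e
    · exact Or.inl (trace_of_pow_four h2 k1 kn (hpow e))
    · exact Or.inr (trace_of_pow_six h2 k1 kn (hpow e))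
  · refine Or.inr (Or.inr (Or.inl ⟨hcard ▸ hc, fun k hk k1 kn => ?_⟩))
    rcases h (φ k) ⟨k, hk, rfl⟩ (hne k1) (hnn kn) with e | e | e
    · exact Or.inl (trace_of_pow_four h2 k1 kn (hpow e))
    · exact Or.inr (Or.inl (trace_of_pow_six h2 k1 kn (hpow e)))
    · exact (trace_of_pow_eight h2 k1 kn (hpow e)).imp_right Or.inr
  · refine Or.inr (Or.inr (Or.inr ⟨hcard ▸ hc, fun k hk k1 kn => ?_⟩))
    rcases h (φ k) ⟨k, hk, rfl⟩ (hne k1) (hnn kn) with e | e | e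
    · exact Or.inl (trace_of_pow_four h2 k1 kn (hpow e))
    · exact Or.inr (Or.inl (trace_of_pow_six h2 k1 kn (hpow e)))
    · exact Or.inr (Or.inr (trace_of_pow_ten h2 k1 kn (hpow e)))

lemma two_ne_zero_of_gt (hp : 12 < p) : (2 : ZMod p) ≠ 0 := by
  intro h
  have : p ∣ 2 := by rw [← ZMod.natCast_eq_zero_iff]; exact_mod_cast h
  have := Nat.le_of_dvd (by norm_num) this
  omega

lemma not_dvd_of_exc (hp : 12 < p) {H : Subgroup (SL2 (ZMod p))} (h : Exc H) :
    ¬ p ∣ Nat.card H := by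
  have hP : p.Prime := Fact.out
  have key : ∀ q, q.Prime → q ≤ 12 → ¬ p ∣ q := fun q hq hq' hd => by
    have := (Nat.prime_dvd_prime_iff_eq hP hq).1 hd; omega
  intro hd
  have : p ∣ 2 ^ 4 * 3 * 5 := by
    rcases h with h | h | h <;> rw [h.1] at hd
    · exact hd.trans (by norm_num)
    · exact hd.trans (by norm_num)
    · exact hd.trans (by norm_num)
  rcases hP.dvd_mul.1 this with h | h
  · rcases hP.dvd_mul.1 h with h | h
    · exact key 2 Nat.prime_two (by norm_num) (hP.dvd_of_dvd_pow h)
    · exact key 3 Nat.prime_three (by norm_num) h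
  · exact key 5 Nat.prime_five (by norm_num) h

theorem lType_or_exc (hp : 12 < p) {H : Subgroup (SL2 (ZMod p))} (hneg : -1 ∈ H) (hH : H ≠ ⊤) :
    LType H ∨ Exc H := by
  by_cases h : p ∣ Nat.card H
  · exact Or.inl ((lType_or_eq_top_of_dvd_card h).resolve_right hH)
  · exact (strongL_or_exc (two_ne_zero_of_gt hp) hneg h).imp_left StrongL.lType

theorem strongL_or_exc_of_le (hp : 12 < p) {H E : Subgroup (SL2 (ZMod p))} (hneg : -1 ∈ H)
    (hE : Exc E) (hle : H ≤ E) : StrongL H ∨ Exc H :=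
  strongL_or_exc (two_ne_zero_of_gt hp) hneg fun h =>
    not_dvd_of_exc hp hE (h.trans (Subgroup.card_dvd_of_le hle))

theorem strongL_or_A_of_lt (hp : 12 < p) {H E : Subgroup (SL2 (ZMod p))} (hneg : -1 ∈ H)
    (hE : Exc E) (hlt : H < E) : StrongL H ∨ Poly 24 TrA H := by
  refine (strongL_or_exc_of_le hp hneg hE hlt.le).imp_right fun h => ?_
  have hdvd := Subgroup.card_dvd_of_le hlt.le
  have hne : Nat.card H ≠ Nat.card E := fun e =>
    hlt.ne (Subgroup.eq_of_le_of_card_ge hlt.le e.symm.le)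
  rcases h with h | h | h
  · exact h
  all_goals
    rcases hE with hE | hE | hE <;> rw [h.1, hE.1] at hdvd hne <;> revert hdvd hne <;> norm_num

/-- The subgroup generated by `s` and `-1`. -/
def gen (s : Set (SL2 (ZMod p))) : Subgroup (SL2 (ZMod p)) := Subgroup.closure (insert (-1) s)

lemma neg_one_mem_gen (s : Set (SL2 (ZMod p))) : -1 ∈ gen s :=
  Subgroup.subset_closure (Set.mem_insert _ _)

lemma subset_gen {s : Set (SL2 (ZMod p))} {g : SL2 (ZMod p)} (h : g ∈ s) : g ∈ gen s :=
  Subgroup.subset_closure (Set.mem_insert_of_mem _ h)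

lemma gen_le {s : Set (SL2 (ZMod p))} {H : Subgroup (SL2 (ZMod p))} (hneg : -1 ∈ H)
    (h : ∀ g ∈ s, g ∈ H) : gen s ≤ H := by
  rw [gen, Subgroup.closure_le]
  rintro g (rfl | hg)
  exacts [hneg, h g hg]

lemma gen_mono {s t : Set (SL2 (ZMod p))} (h : s ⊆ t) : gen s ≤ gen t :=
  gen_le (neg_one_mem_gen t) fun _ hg => subset_gen (h hg)

lemma neg_mem_gen {s : Set (SL2 (ZMod p))} {g : SL2 (ZMod p)} (h : g ∈ gen s) : -g ∈ gen s := by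
  simpa using (gen s).mul_mem (neg_one_mem_gen s) h

lemma neg_mem_gen_iff {s : Set (SL2 (ZMod p))} {g : SL2 (ZMod p)} : -g ∈ gen s ↔ g ∈ gen s :=
  ⟨fun h => by simpa using neg_mem_gen h, neg_mem_gen⟩

lemma lType_of_fixes {s : Set (SL2 (ZMod p))} {v : Mat (ZMod p)} (h0 : v ≠ 0) (ht : v.trace = 0)
    (h : ∀ g ∈ s, Fixes g v) : LType (gen s) :=
  ⟨v, h0, ht, fun _ hg => gen_le (H := lineStab v) (fixes_neg_one v) h hg⟩

lemma lType_mono {H E : Subgroup (SL2 (ZMod p))} (h : H ≤ E) (hE : LType E) : LType H := by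
  obtain ⟨v, h0, ht, hv⟩ := hE
  exact ⟨v, h0, ht, fun g hg => hv g (h hg)⟩

lemma ne_one_of_notMem_gen {s : Set (SL2 (ZMod p))} {g : SL2 (ZMod p)} (h : g ∉ gen s) :
    g ≠ 1 ∧ g ≠ -1 :=
  ⟨fun e => h (e ▸ (gen s).one_mem), fun e => h (e ▸ neg_one_mem_gen s)⟩

end Transfer

section Coefficients

/-- `a + b √2 + c φ + d √2 φ`, where `φ ^ 2 = φ + 1`. -/
structure Coef where
  a : ℤ
  b : ℤ
  c : ℤ
  d : ℤ

namespace Coef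

def add (x y : Coef) : Coef := ⟨x.a + y.a, x.b + y.b, x.c + y.c, x.d + y.d⟩
def neg (x : Coef) : Coef := ⟨-x.a, -x.b, -x.c, -x.d⟩
def sub (x y : Coef) : Coef := x.add y.neg
def mul (x y : Coef) : Coef :=
  ⟨x.a * y.a + 2 * (x.b * y.b) + x.c * y.c + 2 * (x.d * y.d),
   x.a * y.b + x.b * y.a + x.c * y.d + x.d * y.c,
   x.a * y.c + x.c * y.a + 2 * (x.b * y.d) + 2 * (x.d * y.b) + x.c * y.c + 2 * (x.d * y.d),
   x.a * y.d + x.d * y.a + x.b * y.c + x.c * y.b + x.c * y.d + x.d * y.c⟩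
def ofInt (n : ℤ) : Coef := ⟨n, 0, 0, 0⟩
def norm (x : Coef) : ℤ :=
  let u := x.a * x.a + x.c * x.c - 2 * (x.b * x.b + x.d * x.d)
  let v := 2 * (x.a * x.c) + x.c * x.c - 4 * (x.b * x.d) - 2 * (x.d * x.d)
  u * u + u * v - v * v

/-- The product of the primes excluded as characteristics. -/
def badProd : ℕ := 2 * 3 * 5 * 7 * 11 * 19 * 31

/-- The norm is a nonzero integer divisible only by excluded primes. -/
def good (x : Coef) : Bool := let n := x.norm.natAbs; n != 0 && badProd ^ 20 % n == 0

def isZero (x : Coef) : Bool := x.a == 0 && x.b == 0 && x.c == 0 && x.d == 0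

def beq (x y : Coef) : Bool := x.a == y.a && x.b == y.b && x.c == y.c && x.d == y.d

variable {L : Type*} [Field L] (s f : L)

def eval (x : Coef) : L := x.a + x.b * s + x.c * f + x.d * (s * f)

variable {s f}

lemma eval_add (x y : Coef) : (x.add y).eval s f = x.eval s f + y.eval s f := by
  simp only [eval, add]; push_cast; ring
lemma eval_neg (x : Coef) : x.neg.eval s f = -x.eval s f := by
  simp only [eval, neg]; push_cast; ring
lemma eval_sub (x y : Coef) : (x.sub y).eval s f = x.eval s f - y.eval s f := by
  rw [sub, eval_add, eval_neg, sub_eq_add_neg]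
lemma eval_ofInt (n : ℤ) : (ofInt n).eval s f = n := by simp [eval, ofInt]

lemma eval_mul (hs : s ^ 2 = 2) (hf : f ^ 2 = f + 1) (x y : Coef) :
    (x.mul y).eval s f = x.eval s f * y.eval s f := by
  simp only [eval, mul]; push_cast
  linear_combination (-(x.b * y.b + (x.b * y.d + x.d * y.b) * f + x.d * y.d * f ^ 2) : L) * hs -
    (x.c * y.c + (x.c * y.d + x.d * y.c) * s + 2 * x.d * y.d : L) * hf

lemma eq_of_beq {x y : Coef} (h : x.beq y = true) : x = y := by
  cases x; cases y
  simp only [beq, Bool.and_eq_true, beq_iff_eq] at h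
  obtain ⟨⟨⟨rfl, rfl⟩, rfl⟩, rfl⟩ := h
  rfl

lemma eval_of_isZero {x : Coef} (h : x.isZero = true) : x.eval s f = 0 := by
  simp only [isZero, Bool.and_eq_true, beq_iff_eq] at h
  obtain ⟨⟨⟨ha, hb⟩, hc⟩, hd⟩ := h
  simp [eval, ha, hb, hc, hd]

lemma norm_of_eval (hs : s ^ 2 = 2) (hf : f ^ 2 = f + 1) {x : Coef} (h : x.eval s f = 0) :
    ((x.norm : ℤ) : L) = 0 := by
  have h1 : ((x.a : L) + x.c * f) ^ 2 - 2 * (x.b + x.d * f) ^ 2 = 0 := by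
    rw [eval] at h
    linear_combination ((x.a : L) + x.c * f - (x.b + x.d * f) * s) * h +
      ((x.b : L) + x.d * f) ^ 2 * hs
  have h2 : (x.a * x.a + x.c * x.c - 2 * (x.b * x.b + x.d * x.d) : L) +
      (2 * (x.a * x.c) + x.c * x.c - 4 * (x.b * x.d) - 2 * (x.d * x.d)) * f = 0 := by
    linear_combination h1 - ((x.c : L) ^ 2 - 2 * x.d ^ 2) * hf
  simp only [norm]; push_cast
  set u := (x.a * x.a + x.c * x.c - 2 * (x.b * x.b + x.d * x.d) : L)
  set v := (2 * (x.a * x.c) + x.c * x.c - 4 * (x.b * x.d) - 2 * (x.d * x.d) : L)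
  linear_combination (u + v - v * f) * h2 + v ^ 2 * hf

lemma eval_ne_zero (hs : s ^ 2 = 2) (hf : f ^ 2 = f + 1) (hB : (badProd : L) ≠ 0) {x : Coef}
    (h : x.good = true) : x.eval s f ≠ 0 := by
  intro h0
  have h1 := norm_of_eval hs hf h0
  simp only [good, Bool.and_eq_true, bne_iff_ne, beq_iff_eq] at h
  have h2 : (x.norm : ℤ) ∣ ((badProd ^ 20 : ℕ) : ℤ) := Int.natAbs_dvd.1
    (Int.natCast_dvd_natCast.2 (Nat.dvd_of_mod_eq_zero h.2))
  obtain ⟨k, hk⟩ := h2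
  have h3 := congrArg (Int.cast : ℤ → L) hk
  rw [Int.cast_mul, h1, zero_mul] at h3
  push_cast at h3
  exact hB (pow_eq_zero_iff (by norm_num) |>.1 h3)

def z0 : Coef := ⟨0, 0, 0, 0⟩
def z1 : Coef := ⟨1, 0, 0, 0⟩
def m1 : Coef := ⟨-1, 0, 0, 0⟩

/-- The traces occurring in binary octahedral groups. -/
def listS : List Coef := [z0, z1, m1, ⟨0, 1, 0, 0⟩, ⟨0, -1, 0, 0⟩]
/-- The traces occurring in binary icosahedral groups. -/
def listI : List Coef := [z0, z1, m1, ⟨0, 0, 1, 0⟩, ⟨0, 0, -1, 0⟩, ⟨-1, 0, 1, 0⟩, ⟨1, 0, -1, 0⟩]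
def listT : List Coef :=
  [z0, z1, m1, ⟨0, 1, 0, 0⟩, ⟨0, -1, 0, 0⟩, ⟨0, 0, 1, 0⟩, ⟨0, 0, -1, 0⟩, ⟨-1, 0, 1, 0⟩,
    ⟨1, 0, -1, 0⟩]

lemma exists_listS (hs : s ^ 2 = 2) {t : L} (h : TrS t) : ∃ r ∈ listS, r.eval s f = t := by
  have key : ∀ u : L, t ^ 2 = u ^ 2 → t = u ∨ t = -u := fun u h => sq_eq_sq_iff_eq_or_eq_neg.1 h
  rcases h with h | h | h
  · exact ⟨z0, by simp [listS], by simp [eval, z0, h]⟩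
  · rcases key 1 (by rw [h, one_pow]) with h | h
    · exact ⟨z1, by simp [listS], by simp [eval, z1, h]⟩
    · exact ⟨m1, by simp [listS], by simp [eval, m1, h]⟩
  · rcases key s (by rw [h, hs]) with h | h
    · exact ⟨⟨0, 1, 0, 0⟩, by simp [listS], by simp [eval, h]⟩
    · exact ⟨⟨0, -1, 0, 0⟩, by simp [listS], by simp [eval, h]⟩

lemma exists_listI (hf : f ^ 2 = f + 1) {t : L} (h : TrI t) : ∃ r ∈ listI, r.eval s f = t := by
  rcases h with h | h | h | h
  · exact ⟨z0, by simp [listI], by simp [eval, z0, h]⟩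
  · rcases sq_eq_sq_iff_eq_or_eq_neg.1 (h.trans (one_pow 2).symm) with h | h
    · exact ⟨z1, by simp [listI], by simp [eval, z1, h]⟩
    · exact ⟨m1, by simp [listI], by simp [eval, m1, h]⟩
  · have : (t - f) * (t - (1 - f)) = 0 := by linear_combination h - hf
    rcases mul_eq_zero.1 this with h | h
    · exact ⟨⟨0, 0, 1, 0⟩, by simp [listI], by simp [eval]; linear_combination -h⟩
    · exact ⟨⟨1, 0, -1, 0⟩, by simp [listI], by simp [eval]; linear_combination -h⟩
  · have : (t + f) * (t - (f - 1)) = 0 := by linear_combination h - hf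
    rcases mul_eq_zero.1 this with h | h
    · exact ⟨⟨0, 0, -1, 0⟩, by simp [listI], by simp [eval]; linear_combination -h⟩
    · exact ⟨⟨-1, 0, 1, 0⟩, by simp [listI], by simp [eval]; linear_combination -h⟩

lemma listS_subset : ∀ r ∈ listS, r ∈ listT := by simp [listS, listT]
lemma listI_subset : ∀ r ∈ listI, r ∈ listT := by simp [listI, listT]

end Coef
end Coefficients

lemma TrA.trS {K : Type*} [Field K] {t : K} (h : TrA t) : TrS t := h.imp_right Or.inl


section Involutions
variable {K : Type*} [Field K]

lemma mul_add_mul_of_traceless {v w : Mat K} (hv : v.trace = 0) (hw : w.trace = 0) :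
    v * w + w * v = (v * w).trace • (1 : Mat K) := by
  rw [traceless_iff] at hv hw
  simp only [trace_fin_two, mat_ext_iff, mat_mul_entry, Matrix.smul_apply, Matrix.add_apply,
    smul_eq_mul, one_apply_eq, hv, hw, ne_eq, zero_ne_one, one_ne_zero, not_false_eq_true,
    one_apply_ne]
  refine ⟨?_, ?_, ?_, ?_⟩ <;> ring

lemma anticomm_of_trace {v w : Mat K} (hv : v.trace = 0) (hw : w.trace = 0)
    (h : (v * w).trace = 0) : v * w = -(w * v) := by
  have := mul_add_mul_of_traceless hv hw
  rw [h, zero_smul] at this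
  exact eq_neg_of_add_eq_zero_left this

lemma eq_or_eq_neg_of_smul {g h : SL2 K} {c : K} (e : (g : Mat K) = c • (h : Mat K)) :
    g = h ∨ g = -h := by
  have : ((g * h⁻¹ : SL2 K) : Mat K) = c • 1 := by
    rw [Matrix.SpecialLinearGroup.coe_mul, e, smul_mul_assoc, h.mul_inv_mat]
  rcases eq_one_or_neg_one_of_scalar this with h | h
  · exact Or.inl (mul_inv_eq_one.1 h)
  · right; rw [mul_inv_eq_iff_eq_mul.1 h, neg_one_mul]

lemma inv_mat (g : SL2 K) : ((g⁻¹ : SL2 K) : Mat K) = (g : Mat K).trace • (1 : Mat K) - g := by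
  apply g.mat_left_cancel
  rw [g.mul_inv_mat, mul_sub, cayley_hamilton_sl2, mul_smul_comm, mul_one, sub_sub_cancel]

lemma sq_of_trace_zero {A : SL2 K} (h : (A : Mat K).trace = 0) : (A : Mat K) * A = -1 := by
  rw [cayley_hamilton_sl2, h, zero_smul, zero_sub]

lemma inv_of_trace_zero {A : SL2 K} (h : (A : Mat K).trace = 0) : A⁻¹ = -A := by
  apply Subtype.ext
  rw [inv_mat, h, zero_smul, zero_sub, Matrix.SpecialLinearGroup.coe_neg]

lemma trace_zero_of_anticomm (h2 : (2 : K) ≠ 0) {g : SL2 K} {v : Mat K} (hv : v ≠ 0)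
    (h : (g : Mat K) * v = -(v * g)) : (g : Mat K).trace = 0 := by
  have h1 : (g : Mat K) * g * v = v * (g * g) := by
    rw [mul_assoc, h, mul_neg, ← mul_assoc, h, neg_mul, neg_neg, mul_assoc]
  rw [cayley_hamilton_sl2, sub_mul, mul_sub, one_mul, mul_one, smul_mul_assoc, mul_smul_comm, h]
    at h1
  by_contra ht
  have h3 : (2 * (g : Mat K).trace) • (v * (g : Mat K)) = 0 := by
    rw [smul_neg] at h1
    have := sub_left_inj.1 h1
    rw [mul_smul, two_smul]
    nth_rewrite 1 [← this]
    simp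
  rcases smul_eq_zero.1 h3 with h | h
  · exact (mul_ne_zero h2 ht) h
  · exact hv (g.mat_right_cancel (by rw [h, zero_mul]))

lemma ne_zero_of_sl2 (g : SL2 K) : (g : Mat K) ≠ 0 := fun h => by
  have := g.mul_inv_mat
  rw [h, zero_mul] at this
  exact zero_ne_one this

lemma fixes_of_trace_zero {A : SL2 K} {v : Mat K} (hA : (A : Mat K).trace = 0)
    (hv : v.trace = 0) (h : ((A : Mat K) * v).trace = 0) : Fixes A v :=
  ⟨-1, by rw [anticomm_of_trace hA hv h, neg_smul, one_smul]⟩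

lemma fixes_involution {A : SL2 K} {v : Mat K} (hA : (A : Mat K).trace = 0) (hv : v.trace = 0)
    (h : Fixes A v) : (∃ c : K, v = c • (A : Mat K)) ∨ ((A : Mat K) * v).trace = 0 := by
  obtain ⟨c, hc⟩ := h
  have h1 := mul_add_mul_of_traceless hA hv
  by_cases h0 : c + 1 = 0
  · right
    rw [hc] at h1
    have h2 : (c + 1) • (v * (A : Mat K)) = ((A : Mat K) * v).trace • (1 : Mat K) := by
      rw [add_smul, one_smul, h1, hc]
    rw [h0, zero_smul] at h2
    have := congrArg trace h2.symm
    have h3 := congrFun (congrFun h2 0) 0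
    simpa using h3.symm
  · left
    refine ⟨-(c + 1)⁻¹ * ((A : Mat K) * v).trace, ?_⟩
    have h2 : (c + 1) • (v * (A : Mat K)) = ((A : Mat K) * v).trace • (1 : Mat K) := by
      rw [add_smul, one_smul, ← h1, hc]
    have h3 := congrArg (· * (A : Mat K)) h2
    simp only [smul_mul_assoc, one_mul, mul_assoc, sq_of_trace_zero hA, mul_neg, mul_one] at h3
    rw [mul_smul, ← h3, smul_neg, neg_smul, smul_neg, neg_neg, smul_smul, inv_mul_cancel₀ h0,
      one_smul]

lemma conj_of_trace_zero {A : SL2 K} (hA : (A : Mat K).trace = 0) {v : Mat K}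
    (hv : v.trace = 0) : (A : Mat K) * v * ((A⁻¹ : SL2 K) : Mat K) =
      -(((A : Mat K) * v).trace • (A : Mat K)) - v := by
  have h1 := mul_add_mul_of_traceless hA hv
  set t := ((A : Mat K) * v).trace
  rw [inv_of_trace_zero hA, Matrix.SpecialLinearGroup.coe_neg, eq_sub_of_add_eq h1, mul_neg,
    sub_mul, smul_mul_assoc, one_mul, mul_assoc, sq_of_trace_zero hA, mul_neg, mul_one]
  abel

lemma eq_or_neg_of_commute_involution (h2 : (2 : K) ≠ 0) {A B : SL2 K}
    (hA : (A : Mat K).trace = 0) (hB : (B : Mat K).trace = 0)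
    (h : (A : Mat K) * B = B * A) : B = A ∨ B = -A := by
  obtain ⟨c, hc⟩ := exists_smul_of_comm h2 hA hB (ne_zero_of_sl2 A) h
  exact eq_or_eq_neg_of_smul hc

lemma trace_br_mul {A B C : Mat K} (hA : A.trace = 0) (hB : B.trace = 0)
    (hC : C.trace = 0) : (C * br A B).trace = 2 * (A * B * C).trace := by
  have e : ∀ A B C : Mat K, A.trace = 0 → B.trace = 0 → C.trace = 0 →
      (C * (B * A)).trace = -(A * B * C).trace := by
    intro A B C hA hB hC
    rw [traceless_iff] at hA hB hC
    simp only [trace_fin_two, mat_mul_entry, hA, hB, hC]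
    ring
  rw [br, mul_sub, trace_sub, e A B C hA hB hC, trace_mul_comm C]
  ring

/-- The Gram determinant of three traceless matrices. -/
lemma gram_three {A B C : Mat K} (hA : A.trace = 0) (hB : B.trace = 0) (hC : C.trace = 0)
    (sA : (A * A).trace = -2) (sB : (B * B).trace = -2) (sC : (C * C).trace = -2) :
    2 * (A * B * C).trace ^ 2 = 2 * (4 - (A * B).trace * (A * C).trace * (B * C).trace -
      (A * B).trace ^ 2 - (A * C).trace ^ 2 - (B * C).trace ^ 2) := by
  have key : -2 * (A * B * C).trace ^ 2 = (A * A).trace * (B * B).trace * (C * C).trace +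
      2 * ((A * B).trace * (A * C).trace * (B * C).trace) - (A * A).trace * (B * C).trace ^ 2 -
      (B * B).trace * (A * C).trace ^ 2 - (C * C).trace * (A * B).trace ^ 2 := by
    rw [traceless_iff] at hA hB hC
    simp only [trace_fin_two, mat_mul_entry, hA, hB, hC]
    ring
  rw [sA, sB, sC] at key
  linear_combination -key

lemma trace_sq_of_trace_zero {A : SL2 K} (h : (A : Mat K).trace = 0) :
    ((A : Mat K) * A).trace = -2 := by
  rw [sq_of_trace_zero h, trace_neg, trace_one_two]

/-- A traceless matrix orthogonal to three independent ones vanishes. -/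
lemma eq_zero_of_traces (h2 : (2 : K) ≠ 0) {A B C : SL2 K} {v : Mat K}
    (hA : (A : Mat K).trace = 0) (hB : (B : Mat K).trace = 0)
    (hC : (C : Mat K).trace = 0) (hv : v.trace = 0)
    (hABC : ((A : Mat K) * B * C).trace ≠ 0) (h1 : ((A : Mat K) * v).trace = 0)
    (h3 : ((B : Mat K) * v).trace = 0) (h4 : ((C : Mat K) * v).trace = 0) : v = 0 := by
  by_contra h0
  apply hABC
  have e1 := anticomm_of_trace hA hv h1
  have e2 := anticomm_of_trace hB hv h3
  have e3 := anticomm_of_trace hC hv h4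
  have := trace_zero_of_anticomm h2 (g := A * B * C) h0 (by
    simp only [Matrix.SpecialLinearGroup.coe_mul]
    rw [mul_assoc _ _ v, e3, mul_neg, ← mul_assoc, mul_assoc _ _ v, e2, mul_neg, neg_mul,
      ← mul_assoc, e1]
    simp only [neg_mul, neg_neg, mul_assoc])
  simpa only [Matrix.SpecialLinearGroup.coe_mul] using this

/-- Two involutions preserving two distinct common lines coincide up to sign or commute in the
projective group. -/
lemma trace_zero_of_two_lines (h2 : (2 : K) ≠ 0) {A B : SL2 K} {v w : Mat K}
    (hA : (A : Mat K).trace = 0) (hB : (B : Mat K).trace = 0) (hv : v.trace = 0)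
    (hw : w.trace = 0) (hv0 : v ≠ 0) (hw0 : w ≠ 0) (hvw : ∀ c : K, w ≠ c • v)
    (hne : B ≠ A ∧ B ≠ -A) (Av : Fixes A v) (Aw : Fixes A w) (Bv : Fixes B v) (Bw : Fixes B w) :
    ((A : Mat K) * B).trace = 0 := by
  have aux : ∀ {A B : SL2 K} {v : Mat K}, (A : Mat K).trace = 0 → (B : Mat K).trace = 0 →
      v.trace = 0 → v ≠ 0 → B ≠ A ∧ B ≠ -A → Fixes A v → Fixes B v →
      ((A : Mat K) * v).trace ≠ 0 → ((A : Mat K) * B).trace = 0 := by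
    intro A B v hA hB hv hv0 hne Av Bv h
    obtain ⟨c, rfl⟩ := (fixes_involution hA hv Av).resolve_right h
    have hc : c ≠ 0 := by rintro rfl; simp at hv0
    rcases fixes_involution hB hA (fixes_of_smul hc Bv) with ⟨d, hd⟩ | h'
    · exfalso
      rcases eq_or_eq_neg_of_smul hd with e | e
      · exact hne.1 e.symm
      · exact hne.2 (by rw [e, neg_neg])
    · rwa [trace_mul_comm]
  have hne' : A ≠ B ∧ A ≠ -B := ⟨hne.1.symm, fun e => hne.2 (by rw [e, neg_neg])⟩
  by_cases h1 : ((A : Mat K) * v).trace = 0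
  swap; · exact aux hA hB hv hv0 hne Av Bv h1
  by_cases h3 : ((A : Mat K) * w).trace = 0
  swap; · exact aux hA hB hw hw0 hne Aw Bw h3
  by_cases h4 : ((B : Mat K) * v).trace = 0
  swap; · rw [trace_mul_comm]; exact aux hB hA hv hv0 hne' Bv Av h4
  by_cases h5 : ((B : Mat K) * w).trace = 0
  swap; · rw [trace_mul_comm]; exact aux hB hA hw hw0 hne' Bw Aw h5
  exfalso
  have n1 := anticomm_of_trace hA hv h1
  have n2 := anticomm_of_trace hA hw h3
  have n3 := anticomm_of_trace hB hv h4
  have n4 := anticomm_of_trace hB hw h5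
  have hbr : br v w ≠ 0 := fun e => by
    obtain ⟨c, hc⟩ := exists_smul_of_comm h2 hv hw hv0 (br_eq_zero.1 e)
    exact hvw c hc
  have comm : ∀ {A : SL2 K}, (A : Mat K) * v = -(v * A) → (A : Mat K) * w = -(w * A) →
      br v w * (A : Mat K) = A * br v w := by
    intro A e1 e2
    have k1 : (A : Mat K) * (v * w) = v * (w * A) := by
      rw [← mul_assoc, e1, neg_mul, mul_assoc, e2, mul_neg, neg_neg]
    have k2 : (A : Mat K) * (w * v) = w * (v * A) := by
      rw [← mul_assoc, e2, neg_mul, mul_assoc, e1, mul_neg, neg_neg]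
    rw [br, sub_mul, mul_sub, k1, k2, mul_assoc, mul_assoc]
  obtain ⟨a, ha⟩ := exists_smul_of_comm h2 (trace_br v w) hA hbr (comm n1 n2)
  obtain ⟨b, hb⟩ := exists_smul_of_comm h2 (trace_br v w) hB hbr (comm n3 n4)
  rcases eq_or_neg_of_commute_involution h2 hA hB (by
    rw [ha, hb, smul_mul_smul_comm, smul_mul_smul_comm, mul_comm a b]) with e | e
  · exact hne.1 e
  · exact hne.2 e

end Involutions

section FrameCheck
namespace Coef

abbrev Vec := Coef × Coef × Coef

def two (x : Coef) : Coef := x.add x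
def dot (u v : Vec) : Coef := ((u.1.mul v.1).add (u.2.1.mul v.2.1)).add (u.2.2.mul v.2.2)
def sum (u : Vec) : Coef := (u.1.add u.2.1).add u.2.2
def rot (u : Vec) : Vec := (u.2.2, u.1, u.2.1)
def vneg (u : Vec) : Vec := (u.1.neg, u.2.1.neg, u.2.2.neg)
def veq (u v : Vec) : Bool := u.1.beq v.1 && u.2.1.beq v.2.1 && u.2.2.beq v.2.2
def vzero (x y z : ℤ) : Vec := (ofInt x, ofInt y, ofInt z)
def cross (u v : Vec) : Vec :=
  ((u.2.1.mul v.2.2).sub (u.2.2.mul v.2.1), (u.2.2.mul v.1).sub (u.1.mul v.2.2),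
    (u.1.mul v.2.1).sub (u.2.1.mul v.1))
/-- Twice the image of `v` under the half-turn about `u`. -/
def half (u v : Vec) : Vec :=
  let d := dot u v
  ((d.mul u.1).sub v.1.two, (d.mul u.2.1).sub v.2.1.two, (d.mul u.2.2).sub v.2.2.two)

def isCand (u : Vec) : Bool :=
  !((dot u u).sub (ofInt 4)).good &&
    (!(sum u).good || !((sum u).sub (ofInt 2)).good || !((sum u).add (ofInt 2)).good)

def triples (l : List Coef) : List Vec :=
  l.flatMap fun a => l.flatMap fun b => l.map fun c => (a, b, c)

def cands : List Vec := (triples listS ++ triples listI).filter isCand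

def eqUpToSign (u v : Vec) : Bool := veq u v || veq u (vneg v)

def isAxis (u : Vec) : Bool :=
  eqUpToSign u (vzero 4 0 0) || eqUpToSign u (vzero 0 4 0) || eqUpToSign u (vzero 0 0 4)

def redundant (u v : Vec) : Bool :=
  eqUpToSign u v || eqUpToSign u (rot v) || eqUpToSign u (rot (rot v)) ||
    isAxis (half u v) || isAxis (half v u)

/-- `x / k` is not the negative of an element of `l`. -/
def avoids (l : List Coef) (k : ℤ) (x : Coef) : Bool :=
  l.all fun t => (x.add ((ofInt k).mul t)).good

def tripleAvoids (l : List Coef) (u v : Vec) : Bool :=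
  let d := dot u v
  let w := cross u v
  d.good && (avoids l 2 d || (avoids l 2 w.1 && avoids l 4 (((d.sub w.1).sub w.2.1).add w.2.2) &&
    avoids l 4 (((d.add w.1).sub w.2.1).add w.2.2)))

def pairOK (u v : Vec) : Bool :=
  redundant u v ||
    ((avoids listT 2 (dot u v) || avoids listT 2 (dot u (rot v)) ||
      avoids listT 2 (dot u (rot (rot v)))) &&
    ((sum u).good || (sum v).good || (tripleAvoids listS u v && tripleAvoids listI u v)))

lemma pairOK_of_mem : cands.all (fun u => cands.all fun v => pairOK u v) = true := by
  decide +kernel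

end Coef
end FrameCheck

section Frame
variable {K : Type*} [Field K]

/-- Three mutually orthogonal half-turns permuted cyclically by an element of order three. -/
structure Frame (x I J L : SL2 K) : Prop where
  II : (I : Mat K) * I = -1
  JJ : (J : Mat K) * J = -1
  LL : (L : Mat K) * L = -1
  IJ : (I : Mat K) * J = L
  JI : (J : Mat K) * I = -L
  JL : (J : Mat K) * L = I
  LJ : (L : Mat K) * J = -I
  LI : (L : Mat K) * I = J
  IL : (I : Mat K) * L = -J
  tI : (I : Mat K).trace = 0
  tJ : (J : Mat K).trace = 0
  tL : (L : Mat K).trace = 0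
  x2 : (2 : K) • (x : Mat K) = 1 + I + J + L
  cI : (x : Mat K) * I = J * x
  cJ : (x : Mat K) * J = L * x
  cL : (x : Mat K) * L = I * x

lemma polar (A B : Mat K) : A * B + B * A = A.trace • B + B.trace • A +
    ((A * B).trace - A.trace * B.trace) • (1 : Mat K) := by
  simp only [mat_ext_iff, Matrix.trace_fin_two, Matrix.add_apply, Matrix.smul_apply, smul_eq_mul,
    mat_mul_entry, Matrix.one_apply]
  refine ⟨?_, ?_, ?_, ?_⟩ <;> simp <;> ring

theorem exists_frame (x I : SL2 K) (hx : (x : Mat K).trace = 1)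
    (hI : (I : Mat K).trace = 0) (hxI : ((x : Mat K) * I).trace = -1) :
    Frame x I (x * I * x⁻¹) (I * (x * I * x⁻¹)) := by
  have p := polar (x : Mat K) (I : Mat K)
  rw [hx, hI, hxI] at p
  have hxx : (x : Mat K) * x = x - 1 := by simpa [hx] using cayley_hamilton_sl2 x
  have hII := sq_of_trace_zero hI
  have hinv := inv_mat x
  rw [hx, one_smul] at hinv
  have p' : (I : Mat K) * x = I - 1 - x * I := by
    rw [eq_sub_iff_add_eq, add_comm, p]; simp; abel
  have hxxI : (x : Mat K) * (x * I) = x * I - I := by rw [← mul_assoc, hxx, sub_mul, one_mul]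
  have hJ : ((x * I * x⁻¹ : SL2 K) : Mat K) = x + x * I - I := by
    simp only [Matrix.SpecialLinearGroup.coe_mul, hinv, mul_sub, mul_one, mul_assoc, p', hxxI]
    abel
  have hxII : (x : Mat K) * (I * I) = -x := by rw [hII]; simp
  have hIxI : (I : Mat K) * (x * I) = x - 1 * I - 1 := by
    rw [← mul_assoc, p', sub_mul, sub_mul, mul_assoc, hxII, hII]; noncomm_ring
  have hL : ((I * (x * I * x⁻¹) : SL2 K) : Mat K) = x - 1 - x * I := by
    rw [Matrix.SpecialLinearGroup.coe_mul, hJ, mul_sub, mul_add, hIxI, hII, p']; noncomm_ring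
  have t1 : (1 : Mat K).trace = 2 := by simp
  have tJ : ((x * I * x⁻¹ : SL2 K) : Mat K).trace = 0 := by
    rw [hJ, trace_sub, trace_add, hx, hI, hxI]; ring
  have tL : ((I * (x * I * x⁻¹) : SL2 K) : Mat K).trace = 0 := by
    rw [hL, trace_sub, trace_sub, hx, t1, hxI]; ring
  have hJJ := sq_of_trace_zero tJ
  have hLL := sq_of_trace_zero tL
  have hcI : (x : Mat K) * I = (x * I * x⁻¹ : SL2 K) * x := by
    rw [← Matrix.SpecialLinearGroup.coe_mul, ← Matrix.SpecialLinearGroup.coe_mul]; simp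
  generalize hJd : x * I * x⁻¹ = J at *
  have hLd : ((I * J : SL2 K) : Mat K) = (I : Mat K) * J := Matrix.SpecialLinearGroup.coe_mul _ _
  generalize I * J = L at *
  have hJI : (J : Mat K) * I = -L := by
    rw [hL, hJ, sub_mul, add_mul, mul_assoc, hxII, hII]; noncomm_ring
  have hLI : (L : Mat K) * I = J := by
    rw [hL, hJ, sub_mul, sub_mul, mul_assoc, hxII]; noncomm_ring
  refine ⟨hII, hJJ, hLL, hLd.symm, hJI, ?_, ?_, hLI, ?_, hI, tJ, tL, ?_, hcI, ?_, ?_⟩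
  · rw [hLd, ← mul_assoc, hJI, neg_mul, hLd, mul_assoc, hJJ]; simp
  · rw [hLd, mul_assoc, hJJ]; simp
  · rw [hLd, ← mul_assoc, hII]; simp
  · rw [hL, hJ, two_smul]; abel
  · rw [hL, hJ, mul_sub, mul_add, hxxI, hxx]
    simp only [sub_mul, hxx, mul_assoc, p', mul_sub, hxxI]; noncomm_ring
  · rw [hL]
    simp only [p', mul_sub, hxxI, hxx]; noncomm_ring

/-- The traceless matrix with given coordinates in a frame. -/
def qv (I J L : SL2 K) (a b c : K) : Mat K := a • (I : Mat K) + b • (J : Mat K) + c • (L : Mat K)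

lemma trace_qv {x I J L : SL2 K} (F : Frame x I J L) (a b c : K) : (qv I J L a b c).trace = 0 := by
  simp only [qv, trace_add, trace_smul, F.tI, F.tJ, F.tL, smul_zero, add_zero]

lemma qv_mul {x I J L : SL2 K} (F : Frame x I J L) (a b c a' b' c' : K) :
    qv I J L a b c * qv I J L a' b' c' = -(a * a' + b * b' + c * c') • (1 : Mat K) +
      qv I J L (b * c' - c * b') (c * a' - a * c') (a * b' - b * a') := by
  simp only [qv, add_mul, mul_add, Matrix.smul_mul, Matrix.mul_smul, F.II, F.IJ, F.IL, F.JI, F.JJ,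
    F.JL, F.LI, F.LJ, F.LL]
  module

lemma conj_qv {x I J L : SL2 K} (F : Frame x I J L) (a b c : K) :
    (x : Mat K) * qv I J L a b c = qv I J L c a b * x := by
  simp only [qv, add_mul, mul_add, Matrix.smul_mul, Matrix.mul_smul, F.cI, F.cJ, F.cL]
  abel

lemma trace_mul_qv {x I J L : SL2 K} (F : Frame x I J L) (a b c : K) :
    ((I : Mat K) * qv I J L a b c).trace = -2 * a ∧
    ((J : Mat K) * qv I J L a b c).trace = -2 * b ∧
    ((L : Mat K) * qv I J L a b c).trace = -2 * c := by
  simp only [qv, mul_add, Matrix.mul_smul, F.II, F.IJ, F.IL, F.JI, F.JJ, F.JL, F.LI, F.LJ, F.LL,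
    trace_add, trace_smul, trace_neg, F.tI, F.tJ, F.tL, smul_eq_mul, Matrix.trace_one,
    Fintype.card_fin]
  refine ⟨?_, ?_, ?_⟩ <;> push_cast <;> ring

lemma Frame.expand (h2 : (2 : K) ≠ 0) {x I J L : SL2 K} (F : Frame x I J L) {c : Mat K}
    (hc : c.trace = 0) : (2 : K) • c = qv I J L (-((I : Mat K) * c).trace)
      (-((J : Mat K) * c).trace) (-((L : Mat K) * c).trace) := by
  have e := trace_mul_qv F (-((I : Mat K) * c).trace) (-((J : Mat K) * c).trace)
    (-((L : Mat K) * c).trace)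
  rw [← sub_eq_zero]
  apply eq_zero_of_traces h2 F.tI F.tJ F.tL
  · rw [trace_sub, trace_smul, hc, trace_qv F]; simp
  · rw [F.IJ, F.LL]; simpa using h2
  all_goals
    rw [mul_sub, trace_sub, Matrix.mul_smul, trace_smul, smul_eq_mul]
    simp only [e]; ring

variable {x I J L : SL2 K} {c d : Mat K} {a₁ a₂ a₃ b₁ b₂ b₃ : K}

lemma two_smul_mul_two_smul (c d : Mat K) : ((2 : K) • c) * ((2 : K) • d) = (4 : K) • (c * d) := by
  rw [Matrix.smul_mul, Matrix.mul_smul, smul_smul]; norm_num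

lemma Frame.four_mul (F : Frame x I J L) (hc : (2 : K) • c = qv I J L a₁ a₂ a₃)
    (hd : (2 : K) • d = qv I J L b₁ b₂ b₃) : (4 : K) • (c * d) =
    -(a₁ * b₁ + a₂ * b₂ + a₃ * b₃) • (1 : Mat K) +
      qv I J L (a₂ * b₃ - a₃ * b₂) (a₃ * b₁ - a₁ * b₃) (a₁ * b₂ - a₂ * b₁) := by
  rw [← qv_mul F, ← hc, ← hd, two_smul_mul_two_smul]

lemma Frame.dot_eq (F : Frame x I J L) (h2 : (2 : K) ≠ 0) (hc : (2 : K) • c = qv I J L a₁ a₂ a₃)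
    (hd : (2 : K) • d = qv I J L b₁ b₂ b₃) :
    a₁ * b₁ + a₂ * b₂ + a₃ * b₃ = -(2 * (c * d).trace) := by
  have h := congrArg trace (F.four_mul hc hd)
  rw [trace_add, trace_smul, trace_smul, trace_qv F, Matrix.trace_one] at h
  simp only [smul_eq_mul, Fintype.card_fin] at h
  push_cast at h
  apply mul_left_cancel₀ h2
  linear_combination h

lemma Frame.sum_eq (F : Frame x I J L) (h2 : (2 : K) ≠ 0)
    (hc : (2 : K) • c = qv I J L a₁ a₂ a₃) : a₁ + a₂ + a₃ = -(2 * ((x : Mat K) * c).trace) := by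
  have h := congrArg trace (two_smul_mul_two_smul (x : Mat K) c)
  obtain ⟨e1, e2, e3⟩ := trace_mul_qv F a₁ a₂ a₃
  rw [F.x2, hc, add_mul, add_mul, add_mul, one_mul, trace_add, trace_add, trace_add, trace_qv F,
    e1, e2, e3, trace_smul, smul_eq_mul] at h
  apply mul_left_cancel₀ h2
  linear_combination -h

lemma Frame.conj_eq (F : Frame x I J L) {c : SL2 K}
    (hc : (2 : K) • (c : Mat K) = qv I J L a₁ a₂ a₃) :
    (2 : K) • ((x * c * x⁻¹ : SL2 K) : Mat K) = qv I J L a₃ a₁ a₂ := by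
  rw [Matrix.SpecialLinearGroup.coe_mul, Matrix.SpecialLinearGroup.coe_mul, ← Matrix.smul_mul,
    ← Matrix.mul_smul, hc, conj_qv F, mul_assoc, SL2.mul_inv_mat, mul_one]

lemma Frame.half_eq (F : Frame x I J L) (h2 : (2 : K) ≠ 0) {c d : SL2 K}
    (tc : (c : Mat K).trace = 0) (td : (d : Mat K).trace = 0)
    (hc : (2 : K) • (c : Mat K) = qv I J L a₁ a₂ a₃)
    (hd : (2 : K) • (d : Mat K) = qv I J L b₁ b₂ b₃) :
    (4 : K) • ((c * d * c⁻¹ : SL2 K) : Mat K) =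
      qv I J L ((a₁ * b₁ + a₂ * b₂ + a₃ * b₃) * a₁ - 2 * b₁)
        ((a₁ * b₁ + a₂ * b₂ + a₃ * b₃) * a₂ - 2 * b₂)
        ((a₁ * b₁ + a₂ * b₂ + a₃ * b₃) * a₃ - 2 * b₃) := by
  rw [Matrix.SpecialLinearGroup.coe_mul, Matrix.SpecialLinearGroup.coe_mul, conj_of_trace_zero tc td,
    F.dot_eq h2 hc hd]
  have : (4 : K) • (-(((c : Mat K) * d).trace • (c : Mat K)) - (d : Mat K)) =
      (-(2 * ((c : Mat K) * d).trace)) • ((2 : K) • (c : Mat K)) - (2 : K) • ((2 : K) • (d : Mat K))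
      := by module
  rw [this, hc, hd]
  simp only [qv]
  module

lemma Frame.trace_I (F : Frame x I J L) (h2 : (2 : K) ≠ 0)
    (hc : (2 : K) • c = qv I J L a₁ a₂ a₃) (hd : (2 : K) • d = qv I J L b₁ b₂ b₃) :
    a₂ * b₃ - a₃ * b₂ = -(2 * ((I : Mat K) * (c * d)).trace) ∧
    a₃ * b₁ - a₁ * b₃ = -(2 * ((J : Mat K) * (c * d)).trace) ∧
    a₁ * b₂ - a₂ * b₁ = -(2 * ((L : Mat K) * (c * d)).trace) := by
  have h := F.four_mul hc hd
  obtain ⟨e1, e2, e3⟩ := trace_mul_qv F (a₂ * b₃ - a₃ * b₂) (a₃ * b₁ - a₁ * b₃) (a₁ * b₂ - a₂ * b₁)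
  have key : ∀ A : SL2 K, (A : Mat K).trace = 0 → 4 * ((A : Mat K) * (c * d)).trace =
      ((A : Mat K) * qv I J L (a₂ * b₃ - a₃ * b₂) (a₃ * b₁ - a₁ * b₃) (a₁ * b₂ - a₂ * b₁)).trace := by
    intro A hA
    rw [← smul_eq_mul, ← trace_smul, ← Matrix.mul_smul, h, mul_add, trace_add, Matrix.mul_smul,
      mul_one, trace_smul, hA, smul_zero, zero_add]
  refine ⟨?_, ?_, ?_⟩ <;> apply mul_left_cancel₀ h2
  · linear_combination key I F.tI + e1
  · linear_combination key J F.tJ + e2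
  · linear_combination key L F.tL + e3

lemma Frame.trace_xI (F : Frame x I J L) (h2 : (2 : K) ≠ 0)
    (hc : (2 : K) • c = qv I J L a₁ a₂ a₃) (hd : (2 : K) • d = qv I J L b₁ b₂ b₃) :
    a₁ * b₁ + a₂ * b₂ + a₃ * b₃ - (a₂ * b₃ - a₃ * b₂) - (a₃ * b₁ - a₁ * b₃) +
      (a₁ * b₂ - a₂ * b₁) = 4 * ((x : Mat K) * I * (c * d)).trace := by
  obtain ⟨e1, e2, e3⟩ := F.trace_I h2 hc hd
  have e0 := F.dot_eq h2 hc hd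
  have h : (2 : K) • ((x : Mat K) * I * (c * d)) = -(c * d) + (I : Mat K) * (c * d) +
      (J : Mat K) * (c * d) - (L : Mat K) * (c * d) := by
    rw [← Matrix.smul_mul, ← Matrix.smul_mul, F.x2]
    simp only [add_mul, one_mul, F.II, F.JI, F.LI, neg_mul]; abel
  have h' := congrArg trace h
  rw [trace_smul, trace_sub, trace_add, trace_add, trace_neg, smul_eq_mul] at h'
  linear_combination e0 - e1 - e2 + e3 - 2 * h'

lemma Frame.trace_xxI (F : Frame x I J L) (h2 : (2 : K) ≠ 0)
    (hc : (2 : K) • c = qv I J L a₁ a₂ a₃) (hd : (2 : K) • d = qv I J L b₁ b₂ b₃) :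
    a₁ * b₁ + a₂ * b₂ + a₃ * b₃ + (a₂ * b₃ - a₃ * b₂) - (a₃ * b₁ - a₁ * b₃) +
      (a₁ * b₂ - a₂ * b₁) = 4 * ((x : Mat K) * x * I * (c * d)).trace := by
  obtain ⟨e1, e2, e3⟩ := F.trace_I h2 hc hd
  have e0 := F.trace_xI h2 hc hd
  have tx : (x : Mat K).trace = 1 := by
    have := congrArg trace F.x2
    rw [trace_smul, trace_add, trace_add, trace_add, F.tI, F.tJ, F.tL, Matrix.trace_one] at this
    apply mul_left_cancel₀ h2
    simpa using this
  rw [cayley_hamilton_sl2, tx, one_smul, sub_mul, sub_mul, one_mul, trace_sub]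
  linear_combination e0 + 2 * e1

end Frame

section Bridge
variable {K L : Type*} [Field K] [Field L]

lemma TrS.neg {t : K} (h : TrS t) : TrS (-t) := by simpa [TrS] using h
lemma TrI.neg {t : K} (h : TrI t) : TrI (-t) := by
  rcases h with h | h | h | h
  · exact Or.inl (by rw [h, neg_zero])
  · exact Or.inr (Or.inl (by rw [neg_sq, h]))
  · exact Or.inr (Or.inr (Or.inr (by rw [neg_sq, h]; ring)))
  · exact Or.inr (Or.inr (Or.inl (by rw [neg_sq, h]; ring)))
lemma TrS.map (φ : K →+* L) {t : K} (h : TrS t) : TrS (φ t) := by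
  rcases h with h | h | h
  · exact Or.inl (by rw [h, map_zero])
  · exact Or.inr (Or.inl (by rw [← map_pow, h, map_one]))
  · exact Or.inr (Or.inr (by rw [← map_pow, h, map_ofNat]))
lemma TrI.map (φ : K →+* L) {t : K} (h : TrI t) : TrI (φ t) := by
  rcases h with h | h | h | h
  · exact Or.inl (by rw [h, map_zero])
  · exact Or.inr (Or.inl (by rw [← map_pow, h, map_one]))
  · exact Or.inr (Or.inr (Or.inl (by rw [← map_pow, h, map_add, map_one])))
  · exact Or.inr (Or.inr (Or.inr (by rw [← map_pow, h, map_sub, map_one])))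

lemma exists_sqrt_two_golden (L : Type*) [Field L] [IsAlgClosed L] (h2 : (2 : L) ≠ 0) :
    ∃ s f : L, s ^ 2 = 2 ∧ f ^ 2 = f + 1 := by
  obtain ⟨s, hs⟩ := IsAlgClosed.exists_pow_nat_eq (2 : L) (n := 2) (by norm_num)
  obtain ⟨r, hr⟩ := IsAlgClosed.exists_pow_nat_eq (5 : L) (n := 2) (by norm_num)
  refine ⟨s, (1 + r) / 2, hs, ?_⟩
  field_simp
  linear_combination hr

namespace Coef

/-- The vector `u` evaluates to `(a, b, c)`. -/
def Ev (s f : L) (φ : K →+* L) (u : Vec) (a b c : K) : Prop :=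
  u.1.eval s f = φ a ∧ u.2.1.eval s f = φ b ∧ u.2.2.eval s f = φ c

variable {s f : L} {φ : K →+* L} {u v : Vec} {a b c a' b' c' : K}

lemma Ev.rot (h : Ev s f φ u a b c) : Ev s f φ (rot u) c a b := ⟨h.2.2, h.1, h.2.1⟩

lemma Ev.vneg (h : Ev s f φ u a b c) : Ev s f φ (vneg u) (-a) (-b) (-c) := by
  simp only [Ev, Coef.vneg, eval_neg, map_neg, h.1, h.2.1, h.2.2, and_self]

lemma Ev.dot (hs : s ^ 2 = 2) (hf : f ^ 2 = f + 1) (h : Ev s f φ u a b c)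
    (h' : Ev s f φ v a' b' c') : (dot u v).eval s f = φ (a * a' + b * b' + c * c') := by
  simp only [Coef.dot, eval_add, eval_mul hs hf, h.1, h.2.1, h.2.2, h'.1, h'.2.1, h'.2.2, map_add,
    map_mul]

lemma Ev.sum (h : Ev s f φ u a b c) : (sum u).eval s f = φ (a + b + c) := by
  simp only [Coef.sum, eval_add, h.1, h.2.1, h.2.2, map_add]

lemma Ev.cross (hs : s ^ 2 = 2) (hf : f ^ 2 = f + 1) (h : Ev s f φ u a b c)
    (h' : Ev s f φ v a' b' c') :
    Ev s f φ (cross u v) (b * c' - c * b') (c * a' - a * c') (a * b' - b * a') := by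
  simp only [Ev, Coef.cross, eval_sub, eval_mul hs hf, h.1, h.2.1, h.2.2, h'.1, h'.2.1, h'.2.2,
    map_sub, map_mul, and_self]

lemma Ev.half (hs : s ^ 2 = 2) (hf : f ^ 2 = f + 1) (h : Ev s f φ u a b c)
    (h' : Ev s f φ v a' b' c') :
    Ev s f φ (half u v) ((a * a' + b * b' + c * c') * a - 2 * a')
      ((a * a' + b * b' + c * c') * b - 2 * b') ((a * a' + b * b' + c * c') * c - 2 * c') := by
  have e := Ev.dot hs hf h h'
  simp only [Ev, Coef.half, two, eval_sub, eval_add, eval_mul hs hf, e, h.1, h.2.1, h.2.2, h'.1,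
    h'.2.1, h'.2.2, map_sub, map_mul, map_ofNat]
  refine ⟨?_, ?_, ?_⟩ <;> ring

lemma Ev.eq_of_veq (h : Ev s f φ u a b c) (h' : Ev s f φ v a' b' c') (e : veq u v = true) :
    a = a' ∧ b = b' ∧ c = c' := by
  simp only [veq, Bool.and_eq_true] at e
  obtain ⟨⟨e1, e2⟩, e3⟩ := e
  have e1 := eq_of_beq e1
  have e2 := eq_of_beq e2
  have e3 := eq_of_beq e3
  refine ⟨φ.injective ?_, φ.injective ?_, φ.injective ?_⟩
  · rw [← h.1, e1, h'.1]
  · rw [← h.2.1, e2, h'.2.1]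
  · rw [← h.2.2, e3, h'.2.2]

lemma Ev.eq_or_eq_neg (h : Ev s f φ u a b c) (h' : Ev s f φ v a' b' c')
    (e : eqUpToSign u v = true) :
    (a = a' ∧ b = b' ∧ c = c') ∨ (a = -a' ∧ b = -b' ∧ c = -c') := by
  simp only [eqUpToSign, Bool.or_eq_true] at e
  exact e.imp (h.eq_of_veq h') (h.eq_of_veq h'.vneg)

lemma ev_vzero (l m n : ℤ) : Ev s f φ (vzero l m n) (l : K) m n := by
  simp [Ev, vzero, eval_ofInt]

/-- If `x` avoids `-k • l` then no trace from `l` equals `-x / k`. -/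
lemma ne_of_avoids (hs : s ^ 2 = 2) (hf : f ^ 2 = f + 1) (hB : (badProd : L) ≠ 0)
    {l : List Coef} {k : ℤ} {x r : Coef} (h : avoids l k x = true) (hr : r ∈ l) :
    x.eval s f + k * r.eval s f ≠ 0 := by
  have h1 := List.all_eq_true.1 h r hr
  have := eval_ne_zero hs hf hB h1
  rwa [eval_add, eval_mul hs hf, eval_ofInt] at this

lemma not_trS_of_avoids (hs : s ^ 2 = 2) (hf : f ^ 2 = f + 1) (hB : (badProd : L) ≠ 0)
    {k : ℤ} {x : Coef} {y t : K} (h : avoids listS k x = true) (hx : x.eval s f = φ y)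
    (hy : y = -(k * t)) : ¬ TrS t := by
  intro ht
  obtain ⟨r, hr, e⟩ := exists_listS (s := s) (f := f) hs (ht.map φ)
  apply ne_of_avoids hs hf hB h hr
  rw [e, hx, hy, map_neg, map_mul, map_intCast]; ring

lemma not_trI_of_avoids (hs : s ^ 2 = 2) (hf : f ^ 2 = f + 1) (hB : (badProd : L) ≠ 0)
    {k : ℤ} {x : Coef} {y t : K} (h : avoids listI k x = true) (hx : x.eval s f = φ y)
    (hy : y = -(k * t)) : ¬ TrI t := by
  intro ht
  obtain ⟨r, hr, e⟩ := exists_listI (s := s) (f := f) hf (ht.map φ)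
  apply ne_of_avoids hs hf hB h hr
  rw [e, hx, hy, map_neg, map_mul, map_intCast]; ring

lemma not_trT_of_avoids (hs : s ^ 2 = 2) (hf : f ^ 2 = f + 1) (hB : (badProd : L) ≠ 0)
    {k : ℤ} {x : Coef} {y t : K} (h : avoids listT k x = true) (hx : x.eval s f = φ y)
    (hy : y = -(k * t)) : ¬ (TrS t ∨ TrI t) := by
  rintro (ht | ht)
  · refine not_trS_of_avoids hs hf hB ?_ hx hy ht
    exact List.all_eq_true.2 fun r hr => List.all_eq_true.1 h r (listS_subset r hr)
  · refine not_trI_of_avoids hs hf hB ?_ hx hy ht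
    exact List.all_eq_true.2 fun r hr => List.all_eq_true.1 h r (listI_subset r hr)

lemma not_good_of_eval (hs : s ^ 2 = 2) (hf : f ^ 2 = f + 1) (hB : (badProd : L) ≠ 0)
    {x : Coef} (h : x.eval s f = 0) : x.good = false :=
  Bool.eq_false_iff.2 fun hg => eval_ne_zero hs hf hB hg h

lemma mem_triples {l : List Coef} {a b c : Coef} (ha : a ∈ l) (hb : b ∈ l) (hc : c ∈ l) :
    (a, b, c) ∈ triples l := by
  simp only [triples, List.mem_flatMap, List.mem_map]
  exact ⟨a, ha, b, hb, c, hc, rfl⟩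

lemma exists_cand (hs : s ^ 2 = 2) (hf : f ^ 2 = f + 1) (hB : (badProd : L) ≠ 0)
    (h : (TrS a ∧ TrS b ∧ TrS c) ∨ (TrI a ∧ TrI b ∧ TrI c)) (h4 : a * a + b * b + c * c = 4)
    {t : K} (hsum : a + b + c = -(2 * t)) (ht : TrA t) : ∃ u ∈ cands, Ev s f φ u a b c := by
  have key : ∀ u : Vec, Ev s f φ u a b c → isCand u = true := by
    intro u hu
    have e1 := hu.dot hs hf hu
    have e2 := hu.sum
    have hφ : φ 2 = 2 := map_ofNat φ 2
    have g1 : ((Coef.dot u u).sub (ofInt 4)).good = false := by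
      apply not_good_of_eval hs hf hB
      rw [eval_sub, e1, h4, eval_ofInt, map_ofNat]; norm_num
    have g2 : (Coef.sum u).good = false ∨ ((Coef.sum u).sub (ofInt 2)).good = false ∨
        ((Coef.sum u).add (ofInt 2)).good = false := by
      rcases ht with ht | ht
      · left
        apply not_good_of_eval hs hf hB
        rw [e2, hsum, ht]; simp
      · rcases sq_eq_sq_iff_eq_or_eq_neg.1 (ht.trans (one_pow 2).symm) with ht | ht
        · right; right
          apply not_good_of_eval hs hf hB
          rw [eval_add, e2, hsum, ht, eval_ofInt]; simp [hφ]
        · right; left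
          apply not_good_of_eval hs hf hB
          rw [eval_sub, e2, hsum, ht, eval_ofInt]; simp [hφ]
    simp only [isCand, g1, Bool.not_false, Bool.true_and]
    rcases g2 with g | g | g <;> simp [g]
  rcases h with ⟨ha, hb, hc⟩ | ⟨ha, hb, hc⟩
  · obtain ⟨r1, m1, e1⟩ := exists_listS (s := s) (f := f) hs (ha.map φ)
    obtain ⟨r2, m2, e2⟩ := exists_listS (s := s) (f := f) hs (hb.map φ)
    obtain ⟨r3, m3, e3⟩ := exists_listS (s := s) (f := f) hs (hc.map φ)
    have hE : Ev s f φ (r1, r2, r3) a b c := ⟨e1, e2, e3⟩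
    exact ⟨_, List.mem_filter.2 ⟨List.mem_append_left _ (mem_triples m1 m2 m3), key _ hE⟩, hE⟩
  · obtain ⟨r1, m1, e1⟩ := exists_listI (s := s) (f := f) hf (ha.map φ)
    obtain ⟨r2, m2, e2⟩ := exists_listI (s := s) (f := f) hf (hb.map φ)
    obtain ⟨r3, m3, e3⟩ := exists_listI (s := s) (f := f) hf (hc.map φ)
    have hE : Ev s f φ (r1, r2, r3) a b c := ⟨e1, e2, e3⟩
    exact ⟨_, List.mem_filter.2 ⟨List.mem_append_right _ (mem_triples m1 m2 m3), key _ hE⟩, hE⟩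

end Coef
end Bridge

section FrameContra
variable {p : ℕ} [Fact p.Prime]

lemma Exc.trST {H : Subgroup (SL2 (ZMod p))} (h : Exc H) :
    (∀ g ∈ H, g ≠ 1 → g ≠ -1 → TrS (g : Mat (ZMod p)).trace) ∨
    (∀ g ∈ H, g ≠ 1 → g ≠ -1 → TrI (g : Mat (ZMod p)).trace) := by
  rcases h with h | h | h
  · exact Or.inl fun g hg h1 h2 => (h.2 g hg h1 h2).trS
  · exact Or.inl h.2
  · exact Or.inr h.2

lemma gen_pair_le_left {a b c : SL2 (ZMod p)} : gen {a, b} ≤ gen {a, b, c} :=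
  gen_mono (by rintro g (rfl | rfl) <;> simp)

lemma gen_pair_le_right {a b c : SL2 (ZMod p)} : gen {a, c} ≤ gen {a, b, c} :=
  gen_mono (by rintro g (rfl | rfl) <;> simp)

lemma mem_of_eq_or_neg {s : Set (SL2 (ZMod p))} {g h : SL2 (ZMod p)} (e : g = h ∨ g = -h)
    (hh : h ∈ gen s) : g ∈ gen s := by
  rcases e with rfl | rfl
  · exact hh
  · exact neg_mem_gen hh

lemma mem_of_mul_central {s : Set (SL2 (ZMod p))} {a b : SL2 (ZMod p)} (h : a * b = 1 ∨ a * b = -1)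
    (ha : a ∈ gen s) : b ∈ gen s := by
  refine mem_of_eq_or_neg ?_ (inv_mem ha)
  rcases h with h | h
  · exact Or.inl (eq_inv_of_mul_eq_one_right h)
  · right
    rw [← mul_right_inj a, h]; simp

/-- The trace coordinates of an involution in an exceptional group containing the frame. -/
lemma exc_coords {x I c : SL2 (ZMod p)} (hE : Exc (gen {x, I, c})) (hc : c ∉ gen {x, I}) :
    (TrS (-((I : Mat (ZMod p)) * c).trace) ∧ TrS (-(((x * I * x⁻¹ : SL2 _) : Mat (ZMod p)) * c).trace) ∧
      TrS (-(((I * (x * I * x⁻¹) : SL2 _) : Mat (ZMod p)) * c).trace)) ∨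
    (TrI (-((I : Mat (ZMod p)) * c).trace) ∧ TrI (-(((x * I * x⁻¹ : SL2 _) : Mat (ZMod p)) * c).trace) ∧
      TrI (-(((I * (x * I * x⁻¹) : SL2 _) : Mat (ZMod p)) * c).trace)) := by
  have mx : x ∈ gen {x, I} := subset_gen (by simp)
  have mI : I ∈ gen {x, I} := subset_gen (by simp)
  have mc : c ∈ gen {x, I, c} := subset_gen (by simp)
  have hle : gen {x, I} ≤ gen {x, I, c} := gen_pair_le_left
  have key : ∀ A ∈ gen {x, I}, A * c ∈ gen {x, I, c} ∧ A * c ≠ 1 ∧ A * c ≠ -1 := fun A hA =>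
    ⟨mul_mem (hle hA) mc, fun h => hc (mem_of_mul_central (Or.inl h) hA),
      fun h => hc (mem_of_mul_central (Or.inr h) hA)⟩
  have mJ : x * I * x⁻¹ ∈ gen {x, I} := mul_mem (mul_mem mx mI) (inv_mem mx)
  have k1 := key _ mI
  have k2 := key _ mJ
  have k3 := key _ (mul_mem mI mJ)
  rcases hE.trST with h | h
  · exact Or.inl ⟨(h _ k1.1 k1.2.1 k1.2.2).neg, (h _ k2.1 k2.2.1 k2.2.2).neg,
      (h _ k3.1 k3.2.1 k3.2.2).neg⟩
  · exact Or.inr ⟨(h _ k1.1 k1.2.1 k1.2.2).neg, (h _ k2.1 k2.2.1 k2.2.2).neg,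
      (h _ k3.1 k3.2.1 k3.2.2).neg⟩

lemma eq_of_two_smul {K : Type*} [Field K] (h2 : (2 : K) ≠ 0) {c d : SL2 K}
    (h : (2 : K) • (c : Mat K) = (2 : K) • (d : Mat K)) : c = d :=
  Subtype.ext (smul_right_injective _ h2 h)

lemma eq_neg_of_two_smul {K : Type*} [Field K] (h2 : (2 : K) ≠ 0) {c d : SL2 K}
    (h : (2 : K) • (c : Mat K) = -((2 : K) • (d : Mat K))) : c = -d :=
  eq_of_two_smul h2 (by rw [h, Matrix.SpecialLinearGroup.coe_neg, smul_neg])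

lemma qv_neg {K : Type*} [Field K] {I J L : SL2 K} (a b c : K) :
    qv I J L (-a) (-b) (-c) = -qv I J L a b c := by
  simp only [qv]; module

lemma Frame.eq_or_neg {K : Type*} [Field K] (h2 : (2 : K) ≠ 0) {I J L c d : SL2 K}
    {a b e a' b' e' : K} (hc : (2 : K) • (c : Mat K) = qv I J L a b e)
    (hd : (2 : K) • (d : Mat K) = qv I J L a' b' e')
    (h : (a = a' ∧ b = b' ∧ e = e') ∨ (a = -a' ∧ b = -b' ∧ e = -e')) : c = d ∨ c = -d := by
  rcases h with ⟨rfl, rfl, rfl⟩ | ⟨rfl, rfl, rfl⟩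
  · exact Or.inl (eq_of_two_smul h2 (hc.trans hd.symm))
  · exact Or.inr (eq_neg_of_two_smul h2 (by rw [hc, hd, qv_neg]))

lemma four_smul_eq {K : Type*} [Field K] (h2 : (2 : K) ≠ 0) {A B : SL2 K}
    (h : (4 : K) • (A : Mat K) = (4 : K) • (B : Mat K) ∨
      (4 : K) • (A : Mat K) = -((4 : K) • (B : Mat K))) : A = B ∨ A = -B := by
  have h4 : (4 : K) ≠ 0 := by
    have := mul_ne_zero h2 h2; norm_num at this; exact this
  rcases h with h | h
  · exact Or.inl (Subtype.ext (smul_right_injective _ h4 h))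
  · right
    apply Subtype.ext
    apply smul_right_injective _ h4
    simp only [h, Matrix.SpecialLinearGroup.coe_neg, smul_neg]

open Coef in
/-- If the half-turn of a coordinate vector is a frame axis, the frame is redundant. -/
lemma Frame.eq_axis {K L' : Type*} [Field K] [Field L'] (h2 : (2 : K) ≠ 0) {s f : L'} {φ : K →+* L'}
    {I J L A : SL2 K} {u : Vec} {a b e : K} (hu : Ev s f φ u a b e)
    (hA : (4 : K) • (A : Mat K) = qv I J L a b e) (h : isAxis u = true) :
    (A = I ∨ A = -I) ∨ (A = J ∨ A = -J) ∨ (A = L ∨ A = -L) := by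
  simp only [isAxis, Bool.or_eq_true] at h
  have q : ∀ l m n : ℤ, eqUpToSign u (vzero l m n) = true →
      (4 : K) • (A : Mat K) = qv I J L l m n ∨ (4 : K) • (A : Mat K) = -qv I J L l m n := by
    intro l m n h
    rcases hu.eq_or_eq_neg (ev_vzero l m n) h with ⟨rfl, rfl, rfl⟩ | ⟨rfl, rfl, rfl⟩
    · exact Or.inl hA
    · exact Or.inr (by rw [hA, qv_neg])
  rcases h with (h | h) | h
  · refine Or.inl (four_smul_eq h2 ?_)
    simpa [qv] using q _ _ _ h
  · refine Or.inr (Or.inl (four_smul_eq h2 ?_))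
    simpa [qv] using q _ _ _ h
  · refine Or.inr (Or.inr (four_smul_eq h2 ?_))
    simpa [qv] using q _ _ _ h

end FrameContra

section FrameContra
variable {p : ℕ} [Fact p.Prime]

lemma cast_badProd_ne_zero {L : Type*} [Field L] (φ : ZMod p →+* L)
    (hB : (Coef.badProd : ZMod p) ≠ 0) : (Coef.badProd : L) ≠ 0 := by
  rw [← map_natCast φ]
  exact (map_ne_zero φ).2 hB

open Coef in
theorem frame_contra (hp : 12 < p) (hB : (badProd : ZMod p) ≠ 0) {x I c d : SL2 (ZMod p)}
    (hx : (x : Mat (ZMod p)).trace = 1) (hI : (I : Mat (ZMod p)).trace = 0)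
    (hxI : ((x : Mat (ZMod p)) * I).trace = -1) (tc : (c : Mat (ZMod p)).trace = 0)
    (td : (d : Mat (ZMod p)).trace = 0)
    (hE₁ : Exc (gen {x, I, c})) (hE₂ : Exc (gen {x, I, d}))
    (nI : I ∉ gen {x, c, d}) (nc : c ∉ gen {x, I, d}) (nd : d ∉ gen {x, I, c})
    (txc : TrA ((x : Mat (ZMod p)) * c).trace) (txd : TrA ((x : Mat (ZMod p)) * d).trace)
    (H : Exc (gen {x, c, d}) ∨ (((x : Mat (ZMod p)) * c).trace = 0 ∧
      ((x : Mat (ZMod p)) * d).trace = 0 ∧ (((c : Mat (ZMod p)) * d).trace = 0 ∨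
      ∃ b : Mat (ZMod p), (b = I ∨ b = x * I ∨ b = x * x * I) ∧
        ((TrS ((c : Mat (ZMod p)) * d).trace ∧ TrS (b * (c * d)).trace) ∨
        (TrI ((c : Mat (ZMod p)) * d).trace ∧ TrI (b * (c * d)).trace))))) : False := by
  have h2 : (2 : ZMod p) ≠ 0 := two_ne_zero_of_gt hp
  let φ := algebraMap (ZMod p) (AlgebraicClosure (ZMod p))
  have hBL := cast_badProd_ne_zero φ hB
  obtain ⟨s, f, hs, hf⟩ := exists_sqrt_two_golden (AlgebraicClosure (ZMod p)) (by
    rw [← map_ofNat φ 2]; exact (map_ne_zero φ).2 h2)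
  have F := exists_frame x I hx hI hxI
  have c1 := exc_coords hE₁ (fun h => nc (gen_pair_le_left h))
  have d1 := exc_coords hE₂ (fun h => nd (gen_pair_le_left h))
  have hJd : x * I * x⁻¹ = x * I * x⁻¹ := rfl
  generalize hJ : x * I * x⁻¹ = J at *
  generalize hL : I * J = L at *
  have qc := F.expand h2 tc
  have qd := F.expand h2 td
  generalize -((I : Mat (ZMod p)) * c).trace = a₁ at *
  generalize -((J : Mat (ZMod p)) * c).trace = a₂ at *
  generalize -((L : Mat (ZMod p)) * c).trace = a₃ at *
  generalize -((I : Mat (ZMod p)) * d).trace = b₁ at *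
  generalize -((J : Mat (ZMod p)) * d).trace = b₂ at *
  generalize -((L : Mat (ZMod p)) * d).trace = b₃ at *
  have cc : a₁ * a₁ + a₂ * a₂ + a₃ * a₃ = 4 := by
    rw [F.dot_eq h2 qc qc, trace_sq_of_trace_zero tc]; norm_num
  have dd : b₁ * b₁ + b₂ * b₂ + b₃ * b₃ = 4 := by
    rw [F.dot_eq h2 qd qd, trace_sq_of_trace_zero td]; norm_num
  obtain ⟨u, hu, eu⟩ := exists_cand (φ := φ) hs hf hBL c1 cc (F.sum_eq h2 qc) txc
  obtain ⟨v, hv, ev⟩ := exists_cand (φ := φ) hs hf hBL d1 dd (F.sum_eq h2 qd) txd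
  have hpair := List.all_eq_true.1 (List.all_eq_true.1 pairOK_of_mem u hu) v hv
  have mx : ∀ y z, x ∈ gen {x, y, z} := fun y z => subset_gen (by simp)
  have my : ∀ y z, y ∈ gen {x, y, z} := fun y z => subset_gen (by simp)
  have mz : ∀ y z, z ∈ gen {x, y, z} := fun y z => subset_gen (by simp)
  have qd' := F.conj_eq qd
  have qd'' := F.conj_eq qd'
  have nI' : ∀ A ∈ gen {x, c, d}, ¬ ((A = I ∨ A = -I) ∨ (A = J ∨ A = -J) ∨ (A = L ∨ A = -L)) := by
    intro A hA h
    have hxi := inv_mem (mx c d)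
    have sgn : ∀ B, A = B ∨ A = -B → B ∈ gen {x, c, d} := by
      rintro B (rfl | h)
      · exact hA
      · rw [← neg_mem_gen_iff, ← h]; exact hA
    have fromJ : J ∈ gen {x, c, d} → I ∈ gen {x, c, d} := by
      intro h
      have : I = x⁻¹ * J * x := by rw [← hJ]; group
      rw [this]
      exact mul_mem (mul_mem hxi h) (mx c d)
    rcases h with h | h | h
    · exact nI (sgn _ h)
    · exact nI (fromJ (sgn _ h))
    · have hJ' : J = x⁻¹ * L * x := by
        have : x * J = L * x := Subtype.ext F.cJ
        rw [mul_assoc, ← this]; group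
      refine nI (fromJ ?_)
      rw [hJ']
      exact mul_mem (mul_mem hxi (sgn _ h)) (mx c d)
  rw [pairOK, Bool.or_eq_true, Bool.and_eq_true] at hpair
  rcases hpair with h | ⟨h₁, h₂⟩
  · simp only [redundant, Bool.or_eq_true] at h
    have hd := mz I d
    have hxi := inv_mem (mx I d)
    have hd' := mul_mem (mul_mem (mx I d) hd) hxi
    rcases h with (((h | h) | h) | h) | h
    · exact nc (mem_of_eq_or_neg (Frame.eq_or_neg h2 qc qd (eu.eq_or_eq_neg ev h)) hd)
    · exact nc (mem_of_eq_or_neg (Frame.eq_or_neg h2 qc qd' (eu.eq_or_eq_neg ev.rot h)) hd')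
    · exact nc (mem_of_eq_or_neg (Frame.eq_or_neg h2 qc qd'' (eu.eq_or_eq_neg ev.rot.rot h))
        (mul_mem (mul_mem (mx I d) hd') hxi))
    · exact nI' _ (mul_mem (mul_mem (my c d) (mz c d)) (inv_mem (my c d)))
        (Frame.eq_axis h2 (eu.half hs hf ev) (F.half_eq h2 tc td qc qd) h)
    · exact nI' _ (mul_mem (mul_mem (mz c d) (my c d)) (inv_mem (mz c d)))
        (Frame.eq_axis h2 (ev.half hs hf eu) (F.half_eq h2 td tc qd qc) h)
  · rcases H with H | ⟨hxc, hxd, H⟩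
    · have tr : ∀ e ∈ gen {x, d}, TrS ((c : Mat (ZMod p)) * e).trace ∨
          TrI ((c : Mat (ZMod p)) * e).trace := by
        intro e he
        have he' : e ∈ gen {x, c, d} := gen_pair_le_right he
        have hcd := mul_mem (my c d) he'
        have hc' : c ∉ gen {x, d} := fun h => nc (gen_pair_le_right h)
        have n : ¬ (c * e = 1 ∨ c * e = -1) := by
          intro h
          apply hc'
          refine mem_of_eq_or_neg ?_ (inv_mem he)
          rcases h with h | h
          · exact Or.inl (eq_inv_of_mul_eq_one_left h)
          · right
            rw [← mul_left_inj e, h]; simp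
        push Not at n
        exact H.trST.imp (fun h => h _ hcd n.1 n.2) (fun h => h _ hcd n.1 n.2)
      have md : d ∈ gen {x, d} := subset_gen (by simp)
      have mx' : x ∈ gen {x, d} := subset_gen (by simp)
      have md' := mul_mem (mul_mem mx' md) (inv_mem mx')
      have md'' := mul_mem (mul_mem mx' md') (inv_mem mx')
      simp only [Bool.or_eq_true] at h₁
      rcases h₁ with (h | h) | h
      · exact not_trT_of_avoids hs hf hBL h (eu.dot hs hf ev) (by exact_mod_cast F.dot_eq h2 qc qd) (tr _ md)
      · exact not_trT_of_avoids hs hf hBL h (eu.dot hs hf ev.rot) (by exact_mod_cast F.dot_eq h2 qc qd') (tr _ md')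
      · exact not_trT_of_avoids hs hf hBL h (eu.dot hs hf ev.rot.rot) (by exact_mod_cast F.dot_eq h2 qc qd'')
          (tr _ md'')
    · simp only [Bool.or_eq_true, Bool.and_eq_true] at h₂
      rcases h₂ with (h | h) | ⟨hS, hT⟩
      · refine eval_ne_zero hs hf hBL h ?_
        rw [eu.sum, F.sum_eq h2 qc, hxc]; simp
      · refine eval_ne_zero hs hf hBL h ?_
        rw [ev.sum, F.sum_eq h2 qd, hxd]; simp
      · simp only [tripleAvoids, Bool.or_eq_true, Bool.and_eq_true] at hS hT
        obtain ⟨hg, hS⟩ := hS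
        obtain ⟨-, hT⟩ := hT
        have eD := eu.dot hs hf ev
        obtain ⟨eX, eY, eZ⟩ := eu.cross hs hf ev
        have k := F.dot_eq h2 qc qd
        have kI := (F.trace_I h2 qc qd).1
        have kx := F.trace_xI h2 qc qd
        have kxx := F.trace_xxI h2 qc qd
        have e1 : eval s f ((((dot u v).sub (cross u v).1).sub (cross u v).2.1).add
            (cross u v).2.2) = φ (4 * ((x : Mat (ZMod p)) * I * (c * d)).trace) := by
          rw [← kx]
          simp only [eval_add, eval_sub, eD, eX, eY, eZ, map_add, map_sub]
        have e2 : eval s f ((((dot u v).add (cross u v).1).sub (cross u v).2.1).add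
            (cross u v).2.2) = φ (4 * ((x : Mat (ZMod p)) * x * I * (c * d)).trace) := by
          rw [← kxx]
          simp only [eval_add, eval_sub, eD, eX, eY, eZ, map_add, map_sub]
        rcases H with H | ⟨b, hb, ⟨H, H'⟩ | ⟨H, H'⟩⟩
        · refine eval_ne_zero hs hf hBL hg ?_
          rw [eD, k, H]; simp
        · rcases hS with hS | ⟨⟨hS₁, hS₂⟩, hS₃⟩
          · exact not_trS_of_avoids hs hf hBL hS eD (by exact_mod_cast k) H
          · rcases hb with rfl | rfl | rfl
            · exact not_trS_of_avoids hs hf hBL hS₁ eX (by exact_mod_cast kI) H'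
            · exact not_trS_of_avoids hs hf hBL hS₂ e1 (by push_cast; ring) H'.neg
            · exact not_trS_of_avoids hs hf hBL hS₃ e2 (by push_cast; ring) H'.neg
        · rcases hT with hS | ⟨⟨hS₁, hS₂⟩, hS₃⟩
          · exact not_trI_of_avoids hs hf hBL hS eD (by exact_mod_cast k) H
          · rcases hb with rfl | rfl | rfl
            · exact not_trI_of_avoids hs hf hBL hS₁ eX (by exact_mod_cast kI) H'
            · exact not_trI_of_avoids hs hf hBL hS₂ e1 (by push_cast; ring) H'.neg
            · exact not_trI_of_avoids hs hf hBL hS₃ e2 (by push_cast; ring) H'.neg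

end FrameContra

section Quads
variable {p : ℕ} [Fact p.Prime]

lemma gen_le_of {s : Set (SL2 (ZMod p))} {t : Set (SL2 (ZMod p))} (h : ∀ g ∈ s, g ∈ gen t) :
    gen s ≤ gen t := gen_le (neg_one_mem_gen t) h

/-- An irredundant quadruple of elements not fixing a common line. -/
structure Quad (a b c d : SL2 (ZMod p)) : Prop where
  ha : a ∉ gen {b, c, d}
  hb : b ∉ gen {a, c, d}
  hc : c ∉ gen {a, b, d}
  hd : d ∉ gen {a, b, c}
  hL : ¬ LType (gen {a, b, c, d})

variable {a b c d x y : SL2 (ZMod p)}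

lemma Quad.swap₁₂ (h : Quad a b c d) : Quad b a c d := by
  obtain ⟨h1, h2, h3, h4, h5⟩ := h
  refine ⟨h2, h1, ?_, ?_, ?_⟩
  · rwa [Set.insert_comm]
  · rwa [Set.insert_comm]
  · rwa [Set.insert_comm]

lemma Quad.swap₂₃ (h : Quad a b c d) : Quad a c b d := by
  obtain ⟨h1, h2, h3, h4, h5⟩ := h
  refine ⟨?_, h3, h2, ?_, ?_⟩
  · rwa [Set.insert_comm]
  · rwa [Set.pair_comm]
  · rwa [Set.insert_comm c b]

lemma Quad.swap₃₄ (h : Quad a b c d) : Quad a b d c := by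
  obtain ⟨h1, h2, h3, h4, h5⟩ := h
  refine ⟨?_, ?_, h4, h3, ?_⟩
  · rwa [Set.pair_comm]
  · rwa [Set.pair_comm]
  · rwa [Set.pair_comm]

lemma Quad.axis_ne_zero (hp : 12 < p) (h : Quad a b c d) : axis (a : Mat (ZMod p)) ≠ 0 :=
  fun h0 => by
    have h1 := ne_one_of_notMem_gen h.ha
    rcases axis_eq_zero (two_ne_zero_of_gt hp) h0 with h2 | h2
    · exact h1.1 h2
    · exact h1.2 h2

lemma Quad.not_three (hp : 12 < p) (h : Quad a b c d) :
    ¬ (LType (gen {b, c, d}) ∧ LType (gen {a, c, d}) ∧ LType (gen {a, b, d})) := by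
  rintro ⟨⟨v, v0, tv, fv⟩, ⟨w, w0, tw, fw⟩, ⟨u, u0, tu, fu⟩⟩
  have ff : ∀ z : Mat (ZMod p), z ≠ 0 → z.trace = 0 →
      ¬ (Fixes a z ∧ Fixes b z ∧ Fixes c z ∧ Fixes d z) := by
    rintro z z0 tz ⟨h1, h2, h3, h4⟩
    refine h.hL (lType_of_fixes z0 tz ?_)
    rintro g (rfl | rfl | rfl | rfl) <;> assumption
  have bv := fv b (subset_gen (by simp))
  have cv := fv c (subset_gen (by simp))
  have dv := fv d (subset_gen (by simp))
  have aw := fw a (subset_gen (by simp))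
  have cw := fw c (subset_gen (by simp))
  have dw := fw d (subset_gen (by simp))
  have au := fu a (subset_gen (by simp))
  have bu := fu b (subset_gen (by simp))
  have du := fu d (subset_gen (by simp))
  obtain ⟨z, z0, tz, az, bz, cz, hz⟩ := exists_common_line (two_ne_zero_of_gt hp)
    (Quad.axis_ne_zero hp h.swap₃₄.swap₂₃.swap₁₂) tv tw tu v0 w0 u0 aw au bv bu cv cw dv dw du
    (fun k => ff v v0 tv ⟨k, bv, cv, dv⟩) (fun k => ff w w0 tw ⟨aw, k, cw, dw⟩)
    (fun k => ff u u0 tu ⟨au, bu, k, du⟩)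
  exact ff z z0 tz ⟨az, bz, cz, hz d dv dw du⟩

lemma comm_axis_of_strongL (hp : 12 < p) (h : StrongL (gen {a, b}))
    (t : (a : Mat (ZMod p)).trace ≠ 0) :
    (b : Mat (ZMod p)) * axis (a : Mat (ZMod p)) = axis (a : Mat (ZMod p)) * b ∨
    (b : Mat (ZMod p)) * axis (a : Mat (ZMod p)) = -(axis (a : Mat (ZMod p)) * b) := by
  have h2 : (2 : ZMod p) ≠ 0 := two_ne_zero_of_gt hp
  obtain ⟨v, v0, tv, hv⟩ := h
  have hA : (a : Mat (ZMod p)) * v = v * a :=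
    (hv a (subset_gen (by simp))).resolve_right fun h => t (trace_zero_of_anticomm h2 v0 h)
  obtain ⟨k, hk⟩ := exists_smul_of_comm h2 tv (trace_axis _) v0 (comm_axis hA).symm
  rw [hk, Matrix.mul_smul, Matrix.smul_mul, ← smul_neg]
  exact (hv b (subset_gen (by simp))).imp (fun h => by rw [h]) (fun h => by rw [h])

lemma fixes_of_comm_or_anti {K : Type*} [Field K] {g : SL2 K} {v : Mat K}
    (h : (g : Mat K) * v = v * g ∨ (g : Mat K) * v = -(v * g)) : Fixes g v := by
  rcases h with h | h
  · exact ⟨1, by rw [one_smul]; exact h⟩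
  · exact ⟨-1, by rw [neg_one_smul]; exact h⟩

lemma trA_of_triple (hp : 12 < p) (hE : Exc (gen {a, b, c})) (hL : ¬ LType (gen {a, b, c}))
    (hb : b ∉ gen {a, c}) (hc : c ∉ gen {a, b}) (ha : a ≠ 1 ∧ a ≠ -1) :
    TrA (a : Mat (ZMod p)).trace := by
  by_cases t : (a : Mat (ZMod p)).trace = 0
  · exact Or.inl t
  have lt : ∀ y z, z ∉ gen {a, y} → y ∈ gen {a, b, c} → z ∈ gen {a, b, c} →
      StrongL (gen {a, y}) ∨ Poly 24 TrA (gen {a, y}) := by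
    intro y z hz hy hz'
    refine strongL_or_A_of_lt hp (neg_one_mem_gen _) hE (lt_of_le_of_ne (gen_le_of ?_) ?_)
    · rintro g (rfl | rfl)
      · exact subset_gen (by simp)
      · exact hy
    · rintro e; rw [e] at hz; exact hz hz'
  have mb : b ∈ gen {a, b, c} := subset_gen (by simp)
  have mc : c ∈ gen {a, b, c} := subset_gen (by simp)
  rcases lt b c hc mb mc with h | h
  · rcases lt c b hb mc mb with h' | h'
    · refine absurd (lType_of_fixes (v := axis (a : Mat (ZMod p)))
        (fun h => by rcases axis_eq_zero (two_ne_zero_of_gt hp) h with e | e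
                     exacts [ha.1 e, ha.2 e]) (trace_axis _) ?_) hL
      rintro g (rfl | rfl | rfl)
      · exact fixes_of_comm_or_anti (Or.inl (mul_axis _))
      · exact fixes_of_comm_or_anti (comm_axis_of_strongL hp h t)
      · exact fixes_of_comm_or_anti (comm_axis_of_strongL hp h' t)
    · exact h'.2 a (subset_gen (by simp)) ha.1 ha.2
  · exact h.2 a (subset_gen (by simp)) ha.1 ha.2

lemma Quad.lType_or_exc (hp : 12 < p) (h : Quad a b c d) :
    LType (gen {a, b, c}) ∨ Exc (gen {a, b, c}) :=
  PSLRep.lType_or_exc hp (neg_one_mem_gen _) fun e => h.hd (e ▸ Subgroup.mem_top d)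

lemma Quad.notMem_pair (h : Quad a b c d) : c ∉ gen {a, b} := fun k => h.hc (gen_mono (by
  rintro g (rfl | rfl) <;> simp) k)

lemma Quad.trA_of_not_lType (hp : 12 < p) (h : Quad a b c d) (hL : ¬ LType (gen {a, b, c})) :
    TrA (a : Mat (ZMod p)).trace :=
  trA_of_triple hp ((h.lType_or_exc hp).resolve_left hL) hL h.swap₂₃.notMem_pair h.notMem_pair
    (ne_one_of_notMem_gen h.ha)

lemma Quad.trA (hp : 12 < p) (h : Quad a b c d) : TrA (a : Mat (ZMod p)).trace := by
  by_contra hA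
  refine Quad.not_three (a := d) (b := c) (c := b) (d := a) hp ?_ ⟨?_, ?_, ?_⟩
  · exact h.swap₃₄.swap₂₃.swap₁₂.swap₃₄.swap₂₃.swap₃₄
  · by_contra k
    exact hA (h.trA_of_not_lType hp fun h => k (by convert h using 2; ext; simp; tauto))
  · by_contra k
    exact hA (h.swap₃₄.trA_of_not_lType hp fun h => k (by convert h using 2; ext; simp; tauto))
  · by_contra k
    exact hA (h.swap₂₃.swap₃₄.trA_of_not_lType hp fun h => k (by convert h using 2; ext; simp; tauto))

end Quads

section Pairs
variable {p : ℕ} [Fact p.Prime]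

lemma natCast_ne_zero_of_lt {n : ℕ} (h0 : n ≠ 0) (hn : n < p) : (n : ZMod p) ≠ 0 := by
  rw [Ne, ZMod.natCast_eq_zero_iff]
  exact fun h => absurd (Nat.le_of_dvd (Nat.pos_of_ne_zero h0) h) (by omega)

lemma sq_ne_three_of_trST (hp : 12 < p) {t : ZMod p} (h : TrS t ∨ TrI t) : t ^ 2 ≠ 3 := by
  have h1 : (1 : ZMod p) ≠ 0 := one_ne_zero
  have h2 := two_ne_zero_of_gt hp
  have h3 : (3 : ZMod p) ≠ 0 := by exact_mod_cast natCast_ne_zero_of_lt (n := 3) (by norm_num) (by omega)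
  intro e
  rcases h with (h | h | h) | (h | h | h | h)
  · exact h3 (by linear_combination t * h - e)
  · exact h2 (by linear_combination h - e)
  · exact h1 (by linear_combination h - e)
  · exact h3 (by linear_combination t * h - e)
  · exact h2 (by linear_combination h - e)
  · exact h1 (by linear_combination e + (t + 2) * (h - e))
  · exact h1 (by linear_combination e - (t - 2) * (h - e))

variable {x y I b c d : SL2 (ZMod p)}

lemma cube_of_trace_one {K : Type*} [Field K] {x : SL2 K} (hx : (x : Mat K).trace = 1) :
    x * x * x = -1 := by
  apply Subtype.ext
  have h : (x : Mat K) * x = x - 1 := by rw [cayley_hamilton_sl2, hx, one_smul]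
  simp only [Matrix.SpecialLinearGroup.coe_mul, Matrix.SpecialLinearGroup.coe_neg,
    Matrix.SpecialLinearGroup.coe_one, h, sub_mul, one_mul]
  abel

/-- `y` is, up to sign, a product of a power of `x` and `I`. -/
def Rel (x I y : SL2 (ZMod p)) : Prop :=
  ∃ g, (g = I ∨ g = x * I ∨ g = x * x * I) ∧ (y = g ∨ y = -g)

def SPair (x y : SL2 (ZMod p)) : Prop :=
  (y : Mat (ZMod p)).trace = 0 ∧ ((x : Mat (ZMod p)) * y).trace = 0

def APair (x y : SL2 (ZMod p)) : Prop :=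
  ∃ I : SL2 (ZMod p), (I : Mat (ZMod p)).trace = 0 ∧ ((x : Mat (ZMod p)) * I).trace = -1 ∧ Rel x I y

lemma Rel.mem_left {H : Subgroup (SL2 (ZMod p))} (hneg : -1 ∈ H) (h : Rel x I y) (hx : x ∈ H)
    (hI : I ∈ H) : y ∈ H := by
  obtain ⟨g, hg, e⟩ := h
  have : g ∈ H := by
    rcases hg with rfl | rfl | rfl
    · exact hI
    · exact H.mul_mem hx hI
    · exact H.mul_mem (H.mul_mem hx hx) hI
  rcases e with rfl | rfl
  · exact this
  · rw [← neg_one_mul]; exact H.mul_mem hneg this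

lemma Rel.mem_right {H : Subgroup (SL2 (ZMod p))} (hneg : -1 ∈ H) (h : Rel x I y) (hx : x ∈ H)
    (hy : y ∈ H) : I ∈ H := by
  obtain ⟨g, hg, e⟩ := h
  have : g ∈ H := by
    rcases e with rfl | rfl
    · exact hy
    · have := H.mul_mem hneg hy
      rwa [neg_one_mul, neg_neg] at this
  rcases hg with rfl | rfl | rfl
  · exact this
  · exact (H.mul_mem_cancel_left hx).1 this
  · exact (H.mul_mem_cancel_left (H.mul_mem hx hx)).1 this

lemma Rel.refl (x I : SL2 (ZMod p)) : Rel x I I := ⟨I, Or.inl rfl, Or.inl rfl⟩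

lemma Rel.gen_eq {I' y' : SL2 (ZMod p)} (h : Rel x I y) (h' : Rel x I' y') :
    gen {x, y, y'} = gen {x, I, I'} := by
  refine le_antisymm (gen_le_of ?_) (gen_le_of ?_)
  · rintro g (rfl | rfl | rfl)
    · exact subset_gen (by simp)
    · exact h.mem_left (neg_one_mem_gen _) (subset_gen (by simp)) (subset_gen (by simp))
    · exact h'.mem_left (neg_one_mem_gen _) (subset_gen (by simp)) (subset_gen (by simp))
  · rintro g (rfl | rfl | rfl)
    · exact subset_gen (by simp)
    · exact h.mem_right (neg_one_mem_gen _) (subset_gen (by simp)) (subset_gen (by simp))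
    · exact h'.mem_right (neg_one_mem_gen _) (subset_gen (by simp)) (subset_gen (by simp))

lemma APair.not_lType (hp : 12 < p) (hx : (x : Mat (ZMod p)).trace = 1) (h : APair x y) :
    ¬ LType (gen {x, y}) := by
  obtain ⟨I, hI, hxI, hR⟩ := h
  rintro ⟨v, v0, tv, fv⟩
  have h2 := two_ne_zero_of_gt hp
  have fx := fv x (subset_gen (by simp))
  have fI := fv I (hR.mem_right (neg_one_mem_gen _) (subset_gen (by simp)) (subset_gen (by simp)))
  have F := exists_frame x I hx hI hxI
  generalize x * I * x⁻¹ = J at F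
  generalize I * J = L at F
  obtain ⟨k, hk⟩ := fx
  have key : ∀ A B : SL2 (ZMod p), (x : Mat (ZMod p)) * A = B * x →
      ((B : Mat (ZMod p)) * v).trace * 1 = k⁻¹ * ((A : Mat (ZMod p)) * v).trace := by
    intro A B e
    have k0 : k ≠ 0 := by
      rintro rfl
      rw [zero_smul] at hk
      exact v0 (x.mat_left_cancel (by rw [hk, mul_zero]))
    have h1 : ((B : Mat (ZMod p)) * v).trace =
        ((B : Mat (ZMod p)) * v * (x * ((x⁻¹ : SL2 (ZMod p)) : Mat (ZMod p)))).trace := by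
      rw [x.mul_inv_mat, mul_one]
    have h3 : (B : Mat (ZMod p)) * v * (x * ((x⁻¹ : SL2 (ZMod p)) : Mat (ZMod p))) =
        k⁻¹ • ((x : Mat (ZMod p)) * (A * v) * ((x⁻¹ : SL2 (ZMod p)) : Mat (ZMod p))) := by
      have : v * x = k⁻¹ • ((x : Mat (ZMod p)) * v) := by
        rw [hk, smul_smul, inv_mul_cancel₀ k0, one_smul]
      rw [← mul_assoc, mul_assoc (B : Mat (ZMod p)), this, mul_smul_comm, ← mul_assoc, ← e,
        smul_mul_assoc, mul_assoc (x : Mat (ZMod p)) (A : Mat (ZMod p)) v]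
    rw [mul_one, h1, h3, Matrix.trace_smul, trace_conj, smul_eq_mul]
  have kI := key I J F.cI
  have kJ := key J L F.cJ
  have hv := F.expand h2 tv
  have k0 : k⁻¹ ≠ 0 := by
    intro k0
    have kL := key L I F.cL
    rw [k0, zero_mul, mul_one] at kI kJ kL
    rw [kI, kJ, kL] at hv
    simp [qv, v0, h2] at hv
  have hI0 : ((I : Mat (ZMod p)) * v).trace = 0 := by
    rcases fixes_involution hI tv fI with ⟨m, hm⟩ | h
    · have : ((J : Mat (ZMod p)) * v).trace = 0 := by
        rw [hm, mul_smul_comm, F.JI, smul_neg, Matrix.trace_neg, Matrix.trace_smul, F.tL]; simp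
      rw [this, zero_mul] at kI
      exact (mul_eq_zero.1 kI.symm).resolve_left k0
    · exact h
  rw [hI0, mul_zero, mul_one] at kI
  rw [kI, mul_zero, mul_one] at kJ
  rw [hI0, kI, kJ] at hv
  simp [qv, v0, h2] at hv

lemma spair_or_apair_of_traces (hx : (x : Mat (ZMod p)).trace = 1)
    (h2 : (2 : ZMod p) ≠ 0) (h3 : (3 : ZMod p) ≠ 0)
    (ty : TrA (y : Mat (ZMod p)).trace) (tu : TrA ((x : Mat (ZMod p)) * y).trace)
    (tw : TrA ((x : Mat (ZMod p)) * x * y).trace) : SPair x y ∨ APair x y := by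
  have hxx : (x : Mat (ZMod p)) * x = x - 1 := by rw [cayley_hamilton_sl2, hx, one_smul]
  have hx3 : (x : Mat (ZMod p)) * x * x = -1 := by
    rw [hxx, sub_mul, hxx, one_mul]; abel
  have hw : ((x : Mat (ZMod p)) * x * y).trace =
      ((x : Mat (ZMod p)) * y).trace - (y : Mat (ZMod p)).trace := by
    rw [hxx, sub_mul, one_mul, Matrix.trace_sub]
  have pm : ∀ t : ZMod p, TrA t → t = 0 ∨ t = 1 ∨ t = -1 := fun t ht =>
    ht.imp_right fun h => sq_eq_sq_iff_eq_or_eq_neg.1 (h.trans (one_pow 2).symm)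
  have x3 := cube_of_trace_one hx
  have e1 : y = -(x * x * (x * y)) := by
    rw [← mul_assoc, x3, neg_one_mul, neg_neg]
  have e2 : y = -(x * (x * x * y)) := by
    rw [← mul_assoc, ← mul_assoc, x3, neg_one_mul, neg_neg]
  have m1 : (x : Mat (ZMod p)) * (x * x * y) = -y := by
    rw [← mul_assoc, ← mul_assoc, hx3, neg_one_mul]
  have four : ∀ t : ZMod p, TrA t → t ≠ 2 ∧ t ≠ -2 := by
    intro t ht
    rcases ht with rfl | ht
    · exact ⟨h2.symm, fun h => h2 (by linear_combination h)⟩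
    · exact ⟨fun h => h3 (by rw [h] at ht; linear_combination ht),
        fun h => h3 (by rw [h] at ht; linear_combination ht)⟩
  rw [hw] at tw
  rcases pm _ ty with t | t | t <;> rcases pm _ tu with u | u | u <;> rw [t, u] at tw
  · exact Or.inl ⟨t, u⟩
  · refine Or.inr ⟨-y, by simp [t], by simp [u], -y, Or.inl rfl, Or.inr (by simp)⟩
  · exact Or.inr ⟨y, t, u, y, Or.inl rfl, Or.inl rfl⟩
  · refine Or.inr ⟨x * y, by simpa using u, ?_, x * x * (x * y), Or.inr (Or.inr rfl), Or.inr e1⟩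
    simp [← mul_assoc, hw, t, u]
  · refine Or.inr ⟨x * x * y, by simp [hw, t, u], ?_, x * (x * x * y), Or.inr (Or.inl rfl),
      Or.inr e2⟩
    simp only [Matrix.SpecialLinearGroup.coe_mul, m1, Matrix.trace_neg, t]
  · exact absurd (by norm_num) (four _ tw).2
  · refine Or.inr ⟨-(x * y), by simp [u], ?_, -(x * x * (x * y)), Or.inr (Or.inr (by simp)),
      Or.inl e1⟩
    simp [← mul_assoc, hw, t, u]
  · exact absurd (by norm_num) (four _ tw).1
  · refine Or.inr ⟨-(x * x * y), by simp [hw, t, u], ?_, -(x * (x * x * y)),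
      Or.inr (Or.inl (by simp)), Or.inl e2⟩
    simp only [Matrix.SpecialLinearGroup.coe_mul, Matrix.SpecialLinearGroup.coe_neg, mul_neg, m1,
      neg_neg, t]

lemma mem_of_commutes_axis (hp : 12 < p) (hx : (x : Mat (ZMod p)).trace = 1)
    (ty : TrA (y : Mat (ZMod p)).trace) (tu : ((x : Mat (ZMod p)) * y).trace ^ 2 ≠ 3)
    (h : (y : Mat (ZMod p)) * axis (x : Mat (ZMod p)) = axis (x : Mat (ZMod p)) * y) :
    y ∈ gen {x} := by
  have h2 := two_ne_zero_of_gt hp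
  have h3 : (3 : ZMod p) ≠ 0 := by
    exact_mod_cast natCast_ne_zero_of_lt (n := 3) (by norm_num) (by omega)
  have hx1 := axis_sq x
  have hy1 := axis_sq y
  have a0 : axis (x : Mat (ZMod p)) ≠ 0 := by
    intro h0
    rw [h0, hx, mul_zero] at hx1
    have := congrFun (congrFun hx1 0) 0
    simp at this
    exact h3 (by linear_combination this)
  obtain ⟨k, hk⟩ := exists_smul_of_comm h2 (trace_axis _) (trace_axis _) a0 (comm_axis h).symm
  rw [hk, smul_mul_smul_comm, hx1, hx, smul_smul] at hy1
  have e1 := congrFun (congrFun hy1 0) 0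
  simp only [Matrix.smul_apply, Matrix.one_apply_eq, smul_eq_mul, mul_one] at e1
  have hxm : x ∈ gen {x} := subset_gen (by simp)
  have mk : ∀ g : SL2 (ZMod p), g ∈ gen {x} →
      (2 : ZMod p) • (g : Mat (ZMod p)) = (2 : ZMod p) • (y : Mat (ZMod p)) → y ∈ gen {x} := by
    intro g hg e
    rwa [← eq_of_two_smul h2 e]
  simp only [axis, hx] at hk
  rcases ty with t | t
  · exfalso
    have hu := congrArg (fun m => ((x : Mat (ZMod p)) * m).trace) hk
    have hxx : (x : Mat (ZMod p)) * x = x - 1 := by rw [cayley_hamilton_sl2, hx, one_smul]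
    simp only [t, mul_sub, mul_smul_comm, hxx, mul_one, Matrix.trace_sub, Matrix.trace_smul, hx,
      Matrix.trace_one, smul_eq_mul, Fintype.card_fin] at hu
    rw [t] at e1
    have h4 : (4 : ZMod p) ≠ 0 := by
      have := mul_ne_zero h2 h2
      norm_num at this; exact this
    apply tu
    apply mul_left_cancel₀ h4
    push_cast at hu
    linear_combination (2 * ((x : Mat (ZMod p)) * y).trace - 3 * k) * hu - 3 * e1
  · have ek : k ^ 2 = 1 ^ 2 := by
      apply mul_left_cancel₀ h3
      linear_combination -t - e1
    have et := sq_eq_sq_iff_eq_or_eq_neg.1 (t.trans (one_pow 2).symm)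
    have inv : (2 : ZMod p) • ((x⁻¹ : SL2 (ZMod p)) : Mat (ZMod p)) =
        (2 : ZMod p) • (1 : Mat (ZMod p)) - (2 : ZMod p) • (x : Mat (ZMod p)) := by
      rw [inv_mat, hx, one_smul, smul_sub]
    have hn := neg_mem_gen hxm
    have hi := (gen {x}).inv_mem hxm
    have hin := neg_mem_gen hi
    rcases sq_eq_sq_iff_eq_or_eq_neg.1 ek with rfl | rfl <;> rcases et with t | t <;>
      rw [t] at hk
    · refine mk _ hxm ?_
      rw [sub_eq_iff_eq_add] at hk; rw [hk]; module
    · refine mk _ hin ?_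
      rw [Matrix.SpecialLinearGroup.coe_neg, smul_neg, inv]
      rw [sub_eq_iff_eq_add] at hk; rw [hk]; module
    · refine mk _ hi ?_
      rw [inv]
      rw [sub_eq_iff_eq_add] at hk; rw [hk]; module
    · refine mk _ hn ?_
      rw [Matrix.SpecialLinearGroup.coe_neg]
      rw [sub_eq_iff_eq_add] at hk; rw [hk]; module

lemma spair_or_apair (hp : 12 < p) (hE : Exc (gen {x, y, d})) (hd : d ∉ gen {x, y})
    (hx : (x : Mat (ZMod p)).trace = 1) (ty : TrA (y : Mat (ZMod p)).trace)
    (hy : y ∉ gen {x}) : SPair x y ∨ APair x y := by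
  have h2 := two_ne_zero_of_gt hp
  have h3 : (3 : ZMod p) ≠ 0 := by
    exact_mod_cast natCast_ne_zero_of_lt (n := 3) (by norm_num) (by omega)
  have hxm : x ∈ gen {x} := subset_gen (by simp)
  have hxm' : x ∈ gen {x, y} := subset_gen (by simp)
  have hym' : y ∈ gen {x, y} := subset_gen (by simp)
  have n1 : x * y ≠ 1 ∧ x * y ≠ -1 :=
    ⟨fun h => hy (mem_of_mul_central (Or.inl h) hxm), fun h => hy (mem_of_mul_central (Or.inr h) hxm)⟩
  have n2 : x * x * y ≠ 1 ∧ x * x * y ≠ -1 :=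
    ⟨fun h => hy (mem_of_mul_central (Or.inl h) (mul_mem hxm hxm)),
      fun h => hy (mem_of_mul_central (Or.inr h) (mul_mem hxm hxm))⟩
  have mxy : x * y ∈ gen {x, y} := mul_mem hxm' hym'
  have hlt : gen {x, y} < gen {x, y, d} :=
    lt_of_le_of_ne gen_pair_le_left fun e => hd (e ▸ subset_gen (by simp))
  rcases strongL_or_A_of_lt hp (neg_one_mem_gen _) hE hlt with h | h
  · have hx1 : x ≠ 1 ∧ x ≠ -1 := by
      constructor
      · rintro rfl; apply h3; simp at hx
        linear_combination 3 * hx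
      · rintro rfl; apply h3; simp at hx
        linear_combination -hx
    rcases comm_axis_of_strongL hp h (by rw [hx]; exact one_ne_zero) with hc | hc
    · refine absurd (mem_of_commutes_axis hp hx ty (sq_ne_three_of_trST hp ?_) hc) hy
      have hm := hlt.le mxy
      exact hE.trST.imp (fun k => by simpa using k _ hm n1.1 n1.2)
        (fun k => by simpa using k _ hm n1.1 n1.2)
    · left
      have a0 : axis (x : Mat (ZMod p)) ≠ 0 := fun e =>
        (axis_eq_zero h2 e).elim hx1.1 hx1.2
      refine ⟨trace_zero_of_anticomm h2 a0 hc, ?_⟩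
      rw [← Matrix.SpecialLinearGroup.coe_mul]
      refine trace_zero_of_anticomm h2 a0 ?_
      rw [Matrix.SpecialLinearGroup.coe_mul, mul_assoc, hc, mul_neg, ← mul_assoc, mul_axis,
        mul_assoc]
  · refine spair_or_apair_of_traces hx h2 h3 ty ?_ ?_
    · simpa using h.2 _ mxy n1.1 n1.2
    · simpa using h.2 _ (mul_mem (mul_mem hxm' hxm') hym') n2.1 n2.2

end Pairs

section TraceOne
variable {p : ℕ} [Fact p.Prime] {x y I b c d : SL2 (ZMod p)}

lemma exists_involution_of_pair (h : SPair x y ∨ APair x y) : ∃ I : SL2 (ZMod p),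
    (I : Mat (ZMod p)).trace = 0 ∧ TrA ((x : Mat (ZMod p)) * I).trace ∧ Rel x I y := by
  rcases h with ⟨h1, h2⟩ | ⟨I, h1, h2, h3⟩
  · exact ⟨y, h1, Or.inl h2, Rel.refl x y⟩
  · exact ⟨I, h1, Or.inr (by rw [h2]; norm_num), h3⟩

lemma SPair.fixes (h : SPair x y) : Fixes y (axis (x : Mat (ZMod p))) := by
  refine fixes_of_trace_zero h.1 (trace_axis _) ?_
  rw [axis, mul_sub, Matrix.trace_sub, mul_smul_comm, mul_smul_comm, Matrix.trace_smul,
    Matrix.trace_smul, Matrix.trace_mul_comm, h.2, mul_one, h.1]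
  simp

lemma trST_of_rel (hb : ∃ g, (g = I ∨ g = x * I ∨ g = x * x * I) ∧ (b = g ∨ b = -g))
    (h : (TrS ((c : Mat (ZMod p)) * d).trace ∧ TrS ((b : Mat (ZMod p)) * (c * d)).trace) ∨
      (TrI ((c : Mat (ZMod p)) * d).trace ∧ TrI ((b : Mat (ZMod p)) * (c * d)).trace)) :
    ∃ b : Mat (ZMod p), (b = I ∨ b = x * I ∨ b = x * x * I) ∧
        ((TrS ((c : Mat (ZMod p)) * d).trace ∧ TrS (b * (c * d)).trace) ∨
        (TrI ((c : Mat (ZMod p)) * d).trace ∧ TrI (b * (c * d)).trace)) := by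
  obtain ⟨g, hg, e⟩ := hb
  refine ⟨(g : Mat (ZMod p)), ?_, ?_⟩
  · rcases hg with rfl | rfl | rfl
    · exact Or.inl rfl
    · exact Or.inr (Or.inl (by simp))
    · exact Or.inr (Or.inr (by simp))
  · rcases e with rfl | rfl
    · exact h
    · simp only [Matrix.SpecialLinearGroup.coe_neg, neg_mul, Matrix.trace_neg] at h
      exact h.imp (fun k => ⟨k.1, by simpa using k.2.neg⟩) (fun k => ⟨k.1, by simpa using k.2.neg⟩)

lemma Quad.false_of_apair (hp : 12 < p) (hB : (Coef.badProd : ZMod p) ≠ 0) (h : Quad x b c d)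
    (hx : (x : Mat (ZMod p)).trace = 1) (hA : APair x b) : False := by
  have h2 := two_ne_zero_of_gt hp
  have nL : ∀ {c}, ¬ LType (gen {x, b, c}) := fun k =>
    hA.not_lType hp hx (lType_mono gen_pair_le_left k)
  have E1 := (h.lType_or_exc hp).resolve_left nL
  have E2 := (h.swap₃₄.lType_or_exc hp).resolve_left nL
  have ng : ∀ {y z w}, Quad x y z w → y ∉ gen {x} := fun k m => k.swap₂₃.notMem_pair
    (gen_mono (by rintro g rfl; simp) m)
  have pc := spair_or_apair hp (y := c) (d := b) (by rwa [Set.pair_comm])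
    h.swap₂₃.notMem_pair hx (h.swap₂₃.swap₁₂.trA hp) (ng h.swap₂₃)
  have pd := spair_or_apair hp (y := d) (d := b) (by rwa [Set.pair_comm])
    h.swap₃₄.swap₂₃.notMem_pair hx (h.swap₃₄.swap₂₃.swap₁₂.trA hp) (ng h.swap₃₄.swap₂₃)
  have E3 := h.swap₂₃.swap₃₄.lType_or_exc hp
  have hbcd : LType (gen {b, c, d}) ∨ Exc (gen {b, c, d}) :=
    h.swap₁₂.swap₂₃.swap₃₄.lType_or_exc hp
  obtain ⟨I, hI, hxI, hR⟩ := hA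
  have main : ∀ c' d' : SL2 (ZMod p), (c' : Mat (ZMod p)).trace = 0 →
      (d' : Mat (ZMod p)).trace = 0 → TrA ((x : Mat (ZMod p)) * c').trace →
      TrA ((x : Mat (ZMod p)) * d').trace → Rel x c' c → Rel x d' d →
      (Exc (gen {x, c, d}) ∨ (((x : Mat (ZMod p)) * c').trace = 0 ∧
      ((x : Mat (ZMod p)) * d').trace = 0 ∧ (((c' : Mat (ZMod p)) * d').trace = 0 ∨
      ∃ b : Mat (ZMod p), (b = I ∨ b = x * I ∨ b = x * x * I) ∧
        ((TrS ((c' : Mat (ZMod p)) * d').trace ∧ TrS (b * (c' * d')).trace) ∨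
        (TrI ((c' : Mat (ZMod p)) * d').trace ∧ TrI (b * (c' * d')).trace))))) → False := by
    intro c' d' tc td txc txd rc rd H
    refine frame_contra hp hB hx hI hxI tc td (by rwa [← hR.gen_eq rc]) (by rwa [← hR.gen_eq rd])
      ?_ ?_ ?_ txc txd (by rwa [← rc.gen_eq rd])
    · rw [← rc.gen_eq rd]
      exact fun k => h.hb (hR.mem_left (neg_one_mem_gen _) (subset_gen (by simp)) k)
    · rw [← hR.gen_eq rd]
      exact fun k => h.hc (rc.mem_left (neg_one_mem_gen _) (subset_gen (by simp)) k)
    · rw [← hR.gen_eq rc]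
      exact fun k => h.hd (rd.mem_left (neg_one_mem_gen _) (subset_gen (by simp)) k)
  rcases E3 with E3 | E3
  · have sc := pc.resolve_right fun k => k.not_lType hp hx (lType_mono gen_pair_le_left E3)
    have sd := pd.resolve_right fun k => k.not_lType hp hx (lType_mono gen_pair_le_right E3)
    refine main c d sc.1 sd.1 (Or.inl sc.2) (Or.inl sd.2) (Rel.refl x c) (Rel.refl x d)
      (Or.inr ⟨sc.2, sd.2, ?_⟩)
    have ncd : c ∉ gen {d} := fun m => h.hc (gen_mono (by rintro g rfl; simp) m)
    have nb : b ∉ gen {c, d} := fun m => h.hb (gen_mono (by rintro g (rfl | rfl) <;> simp) m)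
    rcases hbcd with ⟨v, v0, tv, fv⟩ | E4
    · left
      refine trace_zero_of_two_lines (v := axis (x : Mat (ZMod p))) h2 sc.1 sd.1 (trace_axis _) tv
        (h.axis_ne_zero hp) v0 ?_ ?_ sc.fixes (fv c (subset_gen (by simp))) sd.fixes
        (fv d (subset_gen (by simp)))
      · intro k hk
        refine h.hL (lType_of_fixes v0 tv ?_)
        rintro g (rfl | rfl | rfl | rfl)
        · rw [hk]
          exact fixes_smul (fixes_of_comm_or_anti (Or.inl (mul_axis _))) k
        all_goals exact fv _ (subset_gen (by simp))
      · constructor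
        · rintro rfl; exact ncd (subset_gen (by simp))
        · rintro rfl; exact ncd (neg_mem_gen_iff.1 (subset_gen (by simp)))
    · right
      refine trST_of_rel hR ?_
      have mc : c ∈ gen {b, c, d} := subset_gen (by simp)
      have md : d ∈ gen {b, c, d} := subset_gen (by simp)
      have mb : b ∈ gen {b, c, d} := subset_gen (by simp)
      have m1 : c * d ∈ gen {b, c, d} := mul_mem mc md
      have m2 : b * (c * d) ∈ gen {b, c, d} := mul_mem mb m1
      have cd_mem : c * d ∈ gen {c, d} := mul_mem (subset_gen (by simp)) (subset_gen (by simp))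
      have mm : ∀ {e : SL2 (ZMod p)}, (e = 1 ∨ e = -1) → ∀ s, e ∈ gen s := by
        rintro e (rfl | rfl) s
        exacts [one_mem _, neg_one_mem_gen _]
      have n1 : c * d ≠ 1 ∧ c * d ≠ -1 := by
        have : ∀ e, (e = 1 ∨ e = -1) → c * d ≠ e := fun e he k =>
          ncd ((Subgroup.mul_mem_cancel_right _ (subset_gen (by simp))).1 (k ▸ mm he {d}))
        exact ⟨this _ (Or.inl rfl), this _ (Or.inr rfl)⟩
      have n2 : b * (c * d) ≠ 1 ∧ b * (c * d) ≠ -1 := by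
        have : ∀ e, (e = 1 ∨ e = -1) → b * (c * d) ≠ e := fun e he k =>
          nb ((Subgroup.mul_mem_cancel_right _ cd_mem).1 (k ▸ mm he {c, d}))
        exact ⟨this _ (Or.inl rfl), this _ (Or.inr rfl)⟩
      exact E4.trST.imp
        (fun k => ⟨by simpa using k _ m1 n1.1 n1.2, by simpa using k _ m2 n2.1 n2.2⟩)
        (fun k => ⟨by simpa using k _ m1 n1.1 n1.2, by simpa using k _ m2 n2.1 n2.2⟩)
  · obtain ⟨c', tc, txc, rc⟩ := exists_involution_of_pair pc
    obtain ⟨d', td, txd, rd⟩ := exists_involution_of_pair pd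
    exact main c' d' tc td txc txd rc rd (Or.inl E3)

lemma Quad.lType_of_trace_one (hp : 12 < p) (hB : (Coef.badProd : ZMod p) ≠ 0) (h : Quad x b c d)
    (hx : (x : Mat (ZMod p)).trace = 1) : LType (gen {x, b, c}) := by
  by_contra hL
  have E1 := (h.lType_or_exc hp).resolve_left hL
  have ng : ∀ {y z w}, Quad x y z w → y ∉ gen {x} := fun k m => k.swap₂₃.notMem_pair
    (gen_mono (by rintro g rfl; simp) m)
  have pb := (spair_or_apair hp E1 h.notMem_pair hx (h.swap₁₂.trA hp) (ng h)).resolve_right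
    (h.false_of_apair hp hB hx)
  have pc := (spair_or_apair hp (y := c) (d := b) (by rwa [Set.pair_comm])
    h.swap₂₃.notMem_pair hx (h.swap₂₃.swap₁₂.trA hp) (ng h.swap₂₃)).resolve_right
    (h.swap₂₃.false_of_apair hp hB hx)
  refine hL (lType_of_fixes (h.axis_ne_zero hp) (trace_axis _) ?_)
  rintro g (rfl | rfl | rfl)
  · exact fixes_of_comm_or_anti (Or.inl (mul_axis _))
  · exact pb.fixes
  · exact pc.fixes

lemma Quad.trace_ne_one (hp : 12 < p) (hB : (Coef.badProd : ZMod p) ≠ 0) (h : Quad x b c d) :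
    (x : Mat (ZMod p)).trace ≠ 1 := by
  intro hx
  have perm : ∀ {y z : SL2 (ZMod p)}, LType (gen {x, y, z}) → LType (gen {y, z, x}) := by
    intro y z h
    rwa [Set.pair_comm, Set.insert_comm]
  exact h.swap₁₂.swap₂₃.swap₃₄.not_three hp ⟨perm (h.swap₂₃.swap₃₄.lType_of_trace_one hp hB hx),
    perm (h.swap₃₄.lType_of_trace_one hp hB hx), perm (h.lType_of_trace_one hp hB hx)⟩

lemma Quad.of_neg (h : Quad x b c d) : Quad (-x) b c d := by
  have key : ∀ s : Set (SL2 (ZMod p)), gen (insert (-x) s) = gen (insert x s) := by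
    intro s
    refine le_antisymm (gen_le_of ?_) (gen_le_of ?_)
    · rintro g (rfl | hg)
      · exact neg_mem_gen (subset_gen (by simp))
      · exact subset_gen (by simp [hg])
    · rintro g (rfl | hg)
      · exact neg_mem_gen_iff.1 (subset_gen (by simp))
      · exact subset_gen (by simp [hg])
  obtain ⟨h1, h2, h3, h4, h5⟩ := h
  exact ⟨fun k => h1 (neg_mem_gen_iff.1 k), by rwa [key], by rwa [key], by rwa [key], by rwa [key]⟩

theorem Quad.trace_eq_zero (hp : 12 < p) (hB : (Coef.badProd : ZMod p) ≠ 0) (h : Quad x b c d) :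
    (x : Mat (ZMod p)).trace = 0 := by
  rcases h.trA hp with t | t
  · exact t
  · rcases sq_eq_sq_iff_eq_or_eq_neg.1 (t.trans (one_pow 2).symm) with t | t
    · exact absurd t (h.trace_ne_one hp hB)
    · exact absurd (by simp [t]) (h.of_neg.trace_ne_one hp hB)

end TraceOne

section GramCheck
namespace Coef

/-- The square of the trace of a product of three involutions with the given pairwise traces. -/
def fval (a b c : Coef) : Coef :=
  (ofInt 4).sub (((a.mul b).mul c).add ((a.mul a).add ((b.mul b).add (c.mul c))))

def twoZeros (a b c : Coef) : Bool :=
  (a.isZero && b.isZero) || (a.isZero && c.isZero) || (b.isZero && c.isZero)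

def contains (l : List Coef) (x : Coef) : Bool := l.any x.beq

def typeOK (l : List Coef) (a b c : Coef) : Bool :=
  contains l a && contains l b && contains l c &&
    l.any (fun t => !t.isZero && !((fval a b c).sub (t.mul t)).good) &&
    l.any (fun t => !(((a.mul b).add c).sub t).good)

def excOK (a b c : Coef) : Bool := !twoZeros a b c && (typeOK listS a b c || typeOK listI a b c)

def lineOK (a b c : Coef) : Bool := twoZeros a b c || !(fval a b c).good

/-- The determinant of the Gram matrix of four involutions. -/
def gram (a b c d e g : Coef) : Coef :=
  let q := b.mul e
  let r := c.mul d
  let k := ofInt (-4)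
  let s := ((a.mul a).add ((b.mul b).add (c.mul c))).add ((d.mul d).add (e.mul e))
  let α := (a.mul a).add k
  let β := (k.mul ((b.mul c).add (d.mul e))).sub (two (a.mul (q.add r)))
  let γ := ((ofInt 16).add (k.mul (s.add (((a.mul b).mul d).add ((a.mul c).mul e))))).add
    ((q.sub r).mul (q.sub r))
  (g.mul ((α.mul g).add β)).add γ

/-- The effect of the half-turn about an involution on trace coordinates. -/
def turn (u v w : Coef) (r : Vec) : Fin 3 → Vec
  | 0 => (r.1, ((r.1.mul u).add r.2.1).neg, ((r.1.mul v).add r.2.2).neg)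
  | 1 => (((r.2.1.mul u).add r.1).neg, r.2.1, ((r.2.1.mul w).add r.2.2).neg)
  | 2 => (((r.2.2.mul v).add r.1).neg, ((r.2.2.mul w).add r.2.1).neg, r.2.2)

def column (u v w : Coef) : Fin 3 → Vec
  | 0 => (ofInt (-2), u, v)
  | 1 => (u, ofInt (-2), w)
  | 2 => (v, w, ofInt (-2))

def orbit (u v w : Coef) (i : Fin 3) (l : List (Fin 3)) : Vec :=
  l.foldl (turn u v w) (column u v w i)

def expressible (W : List (Fin 3 × List (Fin 3))) (u v w x y z : Coef) : Bool :=
  (fval u v w).good && W.any fun k => eqUpToSign (orbit u v w k.1 k.2) (x, y, z)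

def words₁ : List (Fin 3 × List (Fin 3)) :=
  [(2, [1]), (2, [0]), (2, [0, 1]), (1, [2]), (1, [0, 2]), (0, [2]), (2, [1, 0]), (0, [1, 2, 1]),
    (0, [2, 1]), (1, [2, 0, 2]), (0, [2, 1, 0, 2]), (1, [2, 0, 1]), (1, [2, 0, 1, 2]),
    (0, [1, 2, 0, 1]), (0, [2, 0, 1])]

def words₂ : List (Fin 3 × List (Fin 3)) :=
  [(0, [1, 2]), (1, [2]), (0, [2]), (1, [2, 0, 1]), (0, [2, 1, 2]), (1, [2, 0]), (1, [0, 2, 0]),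
    (0, [1, 0, 2]), (2, [0, 1, 2, 0]), (1, [2, 1, 0])]

def words₃ : List (Fin 3 × List (Fin 3)) :=
  [(0, [2, 1]), (0, [1, 2]), (0, [2, 0, 1]), (1, [0, 2, 1]), (2, [1, 0, 2, 1]), (1, [2, 1, 0]),
    (0, [1, 2, 0, 1])]

def words₄ : List (Fin 3 × List (Fin 3)) := [(0, [1, 0, 2]), (1, [0, 2, 1])]

def gramOK (a b c d e g : Coef) : Bool :=
  (!excOK b c g && (!lineOK b c g || !excOK d e g && !g.isZero)) ||
  (!excOK d e g && !lineOK d e g) ||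
  (b.isZero && c.isZero && g.isZero) || (d.isZero && e.isZero && g.isZero) ||
  (gram a b c d e g).good ||
  expressible words₁ a b d c e g || expressible words₂ a c e b d g ||
  expressible words₃ b c g a d e || expressible words₄ d e g a b c

def listP : List Coef := [z0, z1, ⟨0, 1, 0, 0⟩, ⟨0, 0, 1, 0⟩, ⟨-1, 0, 1, 0⟩]

lemma gramOK_of_mem : (listP.all fun a => listP.all fun b => listT.all fun d => !excOK a b d ||
    listP.all fun c => listT.all fun e => !excOK a c e || listT.all fun g =>
      gramOK a b c d e g) = true := by
  decide +kernel

end Coef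
end GramCheck

section Gram
variable {K : Type*} [Field K]

lemma det_gram_eq_zero {A B C D : SL2 K} (hA : (A : Mat K).trace = 0) (hB : (B : Mat K).trace = 0)
    (hC : (C : Mat K).trace = 0) (hD : (D : Mat K).trace = 0) {a b c d e g : K}
    (ha : ((A : Mat K) * B).trace = a) (hb : ((A : Mat K) * C).trace = b)
    (hc : ((A : Mat K) * D).trace = c) (hd : ((B : Mat K) * C).trace = d)
    (he : ((B : Mat K) * D).trace = e) (hg : ((C : Mat K) * D).trace = g) :
    g * ((a * a + -4) * g + (-4 * (b * c + d * e) - 2 * (a * (b * e + c * d)))) +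
      (16 + -4 * (a * a + (b * b + c * c) + (d * d + e * e) + (a * b * d + a * c * e)) +
        (b * e - c * d) * (b * e - c * d)) = 0 := by
  have sA := trace_sq_of_trace_zero hA
  have sB := trace_sq_of_trace_zero hB
  have sC := trace_sq_of_trace_zero hC
  have sD := trace_sq_of_trace_zero hD
  have h1 : !![-2, a, b, c; a, -2, d, e; b, d, -2, g; c, e, g, -2] =
      !![A 0 0, A 0 1, A 1 0, 0; B 0 0, B 0 1, B 1 0, 0; C 0 0, C 0 1, C 1 0, 0;
        D 0 0, D 0 1, D 1 0, 0] *
      !![2 * A 0 0, 2 * B 0 0, 2 * C 0 0, 2 * D 0 0; A 1 0, B 1 0, C 1 0, D 1 0;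
        A 0 1, B 0 1, C 0 1, D 0 1; 0, 0, 0, 0] := by
    rw [traceless_iff] at hA hB hC hD
    simp only [Matrix.trace_fin_two, mat_mul_entry, hA, hB, hC, hD] at sA sB sC sD ha hb hc hd he hg
    ext i j
    fin_cases i <;> fin_cases j <;>
      simp [Matrix.mul_apply, Fin.sum_univ_succ] <;>
      first
        | linear_combination -sA | linear_combination -sB | linear_combination -sC
        | linear_combination -sD | linear_combination -ha | linear_combination -hb
        | linear_combination -hc | linear_combination -hd | linear_combination -he
        | linear_combination -hg
  have h2 := congrArg Matrix.det h1
  rw [Matrix.det_mul, Matrix.det_eq_zero_of_column_eq_zero (A := !![A 0 0, A 0 1, A 1 0, 0;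
      B 0 0, B 0 1, B 1 0, 0; C 0 0, C 0 1, C 1 0, 0; D 0 0, D 0 1, D 1 0, 0]) 3
    (by intro i; fin_cases i <;> rfl), zero_mul] at h2
  rw [← h2, Matrix.det_succ_row_zero]
  simp [Fin.sum_univ_succ, Matrix.det_fin_three, Fin.succAbove]
  ring

lemma trace_mul_mul_sq (h2 : (2 : K) ≠ 0) {A B C : SL2 K} (hA : (A : Mat K).trace = 0)
    (hB : (B : Mat K).trace = 0) (hC : (C : Mat K).trace = 0) {a b c : K}
    (ha : ((A : Mat K) * B).trace = a) (hb : ((A : Mat K) * C).trace = b)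
    (hc : ((B : Mat K) * C).trace = c) :
    ((A : Mat K) * B * C).trace ^ 2 = 4 - (a * b * c + (a * a + (b * b + c * c))) := by
  apply mul_left_cancel₀ h2
  rw [gram_three hA hB hC (trace_sq_of_trace_zero hA) (trace_sq_of_trace_zero hB)
    (trace_sq_of_trace_zero hC), ha, hb, hc]
  ring

lemma trace_turn {A B Y : SL2 K} (hA : (A : Mat K).trace = 0) (hY : (Y : Mat K).trace = 0) :
    ((A * Y * A⁻¹ : SL2 K) : Mat K).trace = 0 ∧
    ((A : Mat K) * (A * Y * A⁻¹ : SL2 K)).trace = ((A : Mat K) * Y).trace ∧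
    ((B : Mat K) * (A * Y * A⁻¹ : SL2 K)).trace =
      -(((A : Mat K) * Y).trace * ((B : Mat K) * A).trace + ((B : Mat K) * Y).trace) := by
  have h := conj_of_trace_zero hA hY
  simp only [Matrix.SpecialLinearGroup.coe_mul] at *
  rw [h]
  refine ⟨by simp [hA, hY], ?_, ?_⟩
  · simp only [mul_sub, mul_neg, mul_smul_comm, Matrix.trace_sub, Matrix.trace_neg,
      Matrix.trace_smul, trace_sq_of_trace_zero hA, smul_eq_mul]
    ring
  · simp only [mul_sub, mul_neg, mul_smul_comm, Matrix.trace_sub, Matrix.trace_neg,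
      Matrix.trace_smul, smul_eq_mul]
    ring

end Gram

section GramEval
namespace Coef
variable {L : Type*} [Field L] {s f : L}

lemma listT_separated : (listT.all fun x => listT.all fun y => x.beq y || (x.sub y).good) = true := by
  decide +kernel

lemma eq_of_eval_eq (hs : s ^ 2 = 2) (hf : f ^ 2 = f + 1) (hB : (badProd : L) ≠ 0) {x y : Coef}
    (hx : x ∈ listT) (hy : y ∈ listT) (h : x.eval s f = y.eval s f) : x = y := by
  have := List.all_eq_true.1 (List.all_eq_true.1 listT_separated x hx) y hy
  rcases Bool.or_eq_true _ _ ▸ this with h1 | h1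
  · exact eq_of_beq h1
  · exact absurd (by rw [eval_sub, h, sub_self]) (eval_ne_zero hs hf hB h1)

lemma isZero_iff (hs : s ^ 2 = 2) (hf : f ^ 2 = f + 1) (hB : (badProd : L) ≠ 0) {x : Coef}
    (hx : x ∈ listT) : x.isZero = true ↔ x.eval s f = 0 := by
  refine ⟨eval_of_isZero, fun h => ?_⟩
  rw [eq_of_eval_eq hs hf hB hx (y := z0) (by simp [listT]) (by rw [h]; simp [eval, z0])]
  rfl

lemma contains_of_mem {l : List Coef} {x : Coef} (h : x ∈ l) : contains l x = true :=
  List.any_eq_true.2 ⟨x, h, by simp [beq]⟩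

lemma eval_fval (hs : s ^ 2 = 2) (hf : f ^ 2 = f + 1) (a b c : Coef) :
    (fval a b c).eval s f = 4 - (a.eval s f * b.eval s f * c.eval s f +
      (a.eval s f * a.eval s f + (b.eval s f * b.eval s f + c.eval s f * c.eval s f))) := by
  simp only [fval, eval_sub, eval_add, eval_mul hs hf, eval_ofInt]
  norm_num

lemma eval_gram (hs : s ^ 2 = 2) (hf : f ^ 2 = f + 1) (a b c d e g : Coef) :
    (gram a b c d e g).eval s f =
    g.eval s f * ((a.eval s f * a.eval s f + -4) * g.eval s f + (-4 * (b.eval s f * c.eval s f +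
      d.eval s f * e.eval s f) - 2 * (a.eval s f * (b.eval s f * e.eval s f +
      c.eval s f * d.eval s f)))) +
      (16 + -4 * (a.eval s f * a.eval s f + (b.eval s f * b.eval s f + c.eval s f * c.eval s f) +
        (d.eval s f * d.eval s f + e.eval s f * e.eval s f) +
        (a.eval s f * b.eval s f * d.eval s f + a.eval s f * c.eval s f * e.eval s f)) +
        (b.eval s f * e.eval s f - c.eval s f * d.eval s f) *
        (b.eval s f * e.eval s f - c.eval s f * d.eval s f)) := by
  simp only [gram, two, eval_sub, eval_add, eval_mul hs hf, eval_ofInt]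
  push_cast
  ring

lemma typeOK_of (hs : s ^ 2 = 2) (hf : f ^ 2 = f + 1) (hB : (badProd : L) ≠ 0) {l : List Coef}
    (hl : ∀ r ∈ l, r ∈ listT) {a b c : Coef} (ha : a ∈ listT) (hb : b ∈ listT) (hc : c ∈ listT)
    (ha' : ∃ r ∈ l, r.eval s f = a.eval s f) (hb' : ∃ r ∈ l, r.eval s f = b.eval s f)
    (hc' : ∃ r ∈ l, r.eval s f = c.eval s f) {t : L} (ht : ∃ r ∈ l, r.eval s f = t) (t0 : t ≠ 0)
    (htF : t ^ 2 = (fval a b c).eval s f)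
    (hw : ∃ r ∈ l, r.eval s f = a.eval s f * b.eval s f + c.eval s f) : typeOK l a b c = true := by
  have mem : ∀ {x}, x ∈ listT → (∃ r ∈ l, r.eval s f = x.eval s f) → contains l x = true := by
    rintro x hx ⟨r, hr, e⟩
    rw [← eq_of_eval_eq hs hf hB (hl r hr) hx e]
    exact contains_of_mem hr
  have ng : ∀ {x : Coef}, x.eval s f = 0 → x.good = false := fun h => not_good_of_eval hs hf hB h
  obtain ⟨r, hr, e⟩ := ht
  obtain ⟨w, hw, ew⟩ := hw
  rw [typeOK, mem ha ha', mem hb hb', mem hc hc', Bool.true_and, Bool.true_and, Bool.true_and,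
    Bool.and_eq_true, List.any_eq_true, List.any_eq_true]
  refine ⟨⟨r, hr, ?_⟩, ⟨w, hw, ?_⟩⟩
  · have : r.isZero = false := by
      rw [← Bool.not_eq_true, isZero_iff hs hf hB (hl r hr), e]; exact t0
    rw [this, ng (by rw [eval_sub, eval_mul hs hf, e, ← htF]; ring)]
    rfl
  · rw [ng (by rw [eval_sub, eval_add, eval_mul hs hf, ew]; ring)]
    rfl

variable {K : Type*} [Field K] {φ : K →+* L}

lemma ev_turn (hs : s ^ 2 = 2) (hf : f ^ 2 = f + 1) {A B C Y : SL2 K}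
    (hA : (A : Mat K).trace = 0) (hB : (B : Mat K).trace = 0) (hC : (C : Mat K).trace = 0)
    (hY : (Y : Mat K).trace = 0) {u v w : Coef}
    (hu : u.eval s f = φ ((A : Mat K) * B).trace) (hv : v.eval s f = φ ((A : Mat K) * C).trace)
    (hw : w.eval s f = φ ((B : Mat K) * C).trace) {r : Vec}
    (hr : Ev s f φ r ((A : Mat K) * Y).trace ((B : Mat K) * Y).trace ((C : Mat K) * Y).trace)
    (i : Fin 3) : ∃ Z : SL2 K, (Z = ![A, B, C] i * Y * (![A, B, C] i)⁻¹) ∧ (Z : Mat K).trace = 0 ∧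
      Ev s f φ (turn u v w r i) ((A : Mat K) * Z).trace ((B : Mat K) * Z).trace
        ((C : Mat K) * Z).trace := by
  obtain ⟨r1, r2, r3⟩ := hr
  refine ⟨_, rfl, ?_⟩
  fin_cases i
  · obtain ⟨h0, h1, h2⟩ := trace_turn (B := B) hA hY
    obtain ⟨-, -, h3⟩ := trace_turn (B := C) hA hY
    refine ⟨h0, ?_, ?_, ?_⟩
    · exact r1.trans (congrArg φ h1.symm)
    · simp only [turn, eval_neg, eval_add, eval_mul hs hf, r1, r2, hu]
      rw [Matrix.trace_mul_comm (A : Mat K) B, ← map_mul, ← map_add, ← map_neg]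
      exact congrArg φ h2.symm
    · simp only [turn, eval_neg, eval_add, eval_mul hs hf, r1, r3, hv]
      rw [Matrix.trace_mul_comm (A : Mat K) C, ← map_mul, ← map_add, ← map_neg]
      exact congrArg φ h3.symm
  · obtain ⟨h0, h1, h2⟩ := trace_turn (B := A) hB hY
    obtain ⟨-, -, h3⟩ := trace_turn (B := C) hB hY
    refine ⟨h0, ?_, ?_, ?_⟩
    · simp only [turn, eval_neg, eval_add, eval_mul hs hf, r1, r2, hu]
      rw [← map_mul, ← map_add, ← map_neg]
      exact congrArg φ h2.symm
    · exact r2.trans (congrArg φ h1.symm)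
    · simp only [turn, eval_neg, eval_add, eval_mul hs hf, r2, r3, hw]
      rw [Matrix.trace_mul_comm (B : Mat K) C, ← map_mul, ← map_add, ← map_neg]
      exact congrArg φ h3.symm
  · obtain ⟨h0, h1, h2⟩ := trace_turn (B := A) hC hY
    obtain ⟨-, -, h3⟩ := trace_turn (B := B) hC hY
    refine ⟨h0, ?_, ?_, ?_⟩
    · simp only [turn, eval_neg, eval_add, eval_mul hs hf, r1, r3, hv]
      rw [← map_mul, ← map_add, ← map_neg]
      exact congrArg φ h2.symm
    · simp only [turn, eval_neg, eval_add, eval_mul hs hf, r2, r3, hw]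
      rw [← map_mul, ← map_add, ← map_neg]
      exact congrArg φ h3.symm
    · exact r3.trans (congrArg φ h1.symm)

lemma exists_of_orbit (hs : s ^ 2 = 2) (hf : f ^ 2 = f + 1) {A B C : SL2 K}
    {H : Subgroup (SL2 K)} (mA : A ∈ H) (mB : B ∈ H) (mC : C ∈ H)
    (hA : (A : Mat K).trace = 0) (hB : (B : Mat K).trace = 0) (hC : (C : Mat K).trace = 0)
    {u v w : Coef}
    (hu : u.eval s f = φ ((A : Mat K) * B).trace) (hv : v.eval s f = φ ((A : Mat K) * C).trace)
    (hw : w.eval s f = φ ((B : Mat K) * C).trace) (i : Fin 3) (l : List (Fin 3)) :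
    ∃ Y ∈ H, (Y : Mat K).trace = 0 ∧ Ev s f φ (orbit u v w i l) ((A : Mat K) * Y).trace
      ((B : Mat K) * Y).trace ((C : Mat K) * Y).trace := by
  have h0 : ∃ Y ∈ H, (Y : Mat K).trace = 0 ∧ Ev s f φ (column u v w i) ((A : Mat K) * Y).trace
      ((B : Mat K) * Y).trace ((C : Mat K) * Y).trace := by
    fin_cases i
    · refine ⟨A, mA, hA, ?_, ?_, ?_⟩
      · simp [column, eval_ofInt, trace_sq_of_trace_zero hA, map_ofNat φ 2]
      · simp [column, hu, Matrix.trace_mul_comm (A : Mat K)]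
      · simp [column, hv, Matrix.trace_mul_comm (A : Mat K)]
    · refine ⟨B, mB, hB, ?_, ?_, ?_⟩
      · simp [column, hu]
      · simp [column, eval_ofInt, trace_sq_of_trace_zero hB, map_ofNat φ 2]
      · simp [column, hw, Matrix.trace_mul_comm (B : Mat K)]
    · refine ⟨C, mC, hC, ?_, ?_, ?_⟩
      · simp [column, hv]
      · simp [column, hw]
      · simp [column, eval_ofInt, trace_sq_of_trace_zero hC, map_ofNat φ 2]
  have extend_word : ∀ (l : List (Fin 3)) (r : Vec), (∃ Y ∈ H, (Y : Mat K).trace = 0 ∧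
      Ev s f φ r ((A : Mat K) * Y).trace ((B : Mat K) * Y).trace ((C : Mat K) * Y).trace) →
      ∃ Y ∈ H, (Y : Mat K).trace = 0 ∧ Ev s f φ (l.foldl (turn u v w) r) ((A : Mat K) * Y).trace
      ((B : Mat K) * Y).trace ((C : Mat K) * Y).trace := by
    intro l
    induction l with
    | nil => exact fun _ h => h
    | cons i l ih =>
      rintro r ⟨Y, mY, hY, hr⟩
      obtain ⟨Z, hZ, h1, h2⟩ := ev_turn hs hf hA hB hC hY hu hv hw hr i
      refine ih _ ⟨Z, ?_, h1, h2⟩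
      have mi : ![A, B, C] i ∈ H := by fin_cases i <;> assumption
      rw [hZ]
      exact H.mul_mem (H.mul_mem mi mY) (H.inv_mem mi)
  exact extend_word l _ h0

lemma mem_of_expressible (hs : s ^ 2 = 2) (hf : f ^ 2 = f + 1) (hbad : (badProd : L) ≠ 0)
    (h2 : (2 : K) ≠ 0) {A B C D : SL2 K} {H : Subgroup (SL2 K)} (hneg : -1 ∈ H) (mA : A ∈ H)
    (mB : B ∈ H) (mC : C ∈ H) (hA : (A : Mat K).trace = 0) (hB : (B : Mat K).trace = 0)
    (hC : (C : Mat K).trace = 0) (hD : (D : Mat K).trace = 0) {u v w x y z : Coef}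
    (hu : u.eval s f = φ ((A : Mat K) * B).trace) (hv : v.eval s f = φ ((A : Mat K) * C).trace)
    (hw : w.eval s f = φ ((B : Mat K) * C).trace) (hx : x.eval s f = φ ((A : Mat K) * D).trace)
    (hy : y.eval s f = φ ((B : Mat K) * D).trace) (hz : z.eval s f = φ ((C : Mat K) * D).trace)
    {W : List (Fin 3 × List (Fin 3))} (h : expressible W u v w x y z = true) : D ∈ H := by
  rw [expressible, Bool.and_eq_true, List.any_eq_true] at h
  obtain ⟨hF, k, -, hk⟩ := h
  obtain ⟨Y, mY, hY, hr⟩ := exists_of_orbit hs hf mA mB mC hA hB hC hu hv hw k.1 k.2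
  have hABC : ((A : Mat K) * B * C).trace ≠ 0 := by
    intro h0
    have h1 := trace_mul_mul_sq h2 hA hB hC rfl rfl rfl
    rw [h0, zero_pow two_ne_zero] at h1
    refine eval_ne_zero hs hf hbad hF ?_
    rw [eval_fval hs hf, hu, hv, hw, ← map_zero φ, h1]
    simp [map_ofNat φ 4]
  have ht : Ev s f φ (x, y, z) ((A : Mat K) * D).trace ((B : Mat K) * D).trace
    ((C : Mat K) * D).trace := ⟨hx, hy, hz⟩
  rcases hr.eq_or_eq_neg ht hk with ⟨e1, e2, e3⟩ | ⟨e1, e2, e3⟩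
  · have : (Y : Mat K) - D = 0 := by
      refine eq_zero_of_traces h2 hA hB hC (by simp [hY, hD]) hABC ?_ ?_ ?_ <;>
        simp [mul_sub, e1, e2, e3]
    have : Y = D := Subtype.ext (sub_eq_zero.1 this)
    rwa [← this]
  · have : (Y : Mat K) + D = 0 := by
      refine eq_zero_of_traces h2 hA hB hC (by simp [hY, hD]) hABC ?_ ?_ ?_ <;>
        simp [mul_add, e1, e2, e3]
    have : D = -1 * Y := Subtype.ext (by simpa using eq_neg_of_add_eq_zero_right this)
    rw [this]
    exact H.mul_mem hneg mY

end Coef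
end GramEval

section Involutions
variable {p : ℕ} [Fact p.Prime] {A B C : SL2 (ZMod p)}

lemma fixes_self : Fixes A (A : Mat (ZMod p)) :=
  ⟨1, (one_smul _ _).symm⟩

lemma lType_of_orthogonal (hA : (A : Mat (ZMod p)).trace = 0) (hB : (B : Mat (ZMod p)).trace = 0)
    (hC : (C : Mat (ZMod p)).trace = 0) (h1 : ((A : Mat (ZMod p)) * B).trace = 0)
    (h2 : ((A : Mat (ZMod p)) * C).trace = 0) : LType (gen {A, B, C}) := by
  refine lType_of_fixes (ne_zero_of_sl2 A) hA ?_
  rintro g (rfl | rfl | rfl)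
  · exact fixes_self
  · exact fixes_of_trace_zero hB hA (by rwa [Matrix.trace_mul_comm])
  · exact fixes_of_trace_zero hC hA (by rwa [Matrix.trace_mul_comm])

lemma lType_of_trace_mul_mul (h2 : (2 : ZMod p) ≠ 0) (hA : (A : Mat (ZMod p)).trace = 0)
    (hB : (B : Mat (ZMod p)).trace = 0) (hC : (C : Mat (ZMod p)).trace = 0)
    (hAB : B ≠ A ∧ B ≠ -A) (h : ((A : Mat (ZMod p)) * B * C).trace = 0) :
    LType (gen {A, B, C}) := by
  have h0 : br (A : Mat (ZMod p)) B ≠ 0 := fun k => by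
    rcases eq_or_neg_of_commute_involution h2 hA hB (sub_eq_zero.1 k) with e | e
    exacts [hAB.1 e, hAB.2 e]
  refine lType_of_fixes h0 (trace_br _ _) ?_
  rintro g (rfl | rfl | rfl)
  · refine fixes_of_trace_zero hA (trace_br _ _) ?_
    rw [br, mul_sub, Matrix.trace_sub, ← mul_assoc, ← mul_assoc, Matrix.trace_mul_comm _ (g : Mat (ZMod p)),
      ← mul_assoc, sub_self]
  · refine fixes_of_trace_zero hB (trace_br _ _) ?_
    rw [br, mul_sub, Matrix.trace_sub, ← mul_assoc, Matrix.trace_mul_comm _ (g : Mat (ZMod p)),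
      sub_self]
  · refine fixes_of_trace_zero hC (trace_br _ _) ?_
    rw [trace_br_mul hA hB hC, h, mul_zero]

lemma zeros_of_lType (h2 : (2 : ZMod p) ≠ 0) (hA : (A : Mat (ZMod p)).trace = 0)
    (hB : (B : Mat (ZMod p)).trace = 0) (hC : (C : Mat (ZMod p)).trace = 0)
    (hAB : A ≠ B ∧ A ≠ -B) (hAC : A ≠ C ∧ A ≠ -C) (hBC : B ≠ C ∧ B ≠ -C)
    (h : LType (gen {A, B, C})) :
    (((A : Mat (ZMod p)) * B).trace = 0 ∧ ((A : Mat (ZMod p)) * C).trace = 0) ∨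
    (((A : Mat (ZMod p)) * B).trace = 0 ∧ ((B : Mat (ZMod p)) * C).trace = 0) ∨
    (((A : Mat (ZMod p)) * C).trace = 0 ∧ ((B : Mat (ZMod p)) * C).trace = 0) ∨
    ((A : Mat (ZMod p)) * B * C).trace = 0 := by
  obtain ⟨v, v0, tv, hv⟩ := h
  have key : ∀ {X Y : SL2 (ZMod p)}, (X : Mat (ZMod p)).trace = 0 → (Y : Mat (ZMod p)).trace = 0 →
      X ≠ Y ∧ X ≠ -Y → (∃ c : ZMod p, v = c • (X : Mat (ZMod p))) → Y ∈ gen {A, B, C} →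
      ((X : Mat (ZMod p)) * Y).trace = 0 := by
    rintro X Y hX hY n ⟨c, rfl⟩ mY
    have c0 : c ≠ 0 := fun h => v0 (by rw [h, zero_smul])
    rcases fixes_involution hY tv (hv Y mY) with ⟨k, hk⟩ | hk
    · have : (X : Mat (ZMod p)) = (c⁻¹ * k) • (Y : Mat (ZMod p)) := by
        rw [mul_smul, ← hk, smul_smul, inv_mul_cancel₀ c0, one_smul]
      rcases eq_or_eq_neg_of_smul this with e | e
      exacts [absurd e n.1, absurd e n.2]
    · rw [Matrix.mul_smul, Matrix.trace_smul, smul_eq_mul, mul_eq_zero] at hk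
      rw [Matrix.trace_mul_comm]
      exact hk.resolve_left c0
  have sym : ∀ {X Y : SL2 (ZMod p)}, X ≠ Y ∧ X ≠ -Y → Y ≠ X ∧ Y ≠ -X := fun h =>
    ⟨h.1.symm, fun k => h.2 (by rw [k, neg_neg])⟩
  have mA : A ∈ gen {A, B, C} := subset_gen (by simp)
  have mB : B ∈ gen {A, B, C} := subset_gen (by simp)
  have mC : C ∈ gen {A, B, C} := subset_gen (by simp)
  rcases fixes_involution hA tv (hv A mA) with a | a
  · exact Or.inl ⟨key hA hB hAB a mB, key hA hC hAC a mC⟩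
  rcases fixes_involution hB tv (hv B mB) with b | b
  · refine Or.inr (Or.inl ⟨?_, key hB hC hBC b mC⟩)
    rw [Matrix.trace_mul_comm]; exact key hB hA (sym hAB) b mA
  rcases fixes_involution hC tv (hv C mC) with c | c
  · refine Or.inr (Or.inr (Or.inl ⟨?_, ?_⟩)) <;> rw [Matrix.trace_mul_comm]
    exacts [key hC hA (sym hAC) c mA, key hC hB (sym hBC) c mB]
  · by_contra k
    exact v0 (eq_zero_of_traces h2 hA hB hC tv (fun h => k (Or.inr (Or.inr (Or.inr h)))) a b c)

lemma ne_of_notMem (h : A ∉ gen {B, C}) : (A ≠ B ∧ A ≠ -B) ∧ (A ≠ C ∧ A ≠ -C) :=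
  ⟨⟨fun e => h (e ▸ subset_gen (by simp)), fun e => h (e ▸ neg_mem_gen (subset_gen (by simp)))⟩,
    ⟨fun e => h (e ▸ subset_gen (by simp)), fun e => h (e ▸ neg_mem_gen (subset_gen (by simp)))⟩⟩

namespace Coef
variable {L : Type*} [Field L] {s f : L} {φ : ZMod p →+* L}

lemma lineOK_of (hs : s ^ 2 = 2) (hf : f ^ 2 = f + 1) (hbad : (badProd : L) ≠ 0)
    (h2 : (2 : ZMod p) ≠ 0) (hA : (A : Mat (ZMod p)).trace = 0)
    (hB : (B : Mat (ZMod p)).trace = 0) (hC : (C : Mat (ZMod p)).trace = 0)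
    (nA : A ∉ gen {B, C}) (nB : B ∉ gen {A, C})
    (h : LType (gen {A, B, C})) {a b c : Coef} (ma : a ∈ listT) (mb : b ∈ listT) (mc : c ∈ listT)
    (ha : a.eval s f = φ ((A : Mat (ZMod p)) * B).trace)
    (hb : b.eval s f = φ ((A : Mat (ZMod p)) * C).trace)
    (hc : c.eval s f = φ ((B : Mat (ZMod p)) * C).trace) : lineOK a b c = true := by
  have z : ∀ {x : Coef} {t : ZMod p}, x ∈ listT → x.eval s f = φ t → t = 0 → x.isZero = true :=
    fun m h k => (isZero_iff hs hf hbad m).2 (by rw [h, k, map_zero])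
  rw [lineOK, twoZeros]
  rcases zeros_of_lType h2 hA hB hC (ne_of_notMem nA).1 (ne_of_notMem nA).2 (ne_of_notMem nB).2 h
    with ⟨h1, h2⟩ | ⟨h1, h2⟩ | ⟨h1, h2⟩ | h1
  · simp [z ma ha h1, z mb hb h2]
  · simp [z ma ha h1, z mc hc h2]
  · simp [z mb hb h1, z mc hc h2]
  · have hF := trace_mul_mul_sq h2 hA hB hC rfl rfl rfl
    rw [h1, zero_pow two_ne_zero] at hF
    rw [not_good_of_eval hs hf hbad (x := fval a b c)]
    · simp
    · rw [eval_fval hs hf, ha, hb, hc, ← map_zero φ, hF]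
      simp [map_ofNat φ 4]

lemma excOK_of (hs : s ^ 2 = 2) (hf : f ^ 2 = f + 1) (hbad : (badProd : L) ≠ 0)
    (h2 : (2 : ZMod p) ≠ 0) (hA : (A : Mat (ZMod p)).trace = 0)
    (hB : (B : Mat (ZMod p)).trace = 0) (hC : (C : Mat (ZMod p)).trace = 0)
    (nB : B ∉ gen {A, C}) (nC : C ∉ gen {A, B})
    (hE : Exc (gen {A, B, C})) (hL : ¬ LType (gen {A, B, C}))
    {a b c : Coef} (ma : a ∈ listT) (mb : b ∈ listT) (mc : c ∈ listT)
    (ha : a.eval s f = φ ((A : Mat (ZMod p)) * B).trace)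
    (hb : b.eval s f = φ ((A : Mat (ZMod p)) * C).trace)
    (hc : c.eval s f = φ ((B : Mat (ZMod p)) * C).trace) : excOK a b c = true := by
  have z : ∀ {x : Coef} {t : ZMod p}, x ∈ listT → x.eval s f = φ t → x.isZero = true → t = 0 := by
    intro x t m h k
    have := (isZero_iff hs hf hbad m).1 k
    rw [h] at this
    exact (map_eq_zero φ).1 this
  have h0 : twoZeros a b c = false := by
    rw [← Bool.not_eq_true]
    intro h
    simp only [twoZeros, Bool.or_eq_true, Bool.and_eq_true] at h
    rcases h with (⟨x, y⟩ | ⟨x, y⟩) | ⟨x, y⟩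
    · exact hL (lType_of_orthogonal hA hB hC (z ma ha x) (z mb hb y))
    · refine hL ?_
      rw [Set.insert_comm]
      exact lType_of_orthogonal hB hA hC (by rw [Matrix.trace_mul_comm]; exact z ma ha x) (z mc hc y)
    · refine hL ?_
      rw [Set.pair_comm, Set.insert_comm]
      refine lType_of_orthogonal hC hA hB ?_ ?_ <;> rw [Matrix.trace_mul_comm]
      exacts [z mb hb x, z mc hc y]
  have t0 : φ ((A : Mat (ZMod p)) * B * C).trace ≠ 0 := fun h =>
    hL (lType_of_trace_mul_mul h2 hA hB hC
      ⟨(ne_of_notMem nB).1.1, (ne_of_notMem nB).1.2⟩ ((map_eq_zero φ).1 h))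
  have hF : φ ((A : Mat (ZMod p)) * B * C).trace ^ 2 = (fval a b c).eval s f := by
    rw [← map_pow, trace_mul_mul_sq h2 hA hB hC rfl rfl rfl, eval_fval hs hf, ha, hb, hc]
    simp [map_ofNat φ 4]
  have hw : -((A * B * A⁻¹ * C : SL2 (ZMod p)) : Mat (ZMod p)).trace =
      ((A : Mat (ZMod p)) * B).trace * ((A : Mat (ZMod p)) * C).trace +
      ((B : Mat (ZMod p)) * C).trace := by
    rw [Matrix.SpecialLinearGroup.coe_mul, Matrix.SpecialLinearGroup.coe_mul,
      Matrix.SpecialLinearGroup.coe_mul, conj_of_trace_zero hA hB]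
    simp [sub_mul]
    ring
  have nc : ∀ {X Y : SL2 (ZMod p)} {s : Set (SL2 (ZMod p))}, X ∈ gen s → Y ∉ gen s →
      X * Y ≠ 1 ∧ X * Y ≠ -1 := fun hX hY =>
    ⟨fun e => hY (mem_of_mul_central (Or.inl e) hX), fun e => hY (mem_of_mul_central (Or.inr e) hX)⟩
  have gA : A ∈ gen {A, B} := subset_gen (by simp)
  have gB : B ∈ gen {A, B} := subset_gen (by simp)
  have gAc : A ∈ gen {A, C} := subset_gen (by simp)
  have kA : A ∈ gen {A, B, C} := subset_gen (by simp)
  have kB : B ∈ gen {A, B, C} := subset_gen (by simp)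
  have kC : C ∈ gen {A, B, C} := subset_gen (by simp)
  have main : ∀ {P : ZMod p → Prop} {l : List Coef}, (∀ {t}, P t → P (-t)) →
      (∀ r ∈ l, r ∈ listT) → (∀ {t}, P t → ∃ r ∈ l, r.eval s f = φ t) →
      (∀ g ∈ gen {A, B, C}, g ≠ 1 → g ≠ -1 → P (g : Mat (ZMod p)).trace) →
      typeOK l a b c = true := by
    intro P l hneg hl hP h
    have h' : ∀ g ∈ gen {A, B, C}, g ≠ 1 ∧ g ≠ -1 →
      ∃ r ∈ l, r.eval s f = φ (g : Mat (ZMod p)).trace := fun g m n => hP (h g m n.1 n.2)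
    refine typeOK_of hs hf hbad hl ma mb mc ?_ ?_ ?_ (t := φ ((A : Mat (ZMod p)) * B * C).trace) ?_
      t0 hF ?_
    · rw [ha]
      exact h' (A * B) (mul_mem kA kB) (nc gAc nB)
    · rw [hb]
      exact h' (A * C) (mul_mem kA kC) (nc gA nC)
    · rw [hc]
      exact h' (B * C) (mul_mem kB kC) (nc gB nC)
    · exact h' (A * B * C) (mul_mem (mul_mem kA kB) kC) (nc (mul_mem gA gB) nC)
    · rw [ha, hb, hc, ← map_mul, ← map_add, ← hw]
      refine hP (hneg (h _ (mul_mem (mul_mem (mul_mem kA kB) (inv_mem kA)) kC) ?_ ?_))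
      exacts [(nc (mul_mem (mul_mem gA gB) (inv_mem gA)) nC).1,
        (nc (mul_mem (mul_mem gA gB) (inv_mem gA)) nC).2]
  rw [excOK, h0]
  rcases hE.trST with h | h
  · simp [main (P := TrS) TrS.neg listS_subset (fun h => exists_listS hs (h.map φ)) h]
  · simp [main (P := TrI) TrI.neg listI_subset (fun h => exists_listI hf (h.map φ)) h]

end Coef
end Involutions

section NoQuad
variable {p : ℕ} [Fact p.Prime] {A B C D : SL2 (ZMod p)}

lemma mem_gen_of_orthogonal (h2 : (2 : ZMod p) ≠ 0) (hA : (A : Mat (ZMod p)).trace = 0)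
    (hB : (B : Mat (ZMod p)).trace = 0) (hC : (C : Mat (ZMod p)).trace = 0)
    (h1 : ((A : Mat (ZMod p)) * B).trace = 0) (h3 : ((A : Mat (ZMod p)) * C).trace = 0)
    (h4 : ((B : Mat (ZMod p)) * C).trace = 0) : C ∈ gen {A, B} := by
  have e1 := anticomm_of_trace hA hC h3
  have e2 := anticomm_of_trace hB hC h4
  have mAB : A * B ∈ gen {A, B} := mul_mem (subset_gen (by simp)) (subset_gen (by simp))
  refine mem_of_eq_or_neg (eq_or_neg_of_commute_involution (A := A * B) h2 ?_ hC ?_) mAB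
  · simpa using h1
  · rw [Matrix.SpecialLinearGroup.coe_mul, mul_assoc, e2, mul_neg, ← mul_assoc, e1, neg_mul, neg_neg,
      mul_assoc]

lemma Quad.notMem_pairs (h : Quad A B C D) :
    A ∉ gen {B, C} ∧ B ∉ gen {A, C} ∧ C ∉ gen {A, B} :=
  ⟨h.swap₁₂.swap₂₃.notMem_pair, h.swap₂₃.notMem_pair, h.notMem_pair⟩

lemma Quad.traces (hp : 12 < p) (hbad : (Coef.badProd : ZMod p) ≠ 0) (h : Quad A B C D) :
    (A : Mat (ZMod p)).trace = 0 ∧ (B : Mat (ZMod p)).trace = 0 ∧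
    (C : Mat (ZMod p)).trace = 0 ∧ (D : Mat (ZMod p)).trace = 0 :=
  ⟨h.trace_eq_zero hp hbad, h.swap₁₂.trace_eq_zero hp hbad,
    h.swap₂₃.swap₁₂.trace_eq_zero hp hbad, h.swap₃₄.swap₂₃.swap₁₂.trace_eq_zero hp hbad⟩

lemma Quad.trace_zero_of_lType (hp : 12 < p) (hbad : (Coef.badProd : ZMod p) ≠ 0)
    (h : Quad A B C D) (h1 : LType (gen {A, B, C})) (h2 : LType (gen {A, B, D})) :
    ((A : Mat (ZMod p)) * B).trace = 0 := by
  obtain ⟨tA, tB, -, -⟩ := h.traces hp hbad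
  obtain ⟨v, v0, tv, hv⟩ := h1
  obtain ⟨w, w0, tw, hw⟩ := h2
  obtain ⟨n1, n2⟩ := (ne_of_notMem h.notMem_pairs.2.1).1
  refine trace_zero_of_two_lines (two_ne_zero_of_gt hp) tA tB tv tw v0 w0 ?_ ⟨n1, n2⟩
    (hv _ (subset_gen (by simp))) (hw _ (subset_gen (by simp))) (hv _ (subset_gen (by simp)))
    (hw _ (subset_gen (by simp)))
  rintro c rfl
  have c0 : c ≠ 0 := fun h => w0 (by rw [h, zero_smul])
  refine h.hL (lType_of_fixes v0 tv ?_)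
  rintro g (rfl | rfl | rfl | rfl)
  · exact hv _ (subset_gen (by simp))
  · exact hv _ (subset_gen (by simp))
  · exact hv _ (subset_gen (by simp))
  · exact fixes_of_smul c0 (hw _ (subset_gen (by simp)))

namespace Coef
variable {L : Type*} [Field L] {s f : L} {φ : ZMod p →+* L}

lemma mem_listP_or_neg {x : Coef} (h : x ∈ listT) : x ∈ listP ∨ x.neg ∈ listP := by
  have : ∀ x ∈ listT, contains listP x = true ∨ contains listP x.neg = true := by
    decide +kernel
  have key : ∀ {x : Coef}, contains listP x = true → x ∈ listP := by
    intro x h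
    obtain ⟨y, m, e⟩ := List.any_eq_true.1 h
    rwa [eq_of_beq e]
  exact (this x h).imp key key

lemma exists_listT (hs : s ^ 2 = 2) (hf : f ^ 2 = f + 1) {H : Subgroup (SL2 (ZMod p))}
    (hE : Exc H) (φ : ZMod p →+* L) {X Y : SL2 (ZMod p)} (hX : X ∈ H) (hY : Y ∈ H)
    (h : Y ∉ gen {X}) : ∃ r ∈ listT, r.eval s f = φ ((X : Mat (ZMod p)) * Y).trace := by
  have mX : X ∈ gen {X} := subset_gen (by simp)
  have n1 : X * Y ≠ 1 := fun e => h (mem_of_mul_central (Or.inl e) mX)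
  have n2 : X * Y ≠ -1 := fun e => h (mem_of_mul_central (Or.inr e) mX)
  rcases hE.trST with k | k
  · obtain ⟨r, hr, e⟩ := exists_listS hs ((k _ (mul_mem hX hY) n1 n2).map φ)
    exact ⟨r, listS_subset r hr, by simpa using e⟩
  · obtain ⟨r, hr, e⟩ := exists_listI hf ((k _ (mul_mem hX hY) n1 n2).map φ)
    exact ⟨r, listI_subset r hr, by simpa using e⟩

lemma false_of_listP (hs : s ^ 2 = 2) (hf : f ^ 2 = f + 1) (hp : 12 < p)
    (hbad : (badProd : ZMod p) ≠ 0) (h : Quad A B C D) (h1 : ¬ LType (gen {A, B, C}))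
    (h3 : ¬ LType (gen {A, B, D})) {a b c : Coef} (pa : a ∈ listP) (pb : b ∈ listP)
    (pc : c ∈ listP) (ma : a ∈ listT) (mb : b ∈ listT) (mc : c ∈ listT)
    (ha : a.eval s f = φ ((A : Mat (ZMod p)) * B).trace)
    (hb : b.eval s f = φ ((A : Mat (ZMod p)) * C).trace)
    (hc : c.eval s f = φ ((A : Mat (ZMod p)) * D).trace) : False := by
  have hL := cast_badProd_ne_zero φ hbad
  have h2 : (2 : ZMod p) ≠ 0 := two_ne_zero_of_gt hp
  obtain ⟨tA, tB, tC, tD⟩ := h.traces hp hbad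
  have E1 := (h.lType_or_exc hp).resolve_left h1
  have E2 := (h.swap₃₄.lType_or_exc hp).resolve_left h3
  have sub : ∀ {X Y Z : SL2 (ZMod p)}, Z ∉ gen {X, Y} → Z ∉ gen {Y} := fun k m =>
    k (gen_mono (by rintro g rfl; simp) m)
  obtain ⟨-, n2, n3⟩ := h.notMem_pairs
  obtain ⟨-, n5, n6⟩ := h.swap₃₄.notMem_pairs
  obtain ⟨n7, n8, n9⟩ := h.swap₂₃.swap₃₄.notMem_pairs
  obtain ⟨n10, n11, n12⟩ := h.swap₁₂.swap₂₃.swap₃₄.notMem_pairs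
  obtain ⟨d, md, hd⟩ := exists_listT hs hf E1 φ (X := B) (Y := C) (subset_gen (by simp))
    (subset_gen (by simp)) (sub n3)
  obtain ⟨e, me, he⟩ := exists_listT hs hf E2 φ (X := B) (Y := D) (subset_gen (by simp))
    (subset_gen (by simp)) (sub n6)
  have hCD : LType (gen {A, C, D}) → LType (gen {B, C, D}) →
      ((C : Mat (ZMod p)) * D).trace = 0 := fun k1 k2 =>
    h.swap₂₃.swap₃₄.swap₁₂.swap₂₃.trace_zero_of_lType hp hbad
      (by rwa [Set.pair_comm, Set.insert_comm]) (by rwa [Set.pair_comm, Set.insert_comm])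
  obtain ⟨g, mg, hg⟩ : ∃ r ∈ listT, r.eval s f = φ ((C : Mat (ZMod p)) * D).trace := by
    rcases h.swap₂₃.swap₃₄.lType_or_exc hp with k1 | k1
    · rcases h.swap₁₂.swap₂₃.swap₃₄.lType_or_exc hp with k2 | k2
      · exact ⟨z0, by simp [listT], by rw [hCD k1 k2]; simp [eval, z0]⟩
      · exact exists_listT hs hf k2 φ (subset_gen (by simp)) (subset_gen (by simp)) (sub n12)
    · exact exists_listT hs hf k1 φ (subset_gen (by simp)) (subset_gen (by simp)) (sub n9)
  have z : ∀ {x : Coef} {t : ZMod p}, x ∈ listT → x.eval s f = φ t → x.isZero = true → t = 0 := by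
    intro x t m h k
    have := (isZero_iff hs hf hL m).1 k
    rw [h] at this
    exact (map_eq_zero φ).1 this
  have x1 : excOK a b d = true := excOK_of hs hf hL h2 tA tB tC n2 n3 E1 h1 ma mb md ha hb hd
  have x2 : excOK a c e = true := excOK_of hs hf hL h2 tA tB tD n5 n6 E2 h3 ma mc me ha hc he
  have x3 : excOK b c g = false → LType (gen {A, C, D}) := fun k => by
    by_contra n
    rw [excOK_of hs hf hL h2 tA tC tD n8 n9
      ((h.swap₂₃.swap₃₄.lType_or_exc hp).resolve_left n) n mb mc mg hb hc hg] at k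
    cases k
  have x4 : excOK d e g = false → LType (gen {B, C, D}) := fun k => by
    by_contra n
    rw [excOK_of hs hf hL h2 tB tC tD n11 n12
      ((h.swap₁₂.swap₂₃.swap₃₄.lType_or_exc hp).resolve_left n) n md me mg hd he hg] at k
    cases k
  have key := gramOK_of_mem
  have key := List.all_eq_true.1 (List.all_eq_true.1 (List.all_eq_true.1 key a pa) b pb) d md
  rw [x1, Bool.not_true, Bool.false_or] at key
  have key := List.all_eq_true.1 (List.all_eq_true.1 key c pc) e me
  rw [x2, Bool.not_true, Bool.false_or] at key
  have key := List.all_eq_true.1 key g mg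
  have ha' : a.eval s f = φ ((B : Mat (ZMod p)) * A).trace := by rw [Matrix.trace_mul_comm, ha]
  have hb' : b.eval s f = φ ((C : Mat (ZMod p)) * A).trace := by rw [Matrix.trace_mul_comm, hb]
  have hc' : c.eval s f = φ ((D : Mat (ZMod p)) * A).trace := by rw [Matrix.trace_mul_comm, hc]
  have hd' : d.eval s f = φ ((C : Mat (ZMod p)) * B).trace := by rw [Matrix.trace_mul_comm, hd]
  have he' : e.eval s f = φ ((D : Mat (ZMod p)) * B).trace := by rw [Matrix.trace_mul_comm, he]
  have hg' : g.eval s f = φ ((D : Mat (ZMod p)) * C).trace := by rw [Matrix.trace_mul_comm, hg]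
  simp only [gramOK, Bool.or_eq_true, Bool.and_eq_true, Bool.not_eq_true'] at key
  have hgen : ∀ {X : SL2 (ZMod p)} {s : Set (SL2 (ZMod p))}, X ∈ s → X ∈ gen s := subset_gen
  rcases key with (((((((⟨k1, k2⟩ | ⟨k1, k2⟩) | ⟨⟨k1, k2⟩, k3⟩) | ⟨⟨k1, k2⟩, k3⟩) | k) | k) | k) | k)
    | k
  · rcases k2 with k2 | ⟨k2, k3⟩
    · rw [lineOK_of hs hf hL h2 tA tC tD n7 n8 (x3 k1) mb mc mg hb hc hg] at k2
      cases k2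
    · rw [(isZero_iff hs hf hL mg).2 (by rw [hg, hCD (x3 k1) (x4 k2), map_zero])] at k3
      cases k3
  · rw [lineOK_of hs hf hL h2 tB tC tD n10 n11 (x4 k1) md me mg hd he hg] at k2
    cases k2
  · exact n9 (mem_gen_of_orthogonal h2 tA tC tD (z mb hb k1) (z mc hc k2) (z mg hg k3))
  · exact n12 (mem_gen_of_orthogonal h2 tB tC tD (z md hd k1) (z me he k2) (z mg hg k3))
  · refine eval_ne_zero hs hf hL k ?_
    have := congrArg φ (det_gram_eq_zero tA tB tC tD rfl rfl rfl rfl rfl rfl)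
    rw [eval_gram hs hf, ha, hb, hc, hd, he, hg, ← map_zero φ, ← this]
    simp [map_ofNat φ 4, map_ofNat φ 2, map_ofNat φ 16]
  · exact h.hd (mem_of_expressible hs hf hL h2 (neg_one_mem_gen _) (hgen (by simp))
      (hgen (by simp)) (hgen (by simp)) tA tB tC tD ha hb hd hc he hg k)
  · exact h.hc (mem_of_expressible hs hf hL h2 (neg_one_mem_gen _) (hgen (by simp))
      (hgen (by simp)) (hgen (by simp)) tA tB tD tC ha hc he hb hd hg' k)
  · exact h.hb (mem_of_expressible hs hf hL h2 (neg_one_mem_gen _) (hgen (by simp))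
      (hgen (by simp)) (hgen (by simp)) tA tC tD tB hb hc hg ha hd' he' k)
  · exact h.ha (mem_of_expressible hs hf hL h2 (neg_one_mem_gen _) (hgen (by simp))
      (hgen (by simp)) (hgen (by simp)) tB tC tD tA hd he hg ha' hb' hc' k)

end Coef

lemma LType.of_eq {s t : Set (SL2 (ZMod p))} (h : LType (gen s)) (e : ∀ g ∈ t, g ∈ gen s) :
    LType (gen t) := lType_mono (gen_le (neg_one_mem_gen _) e) h

lemma Quad.lType_or_lType (hp : 12 < p) (hbad : (Coef.badProd : ZMod p) ≠ 0)
    (h : Quad A B C D) : LType (gen {A, B, C}) ∨ LType (gen {A, B, D}) := by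
  by_contra k
  obtain ⟨k1, k2⟩ := not_or.1 k
  let L := AlgebraicClosure (ZMod p)
  obtain ⟨s, f, hs, hf⟩ := exists_sqrt_two_golden L (by
    rw [← map_ofNat (algebraMap (ZMod p) L) 2]
    exact (map_ne_zero _).2 (two_ne_zero_of_gt hp))
  have sub : ∀ {X Y Z : SL2 (ZMod p)}, Z ∉ gen {X, Y} → Z ∉ gen {X} := fun k m =>
    k (gen_mono (by rintro g rfl; simp) m)
  have E1 := (h.lType_or_exc hp).resolve_left k1
  have E2 := (h.swap₃₄.lType_or_exc hp).resolve_left k2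
  have sign : ∀ {X Y : SL2 (ZMod p)} {r : Coef}, r ∈ Coef.listT →
      r.eval s f = algebraMap (ZMod p) L ((X : Mat (ZMod p)) * Y).trace →
      ∃ Z, (Z = Y ∨ Z = -Y) ∧ ∃ r ∈ Coef.listP,
        r.eval s f = algebraMap (ZMod p) L ((X : Mat (ZMod p)) * Z).trace := by
    intro X Y r hr e
    rcases Coef.mem_listP_or_neg hr with k | k
    · exact ⟨Y, Or.inl rfl, r, k, e⟩
    · exact ⟨-Y, Or.inr rfl, r.neg, k, by rw [Coef.eval_neg, e]; simp⟩
  have listP_sub : ∀ r ∈ Coef.listP, r ∈ Coef.listT := by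
    intro r hr
    simp only [Coef.listP, List.mem_cons, List.not_mem_nil, or_false] at hr
    rcases hr with rfl | rfl | rfl | rfl | rfl <;> simp [Coef.listT, Coef.z1]
  obtain ⟨r1, m1, e1⟩ := Coef.exists_listT hs hf E1 (algebraMap (ZMod p) L) (X := A) (Y := B)
    (subset_gen (by simp)) (subset_gen (by simp)) (sub h.notMem_pairs.2.1)
  obtain ⟨r2, m2, e2⟩ := Coef.exists_listT hs hf E1 (algebraMap (ZMod p) L) (X := A) (Y := C)
    (subset_gen (by simp)) (subset_gen (by simp)) (sub h.notMem_pairs.2.2)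
  obtain ⟨r3, m3, e3⟩ := Coef.exists_listT hs hf E2 (algebraMap (ZMod p) L) (X := A) (Y := D)
    (subset_gen (by simp)) (subset_gen (by simp)) (sub h.swap₃₄.notMem_pairs.2.2)
  obtain ⟨B', hB, a, pa, ha⟩ := sign m1 e1
  obtain ⟨C', hC, b, pb, hb⟩ := sign m2 e2
  obtain ⟨D', hD, c, pc, hc⟩ := sign m3 e3
  have q1 : Quad A B' C D := by
    rcases hB with rfl | rfl
    exacts [h, h.swap₁₂.of_neg.swap₁₂]
  have q2 : Quad A B' C' D := by
    rcases hC with rfl | rfl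
    exacts [q1, q1.swap₂₃.swap₁₂.of_neg.swap₁₂.swap₂₃]
  have q3 : Quad A B' C' D' := by
    rcases hD with rfl | rfl
    exacts [q2, q2.swap₃₄.swap₂₃.swap₁₂.of_neg.swap₁₂.swap₂₃.swap₃₄]
  have back : ∀ {Y Z : SL2 (ZMod p)} {s : Set (SL2 (ZMod p))}, (Z = Y ∨ Z = -Y) → Z ∈ s →
      Y ∈ gen s := by
    rintro Y Z s (rfl | rfl) m
    exacts [subset_gen m, neg_mem_gen_iff.1 (subset_gen m)]
  refine Coef.false_of_listP hs hf hp hbad q3 (fun k => k1 (k.of_eq ?_)) (fun k => k2 (k.of_eq ?_))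
    pa pb pc (listP_sub a pa) (listP_sub b pb) (listP_sub c pc) ha hb hc
  · rintro g (rfl | rfl | rfl)
    exacts [subset_gen (by simp), back hB (by simp), back hC (by simp)]
  · rintro g (rfl | rfl | rfl)
    exacts [subset_gen (by simp), back hB (by simp), back hD (by simp)]

lemma Quad.lType (hp : 12 < p) (hbad : (Coef.badProd : ZMod p) ≠ 0) (h : Quad A B C D) :
    LType (gen {A, B, C}) := by
  by_contra k
  refine h.not_three hp ⟨?_, ?_, ?_⟩
  · refine (h.swap₁₂.swap₂₃.lType_or_lType hp hbad).resolve_left fun e => k ?_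
    rwa [Set.insert_comm, Set.pair_comm]
  · refine (h.swap₂₃.lType_or_lType hp hbad).resolve_left fun e => k ?_
    rwa [Set.pair_comm]
  · exact (h.lType_or_lType hp hbad).resolve_left k

theorem Quad.false (hp : 12 < p) (hbad : (Coef.badProd : ZMod p) ≠ 0) (h : Quad A B C D) :
    False :=
  h.not_three hp ⟨h.swap₁₂.swap₂₃.swap₃₄.lType hp hbad, h.swap₂₃.swap₃₄.lType hp hbad,
    h.swap₃₄.lType hp hbad⟩

end NoQuad

section Length
variable {p : ℕ} [Fact p.Prime]

lemma lType_of_forall_erase (h2 : (2 : ZMod p) ≠ 0) {ι : Type*} [DecidableEq ι]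
    {g : ι → SL2 (ZMod p)} {S : Finset ι} (hS : 4 < S.card)
    (h1 : ∀ i ∈ S, g i ≠ 1 ∧ g i ≠ -1) (h : ∀ i ∈ S, LType (gen (g '' (S.erase i : Finset ι)))) :
    LType (gen (g '' S)) := by
  by_contra hL
  have line : ∀ i ∈ S, ∃ v : Mat (ZMod p), v ≠ 0 ∧ v.trace = 0 ∧
      (∀ j ∈ S, j ≠ i → Fixes (g j) v) ∧ ¬ Fixes (g i) v := by
    intro i hi
    obtain ⟨v, v0, tv, hv⟩ := h i hi
    have hj : ∀ j ∈ S, j ≠ i → Fixes (g j) v := fun j hj hji =>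
      hv _ (subset_gen ⟨j, by simp [hj, hji], rfl⟩)
    refine ⟨v, v0, tv, hj, fun hf => hL (lType_of_fixes v0 tv ?_)⟩
    rintro _ ⟨j, hjS, rfl⟩
    by_cases e : j = i
    · rwa [e]
    · exact hj j hjS e
  obtain ⟨T, hTS, hT⟩ := Finset.exists_subset_card_eq (s := S) (n := 4) (by omega)
  obtain ⟨i, j, k, l, hij, hik, hil, hjk, hjl, hkl, rfl⟩ := Finset.card_eq_four.1 hT
  have mi : i ∈ S := hTS (by simp)
  have mj : j ∈ S := hTS (by simp)
  have mk : k ∈ S := hTS (by simp)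
  have ml : l ∈ S := hTS (by simp)
  obtain ⟨v, v0, tv, hv, nv⟩ := line i mi
  obtain ⟨w, w0, tw, hw, nw⟩ := line j mj
  obtain ⟨u, u0, tu, hu, nu⟩ := line k mk
  obtain ⟨z, z0, tz, fi, fj, fk, hz⟩ := exists_common_line h2
    (fun h0 => by rcases axis_eq_zero h2 h0 with e | e
                  exacts [(h1 l ml).1 e, (h1 l ml).2 e])
    tv tw tu v0 w0 u0 (hw i mi hij) (hu i mi hik) (hv j mj hij.symm) (hu j mj hjk)
    (hv k mk hik.symm) (hw k mk hjk.symm) (hv l ml hil.symm) (hw l ml hjl.symm) (hu l ml hkl.symm)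
    nv nw nu
  refine hL (lType_of_fixes z0 tz ?_)
  rintro _ ⟨m, hm, rfl⟩
  by_cases e1 : m = i
  · rwa [e1]
  by_cases e2 : m = j
  · rwa [e2]
  by_cases e3 : m = k
  · rwa [e3]
  exact hz _ (hv m hm e1) (hw m hm e2) (hu m hm e3)

theorem card_le_three (hp : 12 < p) (hB : (Coef.badProd : ZMod p) ≠ 0) {ι : Type*} [Fintype ι]
    (g : ι → SL2 (ZMod p)) (hg : gen (Set.range g) = ⊤) (hi : ∀ i, gen (g '' {j | j ≠ i}) ≠ ⊤) :
    Fintype.card ι ≤ 3 := by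
  classical
  by_contra hn
  have h2 : (2 : ZMod p) ≠ 0 := two_ne_zero_of_gt hp
  have nm : ∀ i, g i ∉ gen (g '' {j | j ≠ i}) := by
    intro i h
    refine hi i (top_unique (hg ▸ gen_le (neg_one_mem_gen _) ?_))
    rintro _ ⟨j, rfl⟩
    by_cases e : j = i
    · rwa [e]
    · exact subset_gen ⟨j, e, rfl⟩
  have hex : ∃ n, ∃ S : Finset ι, S.card = n ∧ 4 ≤ n ∧ ¬ LType (gen (g '' (S : Set ι))) := by
    refine ⟨_, Finset.univ, rfl, by rw [Finset.card_univ]; omega, ?_⟩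
    rw [Finset.coe_univ, Set.image_univ, hg]
    exact not_lType_top h2
  obtain ⟨S, hS, h4, hL⟩ := Nat.find_spec hex
  have hmin := fun m hm => Nat.find_min (m := m) hex hm
  generalize Nat.find hex = n at *
  rcases h4.lt_or_eq with h5 | rfl
  · refine hL (lType_of_forall_erase h2 (by omega) (fun i _ => ne_one_of_notMem_gen (nm i)) ?_)
    intro i hiS
    by_contra k
    exact hmin (n - 1) (by omega)
      ⟨S.erase i, by rw [Finset.card_erase_of_mem hiS, hS], by omega, k⟩
  · obtain ⟨i, j, k, l, hij, hik, hil, hjk, hjl, hkl, rfl⟩ := Finset.card_eq_four.1 hS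
    have sub : ∀ (a : ι) (s : Set (SL2 (ZMod p))), s ⊆ g '' {j | j ≠ a} → g a ∉ gen s :=
      fun a s hs h => nm a (gen_mono hs h)
    refine Quad.false (A := g i) (B := g j) (C := g k) (D := g l) hp hB ⟨sub i _ ?_, sub j _ ?_,
      sub k _ ?_, sub l _ ?_, ?_⟩
    · rintro _ (rfl | rfl | rfl)
      exacts [⟨j, hij.symm, rfl⟩, ⟨k, hik.symm, rfl⟩, ⟨l, hil.symm, rfl⟩]
    · rintro _ (rfl | rfl | rfl)
      exacts [⟨i, hij, rfl⟩, ⟨k, hjk.symm, rfl⟩, ⟨l, hjl.symm, rfl⟩]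
    · rintro _ (rfl | rfl | rfl)
      exacts [⟨i, hik, rfl⟩, ⟨j, hjk, rfl⟩, ⟨l, hkl.symm, rfl⟩]
    · rintro _ (rfl | rfl | rfl)
      exacts [⟨i, hil, rfl⟩, ⟨j, hjl, rfl⟩, ⟨k, hkl, rfl⟩]
    · convert hL using 3
      simp [Set.image_insert_eq]

end Length

section Projective
variable {p : ℕ} [Fact p.Prime]

/-- The projection onto `PSL(2,p)`. -/
def proj : SL2 (ZMod p) →* PSL p := QuotientGroup.mk' _

lemma proj_surjective : Function.Surjective (proj (p := p)) := QuotientGroup.mk'_surjective _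

lemma proj_eq_one_iff {g : SL2 (ZMod p)} : proj g = 1 ↔ g = 1 ∨ g = -1 := by
  have : proj g = 1 ↔ g ∈ Subgroup.center (SL2 (ZMod p)) := QuotientGroup.eq_one_iff g
  rw [this, Matrix.SpecialLinearGroup.mem_center_iff]
  constructor
  · rintro ⟨r, -, hr⟩
    refine eq_one_or_neg_one_of_scalar (c := r) ?_
    rw [← hr, Matrix.scalar_apply, Matrix.smul_one_eq_diagonal]
  · rintro (rfl | rfl)
    · exact ⟨1, by simp, by simp⟩
    · refine ⟨-1, by simp, ?_⟩
      rw [map_neg, map_one, Matrix.SpecialLinearGroup.coe_neg, Matrix.SpecialLinearGroup.coe_one]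

lemma closure_image_proj {s : Set (SL2 (ZMod p))} :
    Subgroup.closure (proj '' s) = ⊤ ↔ gen s = ⊤ := by
  rw [← MonoidHom.map_closure]
  constructor
  · intro h
    rw [eq_top_iff]
    intro g _
    obtain ⟨k, hk, e⟩ : proj g ∈ (Subgroup.closure s).map proj := h ▸ Subgroup.mem_top _
    have : proj (k⁻¹ * g) = 1 := by rw [map_mul, map_inv, e, inv_mul_cancel]
    have hk' : k ∈ gen s := Subgroup.closure_mono (Set.subset_insert _ _) hk
    rw [← mul_inv_cancel_left k g]
    refine mul_mem hk' ?_
    rcases proj_eq_one_iff.1 this with e | e <;> rw [e]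
    exacts [one_mem _, neg_one_mem_gen s]
  · intro h
    have : gen s ≤ ((Subgroup.closure s).map proj).comap proj := by
      refine gen_le ?_ fun g hg => ⟨g, Subgroup.subset_closure hg, rfl⟩
      rw [Subgroup.mem_comap, proj_eq_one_iff.2 (Or.inr rfl)]
      exact one_mem _
    rw [h, top_le_iff] at this
    rw [eq_top_iff]
    intro x _
    obtain ⟨g, rfl⟩ := proj_surjective x
    exact this.ge (Subgroup.mem_top g)

lemma isGenSeq_proj_iff {n : ℕ} {g : Fin n → SL2 (ZMod p)} :
    IsGenSeq (proj ∘ g) ↔ gen (Set.range g) = ⊤ := by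
  rw [IsGenSeq, Set.range_comp, closure_image_proj]

lemma isIrred_proj_iff {n : ℕ} {g : Fin n → SL2 (ZMod p)} :
    IsIrred (proj ∘ g) ↔ ∀ i, gen (g '' {j | j ≠ i}) ≠ ⊤ := by
  refine forall_congr' fun i => not_congr ?_
  rw [Set.image_comp, closure_image_proj]

theorem length_le_three (hp : 12 < p) (hB : (Coef.badProd : ZMod p) ≠ 0) {n : ℕ}
    {g : Fin n → PSL p} (h1 : IsGenSeq g) (h2 : IsIrred g) : n ≤ 3 := by
  obtain ⟨g, rfl⟩ := proj_surjective.comp_left g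
  simpa using card_le_three hp hB g (isGenSeq_proj_iff.1 h1) (isIrred_proj_iff.1 h2)

theorem not_replacementProperty_of_triple (hp : 12 < p) (hB : (Coef.badProd : ZMod p) ≠ 0)
    {x a b c : SL2 (ZMod p)} (hx : x ≠ 1 ∧ x ≠ -1) (h : gen {a, b, c} = ⊤)
    (hab : gen {x, a, b} ≠ ⊤) (hac : gen {x, a, c} ≠ ⊤) (hbc : gen {x, b, c} ≠ ⊤) :
    ¬ ReplacementProperty (PSL p) := by
  have sub : ∀ {s t : Set (SL2 (ZMod p))}, s ⊆ t → gen t ≠ ⊤ → gen s ≠ ⊤ := fun hst ht hs =>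
    ht (top_unique (hs ▸ gen_mono hst))
  have g1 : IsGenSeq (proj ∘ ![a, b, c]) := isGenSeq_proj_iff.2 (by
    rw [← h]; congr 1; ext g; simp [eq_comm]; tauto)
  have g2 : IsIrred (proj ∘ ![a, b, c]) := by
    rw [isIrred_proj_iff, Fin.forall_fin_succ, Fin.forall_fin_two]
    refine ⟨sub ?_ hbc, sub ?_ hac, sub ?_ hab⟩ <;> rintro _ ⟨j, hj, rfl⟩ <;> fin_cases j <;>
      simp at hj ⊢
  have hm : maxIrredLen (PSL p) = 3 := by
    refine le_antisymm (csSup_le ⟨3, _, g1, g2⟩ ?_) (le_csSup ⟨3, ?_⟩ ⟨_, g1, g2⟩) <;>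
    · rintro n ⟨g, h1, h2⟩
      exact length_le_three hp hB h1 h2
  intro hR
  have key : ∀ n, maxIrredLen (PSL p) = n → ∀ g : Fin n → PSL p, IsGenSeq g → IsIrred g →
      ∀ x : PSL p, x ≠ 1 → ∃ i, IsGenSeq (Function.update g i x) := by
    rintro n rfl
    exact hR
  obtain ⟨i, hi⟩ := key 3 hm _ g1 g2 (proj x) fun h => by
    rcases proj_eq_one_iff.1 h with e | e
    exacts [hx.1 e, hx.2 e]
  rw [show Function.update (proj ∘ ![a, b, c]) i (proj x) =
    proj ∘ Function.update ![a, b, c] i x from (Function.comp_update _ _ _ _).symm,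
    isGenSeq_proj_iff] at hi
  revert hi
  fin_cases i
  · refine sub ?_ hbc
    rintro _ ⟨j, rfl⟩
    fin_cases j <;> simp [Function.update]
  · refine sub ?_ hac
    rintro _ ⟨j, rfl⟩
    fin_cases j <;> simp [Function.update]
  · refine sub ?_ hab
    rintro _ ⟨j, rfl⟩
    fin_cases j <;> simp [Function.update]

end Projective
section Explicit
variable {p : ℕ} [Fact p.Prime]

/-- `g` permutes the matrices `F i` up to sign, by conjugation. -/
def Permutes {n : ℕ} (F : Fin n → Mat (ZMod p)) (g : SL2 (ZMod p)) : Prop :=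
  ∀ i, ∃ j, (g : Mat (ZMod p)) * F i * ((g⁻¹ : SL2 (ZMod p)) : Mat (ZMod p)) = F j ∨
    (g : Mat (ZMod p)) * F i * ((g⁻¹ : SL2 (ZMod p)) : Mat (ZMod p)) = -F j

lemma Permutes.mul {n : ℕ} {F : Fin n → Mat (ZMod p)} {g h : SL2 (ZMod p)} (hg : Permutes F g)
    (hh : Permutes F h) : Permutes F (g * h) := by
  intro i
  obtain ⟨j, hj⟩ := hh i
  obtain ⟨k, hk⟩ := hg j
  refine ⟨k, ?_⟩
  rw [_root_.mul_inv_rev, Matrix.SpecialLinearGroup.coe_mul, Matrix.SpecialLinearGroup.coe_mul,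
    show (g : Mat (ZMod p)) * h * F i * (((h⁻¹ : SL2 (ZMod p)) : Mat (ZMod p)) *
      ((g⁻¹ : SL2 (ZMod p)) : Mat (ZMod p))) = g * (h * F i * ((h⁻¹ : SL2 (ZMod p)) :
      Mat (ZMod p))) * ((g⁻¹ : SL2 (ZMod p)) : Mat (ZMod p)) by simp only [mul_assoc]]
  rcases hj with hj | hj <;> rw [hj]
  · exact hk
  · rw [mul_neg, neg_mul, neg_inj, neg_eq_iff_eq_neg]
    exact hk.symm

lemma Permutes.neg {n : ℕ} {F : Fin n → Mat (ZMod p)} {g : SL2 (ZMod p)} (hg : Permutes F g) :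
    Permutes F (-g) := by
  intro i
  rw [inv_neg, Matrix.SpecialLinearGroup.coe_neg, Matrix.SpecialLinearGroup.coe_neg, neg_mul,
    neg_mul_neg]
  exact hg i

lemma permutes_one {n : ℕ} (F : Fin n → Mat (ZMod p)) : Permutes F 1 := fun i =>
  ⟨i, by simp⟩

/-- The elements permuting a finite system of matrices up to sign. -/
def permSubgroup {n : ℕ} (F : Fin n → Mat (ZMod p)) : Subgroup (SL2 (ZMod p)) where
  carrier := {g | Permutes F g ∧ Permutes F g⁻¹}
  mul_mem' := fun hg hh => ⟨hg.1.mul hh.1, by rw [_root_.mul_inv_rev]; exact hh.2.mul hg.2⟩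
  one_mem' := ⟨permutes_one F, by rw [inv_one]; exact permutes_one F⟩
  inv_mem' := fun hg => ⟨hg.2, by rw [inv_inv]; exact hg.1⟩

lemma permSubgroup_ne_top {n : ℕ} (h2 : (2 : ZMod p) ≠ 0) (hn : 2 * n < p)
    {F : Fin n → Mat (ZMod p)} (hF : ∀ i, (F i).trace = 0) (i : Fin n) (hi : F i ≠ 0) :
    permSubgroup F ≠ ⊤ := by
  intro htop
  have hP : ∀ g, Permutes F g := fun g =>
    (show g ∈ permSubgroup F from htop ▸ Subgroup.mem_top g).1
  have pig : ∀ u : ZMod p → SL2 (ZMod p), ∃ k l, k ≠ l ∧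
      (u k : Mat (ZMod p)) * F i * (((u k)⁻¹ : SL2 (ZMod p)) : Mat (ZMod p)) =
      (u l : Mat (ZMod p)) * F i * (((u l)⁻¹ : SL2 (ZMod p)) : Mat (ZMod p)) := by
    intro u
    have hu : ∀ k, ∃ q : Fin n × Bool,
        (u k : Mat (ZMod p)) * F i * (((u k)⁻¹ : SL2 (ZMod p)) : Mat (ZMod p)) =
        bif q.2 then F q.1 else -F q.1 := by
      intro k
      obtain ⟨j, hj | hj⟩ := hP (u k) i
      · exact ⟨(j, true), hj⟩
      · exact ⟨(j, false), hj⟩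
    choose q hq using hu
    obtain ⟨k, l, hkl, e⟩ := Fintype.exists_ne_map_eq_of_card_lt q (by
      simp only [Fintype.card_prod, Fintype.card_fin, Fintype.card_bool, ZMod.card]
      omega)
    exact ⟨k, l, hkl, by rw [hq, hq, e]⟩
  have tr := traceless_iff.1 (hF i)
  obtain ⟨k, l, hkl, e⟩ := pig upper
  obtain ⟨k', l', hkl', e'⟩ := pig lower
  simp only [inv_mat] at e e'
  simp only [mat_ext_iff, mat_mul_entry, upper, lower, Matrix.trace_fin_two, Matrix.sub_apply,
    Matrix.smul_apply, smul_eq_mul, Matrix.one_apply, Matrix.of_apply, Matrix.cons_val', Matrix.cons_val_zero,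
    Matrix.cons_val_one, Matrix.cons_val_fin_one, Fin.isValue, tr] at e e'
  norm_num at e e'
  have d := sub_ne_zero.2 hkl
  have d' := sub_ne_zero.2 hkl'
  have z10 : F i 1 0 = 0 := by
    apply (mul_eq_zero.1 (_ : (k - l) * F i 1 0 = 0)).resolve_left d
    grind
  have z01 : F i 0 1 = 0 := by
    apply (mul_eq_zero.1 (_ : (k' - l') * F i 0 1 = 0)).resolve_left d'
    grind
  have z00 : F i 0 0 = 0 := by
    apply (mul_eq_zero.1 (_ : (2 * (k - l)) * F i 0 0 = 0)).resolve_left (mul_ne_zero h2 d)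
    grind
  exact hi (mat_ext_iff.2 ⟨z00, z01, z10, by rw [tr, z00, neg_zero]; rfl⟩)

/-- Elements of order four permuting a finite system of matrices do not generate. -/
lemma gen_ne_top_of_permutes {n : ℕ} (h2 : (2 : ZMod p) ≠ 0) (hn : 2 * n < p)
    {F : Fin n → Mat (ZMod p)} (hF : ∀ i, (F i).trace = 0) (i : Fin n) (hi : F i ≠ 0)
    {S : Set (SL2 (ZMod p))}
    (hS : ∀ g ∈ S, (g : Mat (ZMod p)).trace = 0 ∧ Permutes F g) : gen S ≠ ⊤ := by
  intro h
  refine permSubgroup_ne_top h2 hn hF i hi (top_unique (h ▸ gen_le ?_ ?_))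
  · exact ⟨(permutes_one F).neg, by rw [inv_neg, inv_one]; exact (permutes_one F).neg⟩
  · intro g hg
    exact ⟨(hS g hg).2, by rw [inv_of_trace_zero (hS g hg).1]; exact (hS g hg).2.neg⟩

end Explicit

section Quaternions
variable {K : Type*} [Field K]

/-- The pure quaternion `u 0 * i + u 1 * j + u 2 * k` as a matrix, where `α ^ 2 + β ^ 2 = -1`. -/
def pureQ (α β : K) (u : Fin 3 → K) : Mat K :=
  !![u 0 * α + u 2 * β, u 0 * β - u 1 - u 2 * α; u 0 * β + u 1 - u 2 * α, -(u 0 * α + u 2 * β)]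

variable {α β : K}

lemma trace_pureQ (u : Fin 3 → K) : (pureQ α β u).trace = 0 := by
  simp [pureQ, Matrix.trace_fin_two]

lemma pureQ_entries (u : Fin 3 → K) : pureQ α β u 0 0 = u 0 * α + u 2 * β ∧
    pureQ α β u 0 1 = u 0 * β - u 1 - u 2 * α ∧ pureQ α β u 1 0 = u 0 * β + u 1 - u 2 * α ∧
    pureQ α β u 1 1 = -(u 0 * α + u 2 * β) := ⟨rfl, rfl, rfl, rfl⟩

lemma pureQ_neg (u : Fin 3 → K) : pureQ α β (-u) = -pureQ α β u := by
  rw [mat_ext_iff]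
  simp only [pureQ_entries, Matrix.neg_apply, Pi.neg_apply]
  refine ⟨?_, ?_, ?_, ?_⟩ <;> ring

lemma trace_pureQ_mul (h : α ^ 2 + β ^ 2 = -1) (u v : Fin 3 → K) :
    (pureQ α β u * pureQ α β v).trace = -(2 * (u ⬝ᵥ v)) := by
  simp only [Matrix.trace_fin_two, mat_mul_entry, pureQ_entries, Matrix.vec3_dotProduct]
  linear_combination 2 * (u 0 * v 0 + u 2 * v 2) * h

lemma pureQ_anticomm (h : α ^ 2 + β ^ 2 = -1) (u v : Fin 3 → K) :
    pureQ α β u * pureQ α β v = -(2 * (u ⬝ᵥ v)) • (1 : Mat K) - pureQ α β v * pureQ α β u := by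
  rw [mat_ext_iff]
  simp only [mat_mul_entry, pureQ_entries, Matrix.vec3_dotProduct, Matrix.sub_apply,
    Matrix.smul_apply, smul_eq_mul, Matrix.one_apply, Fin.isValue]
  norm_num
  refine ⟨?_, ?_, ?_, ?_⟩
  · linear_combination 2 * (u 0 * v 0 + u 2 * v 2) * h
  · ring
  · ring
  · linear_combination 2 * (u 0 * v 0 + u 2 * v 2) * h

lemma exists_halfTurn (h2 : (2 : K) ≠ 0) (h : α ^ 2 + β ^ 2 = -1) {g : Fin 3 → K}
    (hg : g ⬝ᵥ g = 4) : ∃ A : SL2 K, (A : Mat K) = (2 : K)⁻¹ • pureQ α β g := by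
  refine ⟨⟨(2 : K)⁻¹ • pureQ α β g, ?_⟩, rfl⟩
  rw [Matrix.vec3_dotProduct] at hg
  simp only [Matrix.det_fin_two, Matrix.smul_apply, smul_eq_mul, pureQ_entries]
  field_simp
  linear_combination hg - (g 0 ^ 2 + g 2 ^ 2) * h

section HalfTurn
variable {A B : SL2 K} {g g' : Fin 3 → K}

lemma trace_halfTurn (hA : (A : Mat K) = (2 : K)⁻¹ • pureQ α β g) : (A : Mat K).trace = 0 := by
  rw [hA, Matrix.trace_smul, trace_pureQ, smul_zero]

lemma trace_halfTurn_mul (h2 : (2 : K) ≠ 0) (h : α ^ 2 + β ^ 2 = -1)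
    (hA : (A : Mat K) = (2 : K)⁻¹ • pureQ α β g) (hB : (B : Mat K) = (2 : K)⁻¹ • pureQ α β g') :
    ((A : Mat K) * B).trace = -(g ⬝ᵥ g') / 2 := by
  rw [hA, hB, Matrix.smul_mul, Matrix.mul_smul, Matrix.trace_smul, Matrix.trace_smul,
    trace_pureQ_mul h, smul_eq_mul, smul_eq_mul]
  field_simp

lemma conj_halfTurn (h2 : (2 : K) ≠ 0) (h : α ^ 2 + β ^ 2 = -1)
    (hA : (A : Mat K) = (2 : K)⁻¹ • pureQ α β g) {v w : Fin 3 → K}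
    (e : (g ⬝ᵥ v) • g = (2 : K) • (v + w)) :
    (A : Mat K) * pureQ α β v * ((A⁻¹ : SL2 K) : Mat K) = pureQ α β w := by
  rw [conj_of_trace_zero (trace_halfTurn hA) (trace_pureQ v), hA, Matrix.smul_mul,
    Matrix.trace_smul, trace_pureQ_mul h]
  have e' : ∀ c, (g ⬝ᵥ v) * g c = 2 * (v c + w c) := fun c => congrFun e c
  have e0 := e' 0
  have e1 := e' 1
  have e2 := e' 2
  rw [mat_ext_iff]
  simp only [Matrix.sub_apply, Matrix.neg_apply, Matrix.smul_apply, smul_eq_mul, pureQ_entries]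
  field_simp
  refine ⟨?_, ?_, ?_, ?_⟩
  · linear_combination α * e0 + β * e2
  · linear_combination β * e0 - e1 - α * e2
  · linear_combination β * e0 + e1 - α * e2
  · linear_combination -α * e0 - β * e2

lemma halfTurn_mul_pureQ (h : α ^ 2 + β ^ 2 = -1) (hA : (A : Mat K) = (2 : K)⁻¹ • pureQ α β g)
    {u : Fin 3 → K} (hu : g ⬝ᵥ u = 0) :
    (A : Mat K) * pureQ α β u = -(pureQ α β u * A) := by
  rw [hA, Matrix.smul_mul, pureQ_anticomm h, hu, Matrix.mul_smul]
  simp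

lemma halfTurn_mul_pureQ_of_image (h2 : (2 : K) ≠ 0) (h : α ^ 2 + β ^ 2 = -1)
    (hA : (A : Mat K) = (2 : K)⁻¹ • pureQ α β g) (hB : (B : Mat K) = (2 : K)⁻¹ • pureQ α β g')
    {u : Fin 3 → K} (hu : (2 * (u ⬝ᵥ g)) • u = (u ⬝ᵥ u) • (g + g')) (hu0 : u ⬝ᵥ u ≠ 0) :
    (B : Mat K) * pureQ α β u = pureQ α β u * A := by
  have e' : ∀ c, (2 * (u ⬝ᵥ g)) * u c = (u ⬝ᵥ u) * (g c + g' c) := fun c => congrFun hu c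
  have eg : g' = (2 * (u ⬝ᵥ g) / (u ⬝ᵥ u)) • u - g := by
    funext c
    simp only [Pi.sub_apply, Pi.smul_apply, smul_eq_mul]
    field_simp
    linear_combination -(e' c)
  have hq : pureQ α β g' = (2 * (u ⬝ᵥ g) / (u ⬝ᵥ u)) • pureQ α β u - pureQ α β g := by
    rw [eg, mat_ext_iff]
    simp only [Matrix.sub_apply, Matrix.smul_apply, pureQ_entries, Pi.sub_apply, Pi.smul_apply,
      smul_eq_mul]
    refine ⟨?_, ?_, ?_, ?_⟩ <;> ring
  have hU : pureQ α β u * pureQ α β u = -(u ⬝ᵥ u) • (1 : Mat K) := by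
    apply smul_right_injective _ h2
    have := pureQ_anticomm h u u
    rw [eq_sub_iff_add_eq, ← two_smul K] at this
    simp only [this, smul_smul]
    congr 1
    ring
  rw [hA, hB, Matrix.smul_mul, Matrix.mul_smul, hq, sub_mul, Matrix.smul_mul, hU,
    pureQ_anticomm h u g]
  congr 2
  rw [smul_smul]
  congr 1
  field_simp

end HalfTurn
end Quaternions

section Explicit
variable {p : ℕ} [Fact p.Prime] {α β : ZMod p}

/-- The half-turn about `g` maps the vectors `v i` to each other, up to sign. -/
def Turns {n : ℕ} (v : Fin n → Fin 3 → ZMod p) (g : Fin 3 → ZMod p) : Prop :=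
  ∀ i, ∃ j, (g ⬝ᵥ v i) • g = (2 : ZMod p) • (v i + v j) ∨
    (g ⬝ᵥ v i) • g = (2 : ZMod p) • (v i + -v j)

lemma Turns.permutes {n : ℕ} (h2 : (2 : ZMod p) ≠ 0) (h : α ^ 2 + β ^ 2 = -1)
    {v : Fin n → Fin 3 → ZMod p} {g : Fin 3 → ZMod p} (hg : Turns v g) {A : SL2 (ZMod p)}
    (hA : (A : Mat (ZMod p)) = (2 : ZMod p)⁻¹ • pureQ α β g) :
    Permutes (fun i => pureQ α β (v i)) A := by
  intro i
  obtain ⟨j, hj | hj⟩ := hg i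
  · exact ⟨j, Or.inl (conj_halfTurn h2 h hA hj)⟩
  · exact ⟨j, Or.inr ((conj_halfTurn h2 h hA hj).trans (pureQ_neg _))⟩

lemma Permutes.twist {n : ℕ} {F : Fin n → Mat (ZMod p)} {U : Mat (ZMod p)} {g h : SL2 (ZMod p)}
    (hF : Permutes F g) (tg : (g : Mat (ZMod p)).trace = 0) (th : (h : Mat (ZMod p)).trace = 0)
    (e : ((h : Mat (ZMod p)) * U = U * g ∧ (g : Mat (ZMod p)) * U = U * h) ∨
      ((h : Mat (ZMod p)) * U = -(U * g) ∧ (g : Mat (ZMod p)) * U = -(U * h))) :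
    Permutes (fun i => U * F i * U) h := by
  have key : ∀ i, (h : Mat (ZMod p)) * (U * F i * U) * ((h⁻¹ : SL2 (ZMod p)) : Mat (ZMod p)) =
      U * (g * F i * ((g⁻¹ : SL2 (ZMod p)) : Mat (ZMod p))) * U := by
    intro i
    rw [inv_of_trace_zero tg, inv_of_trace_zero th, Matrix.SpecialLinearGroup.coe_neg,
      Matrix.SpecialLinearGroup.coe_neg]
    have l : ∀ X Y : Mat (ZMod p), X * (U * F i * U) * -Y = -(X * U * F i * (U * Y)) := by
      intros; noncomm_ring
    have r : ∀ X Y : Mat (ZMod p), U * (X * F i * -Y) * U = -(U * X * F i * (Y * U)) := by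
      intros; noncomm_ring
    rw [l, r]
    rcases e with ⟨e1, e2⟩ | ⟨e1, e2⟩
    · rw [e1, e2]
    · rw [e1, e2]
      noncomm_ring
  intro i
  obtain ⟨j, hj⟩ := hF i
  refine ⟨j, ?_⟩
  rw [key]
  rcases hj with hj | hj <;> rw [hj]
  · exact Or.inl rfl
  · exact Or.inr (by rw [mul_neg, neg_mul])

end Explicit

section Generation
variable {p : ℕ} [Fact p.Prime] {A B C : SL2 (ZMod p)}

/-- Three elements of order four with prescribed traces of products generate. -/
lemma gen_eq_top_of_traces (hp : 12 < p) (hA : (A : Mat (ZMod p)).trace = 0)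
    (hB : (B : Mat (ZMod p)).trace = 0) (hC : (C : Mat (ZMod p)).trace = 0) {r s t : ZMod p}
    (hr : ((A : Mat (ZMod p)) * B).trace = r) (hs : ((A : Mat (ZMod p)) * C).trace = s)
    (ht : ((B : Mat (ZMod p)) * C).trace = t) (r0 : r ≠ 0) (s0 : s ≠ 0)
    (hG : 4 - (r * s * t + (r * r + (s * s + t * t))) ≠ 0) (hS : ¬ TrS t)
    (hI : ¬ (TrI t ∧ TrI (-(r * s + t)))) : gen {A, B, C} = ⊤ := by
  have h2 := two_ne_zero_of_gt hp
  have hF : ((A : Mat (ZMod p)) * B * C).trace ≠ 0 := fun h => by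
    rw [← trace_mul_mul_sq h2 hA hB hC hr hs ht, h] at hG
    simp at hG
  have hAB : A ≠ B ∧ A ≠ -B := by
    constructor <;> intro e <;> apply hF <;> rw [e]
    · rw [sq_of_trace_zero hB, neg_one_mul, trace_neg, hC, neg_zero]
    · rw [Matrix.SpecialLinearGroup.coe_neg, neg_mul, sq_of_trace_zero hB, neg_neg, one_mul, hC]
  have hBC : B ≠ C ∧ B ≠ -C := by
    constructor <;> intro e <;> apply hF <;> rw [e, mul_assoc]
    · rw [sq_of_trace_zero hC, mul_neg_one, trace_neg, hA, neg_zero]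
    · rw [Matrix.SpecialLinearGroup.coe_neg, neg_mul, sq_of_trace_zero hC, neg_neg, mul_one, hA]
  have acyc : ((B : Mat (ZMod p)) * A * C).trace = -((A : Mat (ZMod p)) * B * C).trace := by
    have := mul_add_mul_of_traceless hB hA
    rw [eq_sub_of_add_eq this, sub_mul, Matrix.smul_mul, one_mul, trace_sub, trace_smul, hC,
      smul_zero, zero_sub]
  have hAC : A ≠ C ∧ A ≠ -C := by
    constructor <;> intro e <;> apply hF <;> rw [← neg_eq_zero, ← acyc, e, mul_assoc]
    · rw [sq_of_trace_zero hC, mul_neg_one, trace_neg, hB, neg_zero]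
    · rw [Matrix.SpecialLinearGroup.coe_neg, neg_mul, sq_of_trace_zero hC, neg_neg, mul_one, hB]
  by_contra hne
  rcases lType_or_exc hp (neg_one_mem_gen _) hne with hL | hE
  · rw [← hr] at r0
    rw [← hs] at s0
    rcases zeros_of_lType h2 hA hB hC hAB hAC hBC hL with h | h | h | h
    exacts [r0 h.1, r0 h.1, s0 h.1, hF h]
  · have mA : A ∈ gen {A, B, C} := subset_gen (by simp)
    have mB : B ∈ gen {A, B, C} := subset_gen (by simp)
    have mC : C ∈ gen {A, B, C} := subset_gen (by simp)
    have h1 : B * C ≠ 1 ∧ B * C ≠ -1 := by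
      constructor <;> intro e <;> apply hF <;>
        rw [mul_assoc, ← Matrix.SpecialLinearGroup.coe_mul, e]
      · rw [Matrix.SpecialLinearGroup.coe_one, mul_one, hA]
      · rw [Matrix.SpecialLinearGroup.coe_neg, Matrix.SpecialLinearGroup.coe_one, mul_neg_one,
          trace_neg, hA, neg_zero]
    have h3 : A⁻¹ * (B * A * C) ≠ 1 ∧ A⁻¹ * (B * A * C) ≠ -1 := by
      constructor <;> intro e <;> apply hF <;> rw [← neg_eq_zero, ← acyc,
        ← Matrix.SpecialLinearGroup.coe_mul, ← Matrix.SpecialLinearGroup.coe_mul,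
        inv_mul_eq_iff_eq_mul.1 e]
      · rw [mul_one, hA]
      · rw [mul_neg_one, Matrix.SpecialLinearGroup.coe_neg, trace_neg, hA, neg_zero]
    have t1 : ((B * C : SL2 (ZMod p)) : Mat (ZMod p)).trace = t := by
      rw [Matrix.SpecialLinearGroup.coe_mul, ht]
    have t3 : ((A⁻¹ * (B * A * C) : SL2 (ZMod p)) : Mat (ZMod p)).trace = -(r * s + t) := by
      rw [inv_of_trace_zero hA]
      simp only [Matrix.SpecialLinearGroup.coe_mul, Matrix.SpecialLinearGroup.coe_neg]
      rw [eq_sub_of_add_eq (mul_add_mul_of_traceless hB hA), sub_mul, mul_sub, Matrix.smul_mul,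
        one_mul, Matrix.mul_smul, ← mul_assoc, ← mul_assoc, neg_mul, neg_mul, neg_mul,
        sq_of_trace_zero hA, neg_one_mul, neg_neg, trace_sub, ht, trace_smul, trace_neg, hs,
        trace_mul_comm (B : Mat (ZMod p)), hr, smul_eq_mul]
      ring
    rcases hE.trST with h | h
    · exact hS (t1 ▸ h _ (mul_mem mB mC) h1.1 h1.2)
    · exact hI ⟨t1 ▸ h _ (mul_mem mB mC) h1.1 h1.2,
        t3 ▸ h _ (mul_mem (inv_mem mA) (mul_mem (mul_mem mB mA) mC)) h3.1 h3.2⟩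

/-- Four half-turns such that `x, a, b` and `x, a, c` preserve finite configurations and `x` is
orthogonal to `b` and `c` contradict the replacement property. -/
theorem not_replacementProperty_of_vectors (hp : 12 < p) (hB : (Coef.badProd : ZMod p) ≠ 0)
    {x a b c u : Fin 3 → ZMod p} (hx : x ⬝ᵥ x = 4) (ha : a ⬝ᵥ a = 4) (hb : b ⬝ᵥ b = 4)
    (hc : c ⬝ᵥ c = 4) (xu : x ⬝ᵥ u = 0) (au : a ⬝ᵥ u = 0) (xb : x ⬝ᵥ b = 0) (xc : x ⬝ᵥ c = 0)
    (hu : (2 * (u ⬝ᵥ b)) • u = (u ⬝ᵥ u) • (b + c)) (u0 : u ⬝ᵥ u ≠ 0)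
    {n : ℕ} (hn : 2 * n < p) {v : Fin n → Fin 3 → ZMod p} (i : Fin n) (hi : v i ⬝ᵥ v i ≠ 0)
    (tx : Turns v x) (ta : Turns v a) (tb : Turns v b) {r s t : ZMod p}
    (hr : a ⬝ᵥ b = -(2 * r)) (hs : a ⬝ᵥ c = -(2 * s)) (ht : b ⬝ᵥ c = -(2 * t))
    (r0 : r ≠ 0) (s0 : s ≠ 0)
    (hG : 4 - (r * s * t + (r * r + (s * s + t * t))) ≠ 0) (hS : ¬ TrS t)
    (hI : ¬ (TrI t ∧ TrI (-(r * s + t)))) : ¬ ReplacementProperty (PSL p) := by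
  have h2 := two_ne_zero_of_gt hp
  obtain ⟨α, β, h⟩ := ZMod.sq_add_sq p (-1)
  obtain ⟨X, hX⟩ := exists_halfTurn h2 h hx
  obtain ⟨A, hA⟩ := exists_halfTurn h2 h ha
  obtain ⟨B, hB'⟩ := exists_halfTurn h2 h hb
  obtain ⟨C, hC⟩ := exists_halfTurn h2 h hc
  have trX := trace_halfTurn hX
  have trA := trace_halfTurn hA
  have trB := trace_halfTurn hB'
  have trC := trace_halfTurn hC
  have prod : ∀ {y z : ZMod p}, y = -(2 * z) → -y / 2 = z := by
    rintro y z rfl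
    field_simp
  have uu : pureQ α β u * pureQ α β u = -(u ⬝ᵥ u) • (1 : Mat (ZMod p)) := by
    apply smul_right_injective _ h2
    have := pureQ_anticomm h u u
    rw [eq_sub_iff_add_eq, ← two_smul (ZMod p)] at this
    simp only [this, smul_smul]
    congr 1
    ring
  have fi : pureQ α β (v i) ≠ 0 := fun e => by
    have := trace_pureQ_mul h (v i) (v i)
    rw [e, zero_mul, trace_zero, eq_comm, neg_eq_zero] at this
    exact mul_ne_zero h2 hi this
  have twist_ne : pureQ α β u * pureQ α β (v i) * pureQ α β u ≠ 0 := fun e => by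
    have e2 : pureQ α β u * (pureQ α β u * pureQ α β (v i) * pureQ α β u) * pureQ α β u = 0 := by
      rw [e, mul_zero, zero_mul]
    rw [← mul_assoc, ← mul_assoc, uu, mul_assoc, uu, Matrix.smul_mul, one_mul, Matrix.mul_smul,
      mul_one, smul_smul] at e2
    exact fi ((smul_eq_zero.1 e2).resolve_left (mul_ne_zero (neg_ne_zero.2 u0) (neg_ne_zero.2 u0)))
  have anti : ∀ {g : Fin 3 → ZMod p} {G : SL2 (ZMod p)},
      (G : Mat (ZMod p)) = (2 : ZMod p)⁻¹ • pureQ α β g → g ⬝ᵥ u = 0 → Turns v g →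
      Permutes (fun j => pureQ α β u * pureQ α β (v j) * pureQ α β u) G := by
    intro g G hG gu tg
    refine (tg.permutes h2 h hG).twist (trace_halfTurn hG) (trace_halfTurn hG) (Or.inr ⟨?_, ?_⟩)
    all_goals exact halfTurn_mul_pureQ h hG gu
  have twC : Permutes (fun j => pureQ α β u * pureQ α β (v j) * pureQ α β u) C := by
    refine (tb.permutes h2 h hB').twist trB trC (Or.inl ⟨?_, ?_⟩)
    · exact halfTurn_mul_pureQ_of_image h2 h hB' hC hu u0
    · refine halfTurn_mul_pureQ_of_image h2 h hC hB' ?_ u0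
      have : u ⬝ᵥ c = u ⬝ᵥ b := by
        have := congrArg (fun w => u ⬝ᵥ w) hu
        simp only [dotProduct_smul, dotProduct_add, smul_eq_mul] at this
        apply mul_left_cancel₀ u0
        linear_combination -this
      rw [this, hu, add_comm]
  refine not_replacementProperty_of_triple hp hB (x := X) (a := A) (b := B) (c := C) ?_ ?_ ?_ ?_ ?_
  · constructor <;> intro e <;> rw [e] at trX
    · rw [Matrix.SpecialLinearGroup.coe_one, trace_one_two] at trX
      exact h2 trX
    · rw [Matrix.SpecialLinearGroup.coe_neg, Matrix.SpecialLinearGroup.coe_one, trace_neg,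
        trace_one_two, neg_eq_zero] at trX
      exact h2 trX
  · refine gen_eq_top_of_traces hp trA trB trC ?_ ?_ ?_ r0 s0 hG hS hI
    · rw [trace_halfTurn_mul h2 h hA hB', prod hr]
    · rw [trace_halfTurn_mul h2 h hA hC, prod hs]
    · rw [trace_halfTurn_mul h2 h hB' hC, prod ht]
  · refine gen_ne_top_of_permutes h2 hn (fun j => trace_pureQ (α := α) (β := β) (v j)) i fi ?_
    rintro g (rfl | rfl | rfl)
    exacts [⟨trX, tx.permutes h2 h hX⟩, ⟨trA, ta.permutes h2 h hA⟩, ⟨trB, tb.permutes h2 h hB'⟩]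
  · refine gen_ne_top_of_permutes h2 hn
      (F := fun j => pureQ α β u * pureQ α β (v j) * pureQ α β u) (fun j => ?_) i twist_ne ?_
    · rw [trace_mul_comm, ← mul_assoc, uu, Matrix.smul_mul, one_mul, trace_smul, trace_pureQ,
        smul_zero]
    · rintro g (rfl | rfl | rfl)
      exacts [⟨trX, anti hX xu tx⟩, ⟨trA, anti hA au ta⟩, ⟨trC, twC⟩]
  · intro e
    apply not_lType_top h2 (K := ZMod p)
    rw [← e]
    apply lType_of_orthogonal trX trB trC
    · rw [trace_halfTurn_mul h2 h hX hB', xb, neg_zero, zero_div]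
    · rw [trace_halfTurn_mul h2 h hX hC, xc, neg_zero, zero_div]

end Generation

section Octahedral
variable {p : ℕ} [Fact p.Prime]

/-- The case where `2` is a square. -/
theorem not_replacementProperty_of_sq_eq_two (hp : 12 < p) (hB : (Coef.badProd : ZMod p) ≠ 0)
    {s : ZMod p} (hs : s ^ 2 = 2) : ¬ ReplacementProperty (PSL p) := by
  have n2 : (2 : ZMod p) ≠ 0 := two_ne_zero_of_gt hp
  have n3 : (3 : ZMod p) ≠ 0 := by
    exact_mod_cast natCast_ne_zero_of_lt (p := p) (n := 3) (by norm_num) (by omega)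
  have n5 : (5 : ZMod p) ≠ 0 := by
    exact_mod_cast natCast_ne_zero_of_lt (p := p) (n := 5) (by norm_num) (by omega)
  have n7 : (7 : ZMod p) ≠ 0 := by
    exact_mod_cast natCast_ne_zero_of_lt (p := p) (n := 7) (by norm_num) (by omega)
  have n11 : (11 : ZMod p) ≠ 0 := by
    exact_mod_cast natCast_ne_zero_of_lt (p := p) (n := 11) (by norm_num) (by omega)
  obtain ⟨k, hk⟩ : ∃ k : ZMod p, 3 * k = 2 := ⟨2 / 3, by field_simp⟩
  have s0 : s ≠ 0 := by
    rintro rfl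
    exact n2 (by linear_combination -hs)
  refine not_replacementProperty_of_vectors hp hB (x := ![s, -s, 0]) (a := ![s, 0, -s])
    (b := ![0, 0, 2]) (c := ![2 * k, 2 * k, -k]) (u := ![1, 1, 1]) (n := 3)
    (v := ![![1, 0, 0], ![0, 1, 0], ![0, 0, 1]]) (r := s) (s := -s) (t := k)
    ?_ ?_ ?_ ?_ ?_ ?_ ?_ ?_ ?_ ?_ (by omega) 0 ?_ ?_ ?_ ?_ ?_ ?_ ?_ s0 (neg_ne_zero.2 s0) ?_ ?_ ?_
  case refine_11 => simp
  case refine_12 =>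
    intro i
    fin_cases i
    · exact ⟨1, Or.inr (by ext c; fin_cases c <;> simp <;> grind)⟩
    · exact ⟨0, Or.inr (by ext c; fin_cases c <;> simp <;> grind)⟩
    · exact ⟨2, Or.inr (by ext c; fin_cases c <;> simp)⟩
  case refine_13 =>
    intro i
    fin_cases i
    · exact ⟨2, Or.inr (by ext c; fin_cases c <;> simp <;> grind)⟩
    · exact ⟨1, Or.inr (by ext c; fin_cases c <;> simp)⟩
    · exact ⟨0, Or.inr (by ext c; fin_cases c <;> simp <;> grind)⟩
  case refine_14 =>
    intro i
    fin_cases i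
    · exact ⟨0, Or.inr (by ext c; fin_cases c <;> simp)⟩
    · exact ⟨1, Or.inr (by ext c; fin_cases c <;> simp)⟩
    · exact ⟨2, Or.inl (by ext c; fin_cases c <;> simp; grind)⟩
  case refine_9 => ext c; fin_cases c <;> simp <;> grind
  case refine_18 =>
    intro h
    apply mul_ne_zero n2 (mul_ne_zero n2 n2)
    linear_combination 9 * h + (18 - 9 * k) * hs + (3 * k - 4) * hk
  case refine_19 =>
    rintro (h | h | h)
    · grind
    · grind
    · exact mul_ne_zero n2 n7 (by linear_combination (3 * k + 2) * hk - 9 * h)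
  case refine_20 => rintro ⟨h | h | h | h, -⟩ <;> grind
  all_goals simp
  all_goals grind

end Octahedral

section Icosahedral
variable {p : ℕ} [Fact p.Prime]

/-- The case where `5` is a square. -/
theorem not_replacementProperty_of_sq_eq_add_one (hp : 12 < p)
    (hB : (Coef.badProd : ZMod p) ≠ 0) {f : ZMod p} (hf : f ^ 2 = f + 1) :
    ¬ ReplacementProperty (PSL p) := by
  have n2 : (2 : ZMod p) ≠ 0 := two_ne_zero_of_gt hp
  have n3 : (3 : ZMod p) ≠ 0 := by
    exact_mod_cast natCast_ne_zero_of_lt (p := p) (n := 3) (by norm_num) (by omega)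
  have n5 : (5 : ZMod p) ≠ 0 := by
    exact_mod_cast natCast_ne_zero_of_lt (p := p) (n := 5) (by norm_num) (by omega)
  have n11 : (11 : ZMod p) ≠ 0 := by
    exact_mod_cast natCast_ne_zero_of_lt (p := p) (n := 11) (by norm_num) (by omega)
  have n19 : (19 : ZMod p) ≠ 0 := fun h => hB (by
    rw [Coef.badProd]; push_cast; linear_combination 71610 * h)
  have n31 : (31 : ZMod p) ≠ 0 := fun h => hB (by
    rw [Coef.badProd]; push_cast; linear_combination 43890 * h)
  obtain ⟨k, hk⟩ : ∃ k : ZMod p, 3 * k = 2 := ⟨2 / 3, by field_simp⟩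
  obtain ⟨q, rfl⟩ : ∃ q, f = q + 1 := ⟨f - 1, by ring⟩
  have f0 : q + 1 ≠ 0 := by
    intro h
    rw [h] at hf
    norm_num at hf
  have e1 : 3 * (k * (2 * q + 1)) = 4 * q + 2 := by
    linear_combination (2 * q + 1) * hk
  have e2 : 9 * (k * (2 * q + 1)) ^ 2 = 20 := by
    linear_combination (3 * (k * (2 * q + 1)) + 4 * q + 2) * e1 + 16 * hf
  refine not_replacementProperty_of_vectors hp hB (x := ![q + 1, -1, -q])
    (a := ![-q, q + 1, -1]) (b := ![q, q + 1, -1])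
    (c := ![2 * k * q - q, 2 * k * q - (q + 1), 2 * k * q + 1]) (u := ![1, 1, 1]) (n := 6)
    (v := ![![0, 1, q + 1], ![0, -1, q + 1], ![1, q + 1, 0],
      ![-1, q + 1, 0], ![q + 1, 0, 1], ![q + 1, 0, -1]])
    (r := -(q + 1)) (s := q + 1) (t := k * (2 * q + 1))
    ?_ ?_ ?_ ?_ ?_ ?_ ?_ ?_ ?_ ?_ (by omega) 0 ?_ ?_ ?_ ?_ ?_ ?_ ?_ (neg_ne_zero.2 f0) f0 ?_ ?_ ?_
  case refine_9 => ext c; fin_cases c <;> simp <;> grind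
  case refine_12 =>
    intro i
    fin_cases i
    · exact ⟨4, Or.inr (by ext c; fin_cases c <;> simp <;> grind)⟩
    · exact ⟨1, Or.inr (by ext c; fin_cases c <;> simp <;> grind)⟩
    · exact ⟨2, Or.inr (by ext c; fin_cases c <;> simp)⟩
    · exact ⟨5, Or.inr (by ext c; fin_cases c <;> simp <;> grind)⟩
    · exact ⟨0, Or.inr (by ext c; fin_cases c <;> simp <;> grind)⟩
    · exact ⟨3, Or.inr (by ext c; fin_cases c <;> simp <;> grind)⟩
  case refine_13 =>
    intro i
    fin_cases i
    · exact ⟨0, Or.inr (by ext c; fin_cases c <;> simp)⟩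
    · exact ⟨3, Or.inr (by ext c; fin_cases c <;> simp <;> grind)⟩
    · exact ⟨4, Or.inr (by ext c; fin_cases c <;> simp <;> grind)⟩
    · exact ⟨1, Or.inr (by ext c; fin_cases c <;> simp <;> grind)⟩
    · exact ⟨2, Or.inr (by ext c; fin_cases c <;> simp <;> grind)⟩
    · exact ⟨5, Or.inr (by ext c; fin_cases c <;> simp <;> grind)⟩
  case refine_14 =>
    intro i
    fin_cases i
    · exact ⟨0, Or.inr (by ext c; fin_cases c <;> simp)⟩
    · exact ⟨2, Or.inr (by ext c; fin_cases c <;> simp <;> grind)⟩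
    · exact ⟨1, Or.inr (by ext c; fin_cases c <;> simp <;> grind)⟩
    · exact ⟨5, Or.inl (by ext c; fin_cases c <;> simp <;> grind)⟩
    · exact ⟨4, Or.inr (by ext c; fin_cases c <;> simp <;> grind)⟩
    · exact ⟨3, Or.inl (by ext c; fin_cases c <;> simp <;> grind)⟩
  case refine_18 =>
    intro h
    refine mul_ne_zero n2 n2 ?_
    linear_combination 9 * h + (6 - 9 * (k * (2 * q + 1))) * hf - 3 * (q + 2) * e1 + e2
  case refine_19 =>
    rintro (h | h | h)
    · refine mul_ne_zero n2 (mul_ne_zero n2 n5) ?_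
      linear_combination 9 * (k * (2 * q + 1)) * h - e2
    · exact n11 (by linear_combination 9 * h - e2)
    · exact n2 (by linear_combination 9 * h - e2)
  case refine_20 =>
    rintro ⟨-, h⟩
    have e3 : 3 * (-(-(q + 1) * (q + 1) + k * (2 * q + 1))) = 4 - q := by
      linear_combination 3 * hf - e1
    generalize -(-(q + 1) * (q + 1) + k * (2 * q + 1)) = y at h e3
    have e4 : 9 * y ^ 2 = 17 - 9 * q := by
      linear_combination (3 * y + 4 - q) * e3 + hf
    rcases h with h | h | h | h
    · have e : q = 4 := by linear_combination e3 - 3 * h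
      subst e
      exact n19 (by linear_combination hf)
    · have e : 9 * q = 8 := by linear_combination e4 - 9 * h
      refine mul_ne_zero n5 n11 ?_
      linear_combination 81 * hf - (9 * q + 17) * e
    · have e : 3 * q = -2 := by
        apply mul_left_cancel₀ n2
        linear_combination e4 - 9 * h - 3 * e3
      exact n11 (by linear_combination (3 * q + 1) * e - 9 * hf)
    · have e : 3 * q = 5 := by
        apply mul_left_cancel₀ (mul_ne_zero n2 n2)
        linear_combination e4 - 9 * h + 3 * e3
      exact n31 (by linear_combination 9 * hf - (3 * q + 8) * e)
  all_goals simp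
  all_goals grind

end Icosahedral
end PSLRep

theorem psl_replacement_property_fails (p : ℕ) [Fact p.Prime] (hp : 5 < p)
    (h7 : p ≠ 7) (h11 : p ≠ 11) (h19 : p ≠ 19) (h31 : p ≠ 31)
    (h : (p % 8 = 1 ∨ p % 8 = 7) ∨ (p % 10 = 1 ∨ p % 10 = 9)) :
    ¬ ReplacementProperty (PSL p) := by
  have hprime : p.Prime := Fact.out
  have h12 : 12 < p := by
    by_contra hle
    interval_cases p <;> first | omega | exact absurd hprime (by norm_num)
  have hB : (PSLRep.Coef.badProd : ZMod p) ≠ 0 := by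
    rw [Ne, ZMod.natCast_eq_zero_iff, PSLRep.Coef.badProd]
    simp only [hprime.dvd_mul, Nat.prime_dvd_prime_iff_eq hprime Nat.prime_two,
      Nat.prime_dvd_prime_iff_eq hprime Nat.prime_three,
      Nat.prime_dvd_prime_iff_eq hprime Nat.prime_five,
      Nat.prime_dvd_prime_iff_eq hprime (by norm_num : Nat.Prime 7),
      Nat.prime_dvd_prime_iff_eq hprime (by norm_num : Nat.Prime 11),
      Nat.prime_dvd_prime_iff_eq hprime (by norm_num : Nat.Prime 19),
      Nat.prime_dvd_prime_iff_eq hprime (by norm_num : Nat.Prime 31)]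
    omega
  rcases h with h | h
  · obtain ⟨s, hs⟩ := (ZMod.exists_sq_eq_two_iff (by omega)).2 h
    exact PSLRep.not_replacementProperty_of_sq_eq_two h12 hB (s := s) (by rw [hs, sq])
  · have : Fact (Nat.Prime 5) := ⟨Nat.prime_five⟩
    obtain ⟨r, hr⟩ := (ZMod.exists_sq_eq_prime_iff_of_mod_four_eq_one (p := 5) (q := p) rfl
      (by omega)).1 (by
        rcases (by omega : p % 5 = 1 ∨ p % 5 = 4) with h5 | h5
        · exact ⟨1, by rw [← ZMod.natCast_mod, h5]; rfl⟩
        · exact ⟨2, by rw [← ZMod.natCast_mod, h5]; rfl⟩)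
    refine PSLRep.not_replacementProperty_of_sq_eq_add_one h12 hB (f := (1 + r) / 2) ?_
    have h2 := PSLRep.two_ne_zero_of_gt h12
    push_cast at hr
    field_simp
    linear_combination -hr
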